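/- For every k ∈ ℕ and every compact interval [a,b] ⊂ (p_k, 1/2), there exist φ, ψ ∈ (0, π/2) and ε > 0 such that for all p, p' ∈ [a,b] with p < p' and |p' − p| ≤ ε, the critical function of anisotropic bond percolation on the slab S^k satisfies |p'−p| tan φ ≤ |q_c(p') − q_c(p)| ≤ |p'−p| tan ψ. -/

import Mathlib

open MeasureTheory Set
open scoped ENNReal

namespace AnisoSlab

/-! ### A concrete construction of countable products of Bernoulli measures

The product Bernoulli measure on `ι → Bool` (each coordinate `i` open with
probability `P i`, independently) is realized as the pushforward of Lebesgue
measure on `[0,1)`: the binary digits of a uniform sample are i.i.d. fair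
coins; regrouping them along a pairing function yields countably many
independent uniform samples, and comparing the `i`-th sample with `P i`
yields the desired independent Bernoulli coordinates. -/

/-- The `n`-th binary digit of `x` (digits after the binary point). -/
noncomputable def binDigit (n : ℕ) (x : ℝ) : Bool :=
  decide (⌊x * 2 ^ (n + 1)⌋ % 2 = 1)

/-- Countably many independent uniform-`[0,1]` samples extracted from a single
uniform sample `x` on `[0,1)`, by regrouping its binary digits. -/
noncomputable def unifSample (i : ℕ) (x : ℝ) : ℝ :=
  ∑' n : ℕ, if binDigit (Nat.pair i n) x then ((2 : ℝ) ^ (n + 1))⁻¹ else 0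

/-- The product Bernoulli measure on `ι → Bool`, coordinate `i` being `true`
with probability `P i`, independently over `i`. -/
noncomputable def bernoulliProduct {ι : Type*} [Encodable ι] (P : ι → ℝ) :
    Measure (ι → Bool) :=
  Measure.map (fun x i => decide (unifSample (Encodable.encode i) x < P i))
    (volume.restrict (Set.Ico (0 : ℝ) 1))

/-! ### The slab `S^k` and anisotropic bond percolation on it -/

/-- Ambient vertices: `ℤ³`; the slab `S^k` uses those with third coordinate in `{0, …, k}`. -/
abbrev Vtx : Type := ℤ × ℤ × ℤ

/-- The three unit coordinate vectors. -/
def dvec : Fin 3 → Vtx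
  | 0 => (1, 0, 0)
  | 1 => (0, 1, 0)
  | 2 => (0, 0, 1)

/-- A bond is indexed by its lower endpoint `v` and a direction `i`; it joins
`v` to `v + dvec i`. Directions `0, 1` give radial (horizontal) bonds, and
direction `2` gives axial (vertical) bonds. -/
abbrev EdgeIdx : Type := Vtx × Fin 3

/-- A percolation configuration: each bond is open (`true`) or closed (`false`). -/
abbrev Config : Type := EdgeIdx → Bool

/-- `v` is a vertex of the slab `S^k`. -/
def InSlab (k : ℕ) (v : Vtx) : Prop := 0 ≤ v.2.2 ∧ v.2.2 ≤ k

/-- `(v, i)` is a bond of the slab `S^k` (both endpoints lie in the slab). -/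
def IsEdge (k : ℕ) (e : EdgeIdx) : Prop := InSlab k e.1 ∧ InSlab k (e.1 + dvec e.2)

/-- The measure `P_{p,q}` on configurations of `S^k`: each radial (horizontal)
bond is open with probability `p` and each axial (vertical) bond is open with
probability `q`, independently. -/
noncomputable def slabMeasure (k : ℕ) (p q : ℝ) : Measure Config :=
  bernoulliProduct (fun e => if e.2 = 2 then q else p)

/-- `x` and `y` are joined by an open bond of `S^k` in the configuration `ω`. -/
def OpenAdj (k : ℕ) (ω : Config) (x y : Vtx) : Prop :=
  ∃ i : Fin 3,
    (y = x + dvec i ∧ IsEdge k (x, i) ∧ ω (x, i) = true) ∨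
    (x = y + dvec i ∧ IsEdge k (y, i) ∧ ω (y, i) = true)

/-- The open cluster of the vertex `x` in the configuration `ω`. -/
def cluster (k : ℕ) (ω : Config) (x : Vtx) : Set Vtx :=
  {y | Relation.ReflTransGen (OpenAdj k ω) x y}

/-- The percolation function `θ(p,q) = P_{p,q}(0 ↔ ∞)`. -/
noncomputable def theta (k : ℕ) (p q : ℝ) : ℝ≥0∞ :=
  slabMeasure k p q {ω | (cluster k ω 0).Infinite}

/-- `p_k = 1 - (1/2)^{1/(k+1)}`, the horizontal critical value at `q = 1`. -/
noncomputable def pCrit (k : ℕ) : ℝ := 1 - (1 / 2 : ℝ) ^ ((1 : ℝ) / (k + 1))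

/-- The critical curve `q_c(p) = sup {q ∈ [0,1] : θ(p,q) = 0}`. -/
noncomputable def qc (k : ℕ) (p : ℝ) : ℝ :=
  sSup {q : ℝ | q ∈ Set.Icc (0 : ℝ) 1 ∧ theta k p q = 0}

/-- The critical curve `p_c(q) = sup {p ∈ [0,1] : θ(p,q) = 0}`. -/
noncomputable def pc (k : ℕ) (q : ℝ) : ℝ :=
  sSup {p : ℝ | p ∈ Set.Icc (0 : ℝ) 1 ∧ theta k p q = 0}


section
open ProbabilityTheory

/-! ### Identification of the concrete measure with the product measure -/

/-- Uniform measure on `[0,1)`. -/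
noncomputable def unifM : Measure ℝ := volume.restrict (Set.Ico (0 : ℝ) 1)

instance : IsProbabilityMeasure unifM := ⟨by simp [unifM]⟩

lemma measurable_decide_lt (p : ℝ) : Measurable (fun x : ℝ => decide (x < p)) :=
  measurable_to_bool (by
    have : (fun x : ℝ => decide (x < p)) ⁻¹' {true} = Set.Iio p := by ext; simp
    rw [this]; exact measurableSet_Iio)

/-- Bernoulli measure on `Bool` (with the parameter clamped to `[0,1]`). -/
noncomputable def bm (p : ℝ) : Measure Bool := unifM.map (fun x => decide (x < p))

instance (p : ℝ) : IsProbabilityMeasure (bm p) :=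
  Measure.isProbabilityMeasure_map (measurable_decide_lt p).aemeasurable

lemma bm_true {p : ℝ} (h0 : 0 ≤ p) (h1 : p ≤ 1) : (bm p).real {true} = p := by
  rw [Measure.real, bm, Measure.map_apply (measurable_decide_lt p) (by simp)]
  have : (fun x : ℝ => decide (x < p)) ⁻¹' {true} = Set.Iio p := by ext; simp
  rw [this, unifM, Measure.restrict_apply measurableSet_Iio]
  have : Set.Iio p ∩ Set.Ico 0 1 = Set.Ico 0 p := by
    ext x; simp only [mem_inter_iff, mem_Iio, mem_Ico]; constructor
    · rintro ⟨a, b, c⟩; exact ⟨b, a⟩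
    · rintro ⟨a, b⟩; exact ⟨b, a, by linarith⟩
  rw [this]; simp [h0]

lemma bm_false {p : ℝ} (h0 : 0 ≤ p) (h1 : p ≤ 1) : (bm p).real {false} = 1 - p := by
  have : ({false} : Set Bool) = {true}ᶜ := by ext x; cases x <;> simp
  rw [this, probReal_compl_eq_one_sub (by simp), bm_true h0 h1]

/-- The product Bernoulli measure. -/
noncomputable def bern {E : Type*} (P : E → ℝ) : Measure (E → Bool) :=
  Measure.infinitePi (fun e => bm (P e))

instance {E : Type*} (P : E → ℝ) : IsProbabilityMeasure (bern P) := by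
  unfold bern; infer_instance

lemma infinitePi_map_inj {ι κ X : Type*} [MeasurableSpace X] (μ : κ → Measure X)
    [∀ i, IsProbabilityMeasure (μ i)] (f : ι → κ) (hf : Function.Injective f) :
    (Measure.infinitePi μ).map (fun x i => x (f i)) = Measure.infinitePi (fun i => μ (f i)) := by
  classical
  refine Measure.eq_infinitePi _ fun s t ht => ?_
  rw [Measure.map_apply (by fun_prop) (.pi s.countable_toSet fun _ _ => ht _)]
  have : (fun (x : κ → X) i => x (f i)) ⁻¹' ((s : Set ι).pi t) =
      ((s.map ⟨f, hf⟩ : Finset κ) : Set κ).pi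
        (fun j => if h : ∃ i, f i = j then t h.choose else univ) := by
    ext x
    simp only [mem_preimage, Set.mem_pi, Finset.mem_coe, Finset.coe_map,
      Function.Embedding.coeFn_mk, mem_image, forall_exists_index, and_imp,
      forall_apply_eq_imp_iff₂]
    refine forall₂_congr fun i _ => ?_
    have h : ∃ i', f i' = f i := ⟨i, rfl⟩
    rw [dif_pos h, hf h.choose_spec]
  rw [this, Measure.infinitePi_pi, Finset.prod_map]
  · refine Finset.prod_congr rfl fun i _ => ?_
    have h : ∃ i', f i' = f i := ⟨i, rfl⟩
    simp only [Function.Embedding.coeFn_mk]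
    rw [dif_pos h, hf h.choose_spec]
  · intro j _
    split_ifs
    · exact ht _
    · exact .univ

/-- All binary digits. -/
noncomputable def digs (x : ℝ) : ℕ → Bool := fun n => binDigit n x

lemma measurable_binDigit (n : ℕ) : Measurable (binDigit n) := by
  unfold binDigit
  refine measurable_to_bool ?_
  have : Measurable (fun x : ℝ => ⌊x * 2 ^ (n + 1)⌋ % 2) := by
    have h : Measurable (fun x : ℝ => ⌊x * 2 ^ (n + 1)⌋) :=
      Int.measurable_floor.comp (by fun_prop)
    exact (measurable_from_top (f := fun z : ℤ => z % 2)).comp h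
  have h2 := this (measurableSet_singleton (1 : ℤ))
  convert h2 using 1
  ext x; simp

lemma measurable_digs : Measurable digs := measurable_pi_lambda _ measurable_binDigit

/-- The integer with prescribed binary digits. -/
def dyadIdx (b : ℕ → Bool) : ℕ → ℤ
  | 0 => 0
  | n + 1 => 2 * dyadIdx b n + (if b n then 1 else 0)

lemma floor_two_mul_div (y : ℝ) : ⌊y * 2⌋ / 2 = ⌊y⌋ := by
  have h1 := Int.floor_le y
  have h2 := Int.lt_floor_add_one y
  have h3 : 2 * ⌊y⌋ ≤ ⌊y * 2⌋ := Int.le_floor.2 (by push_cast; linarith)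
  have h4 : ⌊y * 2⌋ < 2 * ⌊y⌋ + 2 := Int.floor_lt.2 (by push_cast; linarith)
  omega

lemma digs_cyl (b : ℕ → Bool) (n : ℕ) (x : ℝ) :
    (x ∈ Set.Ico (0 : ℝ) 1 ∧ ∀ i < n, binDigit i x = b i) ↔ ⌊x * 2 ^ n⌋ = dyadIdx b n := by
  induction n with
  | zero => simp [dyadIdx, Int.floor_eq_zero_iff]
  | succ n ih =>
    have h := floor_two_mul_div (x * 2 ^ n)
    have h' : x * 2 ^ n * 2 = x * 2 ^ (n + 1) := by ring
    rw [h'] at h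
    have key : binDigit n x = b n ↔ ⌊x * 2 ^ (n + 1)⌋ % 2 = (if b n then 1 else 0) := by
      unfold binDigit
      cases b n <;> simp
    constructor
    · rintro ⟨h1, h2⟩
      have h3 := ih.1 ⟨h1, fun i hi => h2 i (by omega)⟩
      have h4 := key.1 (h2 n (by omega))
      simp only [dyadIdx]
      omega
    · intro h1
      simp only [dyadIdx] at h1
      have h2 : ⌊x * 2 ^ n⌋ = dyadIdx b n := by split_ifs at h1 <;> omega
      obtain ⟨h3, h4⟩ := ih.2 h2
      refine ⟨h3, fun i hi => ?_⟩
      rcases Nat.lt_succ_iff_lt_or_eq.1 hi with hi | rfl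
      · exact h4 i hi
      · rw [key]; split_ifs at h1 ⊢ <;> omega

lemma vol_digs_cyl (b : ℕ → Bool) (n : ℕ) :
    unifM {x | ∀ i < n, binDigit i x = b i} = (2⁻¹ : ℝ≥0∞) ^ n := by
  have hm : MeasurableSet {x | ∀ i < n, binDigit i x = b i} := by
    have : {x | ∀ i < n, binDigit i x = b i} = ⋂ i ∈ Set.Iio n, binDigit i ⁻¹' {b i} := by
      ext; simp
    rw [this]
    exact MeasurableSet.biInter (Set.to_countable _) fun i _ =>
      measurable_binDigit i (measurableSet_singleton _)
  rw [unifM, Measure.restrict_apply hm]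
  have : {x | ∀ i < n, binDigit i x = b i} ∩ Set.Ico 0 1 =
      Set.Ico ((dyadIdx b n : ℝ) / 2 ^ n) ((dyadIdx b n + 1 : ℝ) / 2 ^ n) := by
    ext x
    have := digs_cyl b n x
    rw [inter_comm, mem_inter_iff, Set.mem_ofPred_eq, this, Int.floor_eq_iff, mem_Ico,
      div_le_iff₀ (by positivity), lt_div_iff₀ (by positivity)]
  rw [this, Real.volume_Ico]
  have : ((dyadIdx b n + 1 : ℝ) / 2 ^ n) - (dyadIdx b n : ℝ) / 2 ^ n = (2⁻¹) ^ n := by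
    field_simp; simp
  rw [this, ENNReal.ofReal_pow (by norm_num)]
  congr 1
  rw [ENNReal.ofReal_inv_of_pos (by norm_num)]; simp

lemma bm_half (b : Bool) : bm (1/2) {b} = 2⁻¹ := by
  have h : (bm (1/2)).real {b} = 1/2 := by
    cases b
    · rw [bm_false] <;> norm_num
    · rw [bm_true] <;> norm_num
  rw [← ENNReal.ofReal_toReal (measure_ne_top (bm (1/2)) {b})]
  rw [Measure.real] at h
  rw [h, one_div, ENNReal.ofReal_inv_of_pos (by norm_num)]; simp

lemma map_digs : unifM.map digs = Measure.infinitePi (fun _ : ℕ => bm (1/2)) := by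
  have : IsProbabilityMeasure (unifM.map digs) :=
    Measure.isProbabilityMeasure_map measurable_digs.aemeasurable
  have key : ∀ n : ℕ, (unifM.map digs).map ((Finset.range n).restrict (π := fun _ => Bool)) =
      (Measure.infinitePi (fun _ : ℕ => bm (1/2))).map ((Finset.range n).restrict (π := fun _ => Bool)) := by
    intro n
    refine Measure.ext_of_singleton fun b => ?_
    let b' : ℕ → Bool := fun i => if h : i ∈ Finset.range n then b ⟨i, h⟩ else false
    have hb : ((Finset.range n).restrict (π := fun _ => Bool)) ⁻¹' {b} =
        ((Finset.range n : Finset ℕ) : Set ℕ).pi (fun i => {b' i}) := by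
      ext x
      simp only [mem_preimage, mem_singleton_iff, funext_iff, Finset.restrict, Subtype.forall,
        Set.mem_pi, Finset.mem_coe, b']
      refine forall₂_congr fun i hi => ?_
      rw [dif_pos hi]
    rw [Measure.map_apply (Finset.measurable_restrict _) (by simp), Measure.map_apply (Finset.measurable_restrict _) (by simp), hb,
      Measure.infinitePi_pi _ (by simp), Measure.map_apply measurable_digs
        (.pi (Finset.countable_toSet _) (by simp))]
    have : digs ⁻¹' ((Finset.range n : Finset ℕ) : Set ℕ).pi (fun i => {b' i}) =
        {x | ∀ i < n, binDigit i x = b' i} := by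
      ext; simp [digs]
    rw [this, vol_digs_cyl]
    rw [Finset.prod_congr rfl fun i _ => bm_half (b' i)]
    simp
  refine Measure.eq_infinitePi _ fun s t ht => ?_
  obtain ⟨n, hn⟩ : ∃ n, s ⊆ Finset.range n := by
    refine ⟨s.sup id + 1, fun i hi => ?_⟩
    have := Finset.le_sup (f := id) hi
    simp only [id] at this
    simp; omega
  have hpre : (s : Set ℕ).pi t = ((Finset.range n).restrict (π := fun _ => Bool)) ⁻¹'
      {y | ∀ i (h : i ∈ s), y ⟨i, hn h⟩ ∈ t i} := by
    ext x; simp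
  have hmeas : MeasurableSet {y : (Finset.range n) → Bool | ∀ i (h : i ∈ s), y ⟨i, hn h⟩ ∈ t i} :=
    (Set.toFinite _).measurableSet
  rw [hpre, ← Measure.map_apply (Finset.measurable_restrict _) hmeas, key, Measure.map_apply (Finset.measurable_restrict _) hmeas,
    ← hpre, Measure.infinitePi_pi _ (fun i _ => ht i)]

/-- Value of a binary expansion. -/
noncomputable def binVal (b : ℕ → Bool) : ℝ :=
  ∑' n : ℕ, if b n then ((2 : ℝ) ^ (n + 1))⁻¹ else 0

lemma measurable_binVal : Measurable binVal := by
  have hs : ∀ b : ℕ → Bool, Summable fun n : ℕ => if b n then ((2 : ℝ) ^ (n + 1))⁻¹ else 0 := by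
    intro b
    refine Summable.of_nonneg_of_le (fun n => by split_ifs <;> positivity)
      (fun n => ?_) (summable_geometric_two)
    split_ifs
    · rw [pow_succ, mul_inv, one_div, inv_pow]
      have : (0:ℝ) < (2 ^ n)⁻¹ := by positivity
      linarith
    · positivity
  have hlim : ∀ b, Filter.Tendsto (fun N => ∑ n ∈ Finset.range N,
      if b n then ((2 : ℝ) ^ (n + 1))⁻¹ else 0) Filter.atTop (nhds (binVal b)) :=
    fun b => (hs b).hasSum.tendsto_sum_nat
  refine measurable_of_tendsto_metrizable (f := fun N (b : ℕ → Bool) => ∑ n ∈ Finset.range N,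
      if b n then ((2 : ℝ) ^ (n + 1))⁻¹ else 0) (fun N => ?_) (tendsto_pi_nhds.2 hlim)
  refine Finset.measurable_sum _ fun n _ => ?_
  refine Measurable.ite ?_ measurable_const measurable_const
  exact (measurable_pi_apply (X := fun _ : ℕ => Bool) n) (measurableSet_singleton true)

lemma binVal_digs {x : ℝ} (hx : x ∈ Set.Ico (0 : ℝ) 1) : binVal (digs x) = x := by
  have h := Real.ofDigits_digits (b := 2) (by norm_num) hx
  rw [← h]
  conv_rhs => rw [Real.ofDigits]
  rw [h, binVal]
  refine tsum_congr fun n => ?_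
  unfold Real.ofDigitsTerm Real.digits digs binDigit
  have h1 : (0:ℝ) ≤ x * 2 ^ (n+1) := by have := hx.1; positivity
  have h2 : ⌊x * 2 ^ (n+1)⌋ = (⌊x * 2 ^ (n+1)⌋₊ : ℤ) := (Int.natCast_floor_eq_floor h1).symm
  have h3 : ((Fin.ofNat 2 ⌊x * 2 ^ (n+1)⌋₊ : Fin 2) : ℕ) = ⌊x * 2 ^ (n+1)⌋₊ % 2 := by
    simp [Fin.ofNat]
  push_cast
  rw [h3, h2]
  rcases Nat.mod_two_eq_zero_or_one ⌊x * 2 ^ (n+1)⌋₊ with h4 | h4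
  · have h5 : ((⌊x * 2 ^ (n+1)⌋₊ : ℤ)) % 2 ≠ 1 := by omega
    simp [h4, h5]
  · have h5 : ((⌊x * 2 ^ (n+1)⌋₊ : ℤ)) % 2 = 1 := by omega
    simp [h4, h5]

lemma map_binVal : (Measure.infinitePi (fun _ : ℕ => bm (1/2))).map binVal = unifM := by
  rw [← map_digs, Measure.map_map measurable_binVal measurable_digs]
  have : (binVal ∘ digs) =ᵐ[unifM] id := by
    filter_upwards [ae_restrict_mem measurableSet_Ico] with x hx
    exact binVal_digs hx
  rw [Measure.map_congr this, Measure.map_id]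

lemma map_unifSample : unifM.map (fun x (i : ℕ) => unifSample i x) =
    Measure.infinitePi (fun _ : ℕ => unifM) := by
  have h1 : (fun x (i : ℕ) => unifSample i x) =
      (fun (c : ℕ → ℕ → Bool) i => binVal (c i)) ∘ (MeasurableEquiv.curry ℕ ℕ Bool) ∘
        (fun (b : ℕ → Bool) (p : ℕ × ℕ) => b (Nat.pairEquiv p)) ∘ digs := by
    funext x i
    simp [unifSample, binVal, digs, MeasurableEquiv.curry, Function.curry]
    rfl
  rw [h1, ← Measure.map_map (by
      refine measurable_pi_lambda _ fun i => measurable_binVal.comp (measurable_pi_apply i))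
      (by
        refine (MeasurableEquiv.measurable _).comp (Measurable.comp (by fun_prop) measurable_digs)),
    ← Measure.map_map (MeasurableEquiv.measurable _) (Measurable.comp (by fun_prop) measurable_digs),
    ← Measure.map_map (by fun_prop) measurable_digs, map_digs,
    infinitePi_map_inj _ _ Nat.pairEquiv.injective]
  have := Measure.infinitePi_map_curry (fun (_ _ : ℕ) => bm (1/2))
  rw [this, Measure.infinitePi_map_pi _ (fun _ => measurable_binVal)]
  simp_rw [map_binVal]

lemma measurable_unifSample (i : ℕ) : Measurable (unifSample i) := by
  have : unifSample i = binVal ∘ (fun b n => b (Nat.pair i n)) ∘ digs := by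
    funext x; simp [unifSample, binVal, digs]; rfl
  rw [this]
  exact measurable_binVal.comp (Measurable.comp (by fun_prop) measurable_digs)

theorem bernoulliProduct_eq {ι : Type*} [Encodable ι] (P : ι → ℝ) :
    bernoulliProduct P = bern P := by
  have h1 : (fun (x : ℝ) (i : ι) => decide (unifSample (Encodable.encode i) x < P i)) =
    (fun (u : ι → ℝ) i => decide (u i < P i)) ∘ (fun (u : ℕ → ℝ) i => u (Encodable.encode i)) ∘
      (fun x (i : ℕ) => unifSample i x) := by
    funext x i; simp
  have hm : Measurable (fun x (i : ℕ) => unifSample i x) :=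
    measurable_pi_lambda _ measurable_unifSample
  have hm2 : Measurable (fun (u : ι → ℝ) i => decide (u i < P i)) :=
    measurable_pi_lambda _ fun i => (measurable_decide_lt (P i)).comp (measurable_pi_apply i)
  rw [bernoulliProduct, h1]
  change unifM.map _ = _
  rw [← Measure.map_map hm2 (Measurable.comp (by fun_prop) hm),
    ← Measure.map_map (by fun_prop) hm, map_unifSample,
    infinitePi_map_inj _ _ Encodable.encode_injective,
    Measure.infinitePi_map_pi (fun _ : ι => unifM) (fun i => measurable_decide_lt (P i))]
  rfl
end

section
open ProbabilityTheory

/-! ### Events determined by coordinates, independence -/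

set_option linter.unusedSectionVars false

section events
variable {E : Type*}

/-- The event `A` depends only on the coordinates in `I`. -/
def Det (I : Set E) (A : Set (E → Bool)) : Prop :=
  ∀ ω η : E → Bool, (∀ e ∈ I, ω e = η e) → ω ∈ A → η ∈ A

/-- Probability of an event under the product Bernoulli measure. -/
noncomputable def pr (P : E → ℝ) (A : Set (E → Bool)) : ℝ := (bern P).real A

lemma Det.iff {I : Set E} {A : Set (E → Bool)} (h : Det I A) {ω ω' : E → Bool}
    (hw : ∀ e ∈ I, ω e = ω' e) : ω ∈ A ↔ ω' ∈ A :=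
  ⟨h _ _ hw, h _ _ fun e he => (hw e he).symm⟩

lemma Det.mono {I J : Set E} {A : Set (E → Bool)} (h : Det I A) (hIJ : I ⊆ J) : Det J A :=
  fun _ _ hw => h _ _ fun e he => hw e (hIJ he)

lemma Det.compl {I : Set E} {A : Set (E → Bool)} (h : Det I A) : Det I Aᶜ :=
  fun _ _ hw hA hA' => hA (h _ _ (fun e he => (hw e he).symm) hA')

lemma Det.inter {I J : Set E} {A B : Set (E → Bool)} (h : Det I A) (h' : Det J B) :
    Det (I ∪ J) (A ∩ B) :=
  fun _ _ hw hA => ⟨h _ _ (fun e he => hw e (Or.inl he)) hA.1,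
    h' _ _ (fun e he => hw e (Or.inr he)) hA.2⟩

lemma Det.union {I J : Set E} {A B : Set (E → Bool)} (h : Det I A) (h' : Det J B) :
    Det (I ∪ J) (A ∪ B) := by
  intro _ _ hw hA
  rcases hA with hA | hA
  · exact Or.inl (h _ _ (fun e he => hw e (Or.inl he)) hA)
  · exact Or.inr (h' _ _ (fun e he => hw e (Or.inr he)) hA)

lemma Det.iInter {ι : Type*} {I : Set E} {A : ι → Set (E → Bool)} (h : ∀ i, Det I (A i)) :
    Det I (⋂ i, A i) := by
  intro _ _ hw hA
  rw [mem_iInter] at hA ⊢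
  exact fun i => h i _ _ hw (hA i)

lemma Det.iUnion {ι : Type*} {I : Set E} {A : ι → Set (E → Bool)} (h : ∀ i, Det I (A i)) :
    Det I (⋃ i, A i) := by
  intro _ _ hw hA
  rw [mem_iUnion] at hA ⊢
  obtain ⟨i, hi⟩ := hA
  exact ⟨i, h i _ _ hw hi⟩

lemma det_univ (I : Set E) : Det I (univ : Set (E → Bool)) := fun _ _ _ _ => trivial

lemma det_coord (e : E) (b : Bool) : Det {e} {ω : E → Bool | ω e = b} :=
  fun ω ω' h hA => by rw [mem_ofPred_eq] at *; rw [← h e rfl]; exact hA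

lemma pr_nonneg (P : E → ℝ) (A : Set (E → Bool)) : 0 ≤ pr P A := measureReal_nonneg

lemma pr_le_one (P : E → ℝ) (A : Set (E → Bool)) : pr P A ≤ 1 := measureReal_le_one

lemma pr_mono (P : E → ℝ) {A B : Set (E → Bool)} (h : A ⊆ B) : pr P A ≤ pr P B :=
  measureReal_mono h

lemma pr_univ (P : E → ℝ) : pr P univ = 1 := by simp [pr]

lemma pr_empty (P : E → ℝ) : pr P ∅ = 0 := by simp [pr]

lemma pr_compl (P : E → ℝ) {A : Set (E → Bool)} (h : MeasurableSet A) : pr P Aᶜ = 1 - pr P A :=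
  probReal_compl_eq_one_sub h

lemma pr_union_le (P : E → ℝ) (A B : Set (E → Bool)) : pr P (A ∪ B) ≤ pr P A + pr P B :=
  measureReal_union_le A B

lemma pr_union (P : E → ℝ) {A B : Set (E → Bool)} (h : Disjoint A B) (hB : MeasurableSet B) :
    pr P (A ∪ B) = pr P A + pr P B :=
  measureReal_union h hB

lemma pr_biUnion_le {ι : Type*} (P : E → ℝ) (s : Finset ι) (A : ι → Set (E → Bool)) :
    pr P (⋃ i ∈ s, A i) ≤ ∑ i ∈ s, pr P (A i) :=
  measureReal_biUnion_finset_le s A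

lemma pr_biUnion {ι : Type*} (P : E → ℝ) {s : Finset ι} {A : ι → Set (E → Bool)}
    (hd : PairwiseDisjoint (s : Set ι) A) (hm : ∀ i ∈ s, MeasurableSet (A i)) :
    pr P (⋃ i ∈ s, A i) = ∑ i ∈ s, pr P (A i) :=
  measureReal_biUnion_finset hd hm

lemma measurableSet_coord (e : E) (b : Bool) : MeasurableSet {ω : E → Bool | ω e = b} :=
  (measurable_pi_apply (X := fun _ : E => Bool) e) (measurableSet_singleton b)

lemma Det.measurableSet {F : Finset E} {A : Set (E → Bool)} (h : Det (F : Set E) A) :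
    MeasurableSet A := by
  have hpre : A = (F.restrict (π := fun _ => Bool)) ⁻¹' ((F.restrict (π := fun _ => Bool)) '' A) := by
    apply subset_antisymm (subset_preimage_image _ _)
    rintro ω ⟨ω', hω', he⟩
    refine h ω' ω (fun e heF => ?_) hω'
    exact congrFun he ⟨e, heF⟩
  rw [hpre]
  exact (Finset.measurable_restrict F) (Set.toFinite _).measurableSet

lemma pr_inter_of_det (P : E → ℝ) {I J : Set E} {A B : Set (E → Bool)} (hA : Det I A)
    (hB : Det J B) (hIJ : Disjoint I J) (mA : MeasurableSet A) (mB : MeasurableSet B) :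
    pr P (A ∩ B) = pr P A * pr P B := by
  classical
  have hind : iIndepFun (fun (e : E) (ω : E → Bool) => ω e) (bern P) := by
    have := iIndepFun_infinitePi (P := fun e => bm (P e)) (X := fun _ (b : Bool) => b)
      (fun _ => measurable_id)
    exact this
  have h2 := indep_iSup_of_disjoint (fun e => (measurable_pi_apply (X := fun _ : E => Bool) e).comap_le)
    hind hIJ
  have key : ∀ (I : Set E) (A : Set (E → Bool)), Det I A → MeasurableSet A →
      MeasurableSet[⨆ e ∈ I, MeasurableSpace.comap (fun ω : E → Bool => ω e) inferInstance] A := by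
    intro I A hA mA
    let r : (E → Bool) → (E → Bool) := fun ω e => if e ∈ I then ω e else false
    have hr : A = r ⁻¹' A := by
      ext ω
      exact hA.iff fun e he => by simp [r, he]
    have mr : @Measurable _ _ (⨆ e ∈ I, MeasurableSpace.comap (fun ω : E → Bool => ω e) inferInstance)
        _ r := by
      refine @measurable_pi_lambda _ _ _ (⨆ e ∈ I, MeasurableSpace.comap (fun ω : E → Bool => ω e) inferInstance) _ _ fun e => ?_
      by_cases he : e ∈ I
      · simp only [r, he, if_true]
        have : MeasurableSpace.comap (fun ω : E → Bool => ω e) inferInstance ≤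
          ⨆ e ∈ I, MeasurableSpace.comap (fun ω : E → Bool => ω e) inferInstance :=
          le_iSup₂ (f := fun e (_ : e ∈ I) => MeasurableSpace.comap (fun ω : E → Bool => ω e) inferInstance) e he
        exact (comap_measurable _).mono this le_rfl
      · simp only [r, he, if_false]
        exact measurable_const
    rw [hr]
    exact mr mA
  have h3 := (Indep_iff _ _ _).1 h2 A B (key I A hA mA) (key J B hB mB)
  simp only [pr, Measure.real, h3, ENNReal.toReal_mul]

lemma pr_coord_true {P : E → ℝ} {e : E} (h0 : 0 ≤ P e) (h1 : P e ≤ 1) :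
    pr P {ω | ω e = true} = P e := by
  have h := Measure.infinitePi_map_eval (fun e => bm (P e)) e
  rw [← bm_true h0 h1, ← h, pr, bern, map_measureReal_apply (measurable_pi_apply e) (by simp)]
  rfl

lemma pr_coord_false {P : E → ℝ} {e : E} (h0 : 0 ≤ P e) (h1 : P e ≤ 1) :
    pr P {ω | ω e = false} = 1 - P e := by
  rw [← pr_coord_true h0 h1, ← pr_compl P (measurableSet_coord e true)]
  congr 1; ext ω; simp

/-- Law of coordinates which are functions of disjoint blocks. -/
lemma map_blocks {M : Type*} (Q : M → ℝ) (X : E → (M → Bool) → Bool) (I : E → Set M)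
    (hm : ∀ e, MeasurableSet {ω | X e ω = true}) (hdet : ∀ e, Det (I e) {ω | X e ω = true})
    (hdisj : Pairwise (fun e e' => Disjoint (I e) (I e'))) (P : E → ℝ)
    (hP0 : ∀ e, 0 ≤ P e) (hP1 : ∀ e, P e ≤ 1) (hP : ∀ e, pr Q {ω | X e ω = true} = P e) :
    (bern Q).map (fun ω e => X e ω) = bern P := by
  classical
  have mX : ∀ e, Measurable (X e) := fun e => measurable_to_bool (hm e)
  have mXX : Measurable (fun ω e => X e ω) := measurable_pi_lambda _ mX
  refine Measure.eq_infinitePi _ fun s u hu => ?_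
  rw [Measure.map_apply mXX (.pi s.countable_toSet fun _ _ => hu _)]
  have hdet' : ∀ e (u : Set Bool), Det (I e) {ω | X e ω ∈ u} := by
    intro e u ω ω' hw h
    have h1 : X e ω = true ↔ X e ω' = true := (hdet e).iff hw
    have h2 : X e ω = X e ω' := by
      cases h3 : X e ω <;> cases h4 : X e ω' <;> simp_all
    rw [mem_ofPred_eq] at *
    rwa [← h2]
  have hm' : ∀ e (u : Set Bool), MeasurableSet {ω | X e ω ∈ u} := fun e u =>
    mX e (Set.toFinite u).measurableSet
  have hlaw : ∀ e (u : Set Bool), bern Q {ω | X e ω ∈ u} = bm (P e) u := by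
    intro e u
    have : (bern Q).map (X e) = bm (P e) := by
      have : IsProbabilityMeasure ((bern Q).map (X e)) :=
        Measure.isProbabilityMeasure_map (mX e).aemeasurable
      have ht : ((bern Q).map (X e)).real {true} = (bm (P e)).real {true} := by
        rw [bm_true (hP0 e) (hP1 e), ← hP e, map_measureReal_apply (mX e) (by simp)]; rfl
      refine Measure.ext_of_singleton fun b => ?_
      rw [← measureReal_eq_measureReal_iff]
      cases b
      · have h : ({false} : Set Bool) = {true}ᶜ := by ext x; cases x <;> simp
        rw [h, probReal_compl_eq_one_sub (by simp), probReal_compl_eq_one_sub (by simp), ht]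
      · exact ht
    rw [← this, Measure.map_apply (mX e) (Set.toFinite u).measurableSet]; rfl
  have key : ∀ s : Finset E, pr Q {ω | ∀ e ∈ s, X e ω ∈ u e} = ∏ e ∈ s, pr Q {ω | X e ω ∈ u e} ∧
      MeasurableSet {ω | ∀ e ∈ s, X e ω ∈ u e} ∧
      Det (⋃ e ∈ s, I e) {ω | ∀ e ∈ s, X e ω ∈ u e} := by
    intro s
    induction s using Finset.induction_on with
    | empty => simp [pr_univ, det_univ]
    | insert e s he ih =>
      obtain ⟨ih1, ih2, ih3⟩ := ih
      have hs : {ω | ∀ e' ∈ insert e s, X e' ω ∈ u e'} =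
          {ω | X e ω ∈ u e} ∩ {ω | ∀ e ∈ s, X e ω ∈ u e} := by
        ext; simp
      rw [hs]
      refine ⟨?_, (hm' e _).inter ih2, ?_⟩
      · rw [pr_inter_of_det Q (hdet' e _) ih3 _ (hm' e _) ih2, ih1, Finset.prod_insert he]
        rw [Set.disjoint_iUnion₂_right]
        intro e' he'
        exact hdisj (fun h => he (h ▸ he'))
      · refine ((hdet' e _).inter ih3).mono ?_
        simp
  have h1 := (key s).1
  have h2 : (fun ω e => X e ω) ⁻¹' (s : Set E).pi u = {ω | ∀ e ∈ s, X e ω ∈ u e} := by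
    ext; simp [Set.mem_pi]
  rw [h2, ← ENNReal.ofReal_toReal (measure_ne_top (bern Q) _)]
  change ENNReal.ofReal (pr Q _) = _
  rw [h1, ENNReal.ofReal_prod_of_nonneg (fun _ _ => pr_nonneg _ _)]
  refine Finset.prod_congr rfl fun e _ => ?_
  rw [← hlaw e, pr, Measure.real, ENNReal.ofReal_toReal (measure_ne_top _ _)]

lemma pr_map {M : Type*} {Q : M → ℝ} {P : E → ℝ} {f : (M → Bool) → (E → Bool)}
    (hf : Measurable f) (h : (bern Q).map f = bern P) {A : Set (E → Bool)} (hA : MeasurableSet A) :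
    pr P A = pr Q (f ⁻¹' A) := by
  rw [pr, pr, ← h, map_measureReal_apply hf hA]

lemma pr_reindex {M : Type*} (Q : M → ℝ) (f : E → M) (hf : Function.Injective f)
    {A : Set (E → Bool)} (hA : MeasurableSet A) :
    pr (fun e => Q (f e)) A = pr Q {ω | (fun e => ω (f e)) ∈ A} := by
  refine pr_map (f := fun ω e => ω (f e)) (by fun_prop) ?_ hA
  exact infinitePi_map_inj _ _ hf

/-! ### One-coordinate decompositions -/

/-- The event that `ω` with coordinate `e` set to `b` is in `A`. -/
def setc [DecidableEq E] (e : E) (b : Bool) (A : Set (E → Bool)) : Set (E → Bool) :=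
  {ω | Function.update ω e b ∈ A}

variable [DecidableEq E]

lemma measurableSet_setc (e : E) (b : Bool) {A : Set (E → Bool)} (hA : MeasurableSet A) :
    MeasurableSet (setc e b A) := by
  have : Measurable (fun ω : E → Bool => Function.update ω e b) := by
    refine measurable_pi_lambda _ fun i => ?_
    by_cases h : i = e
    · subst h; simp
    · simp only [Function.update_of_ne h]; exact measurable_pi_apply i
  exact this hA

lemma det_setc (e : E) (b : Bool) {A : Set (E → Bool)} {I : Set E} (hA : Det I A) :
    Det (I \ {e}) (setc e b A) := by
  intro ω ω' hw h
  refine hA _ _ (fun i hi => ?_) h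
  by_cases hie : i = e
  · subst hie; simp
  · simp only [Function.update_of_ne hie]; exact hw i ⟨hi, hie⟩

lemma pr_split (P : E → ℝ) (e : E) (h0 : 0 ≤ P e) (h1 : P e ≤ 1) {A : Set (E → Bool)}
    (hA : MeasurableSet A) :
    pr P A = P e * pr P (setc e true A) + (1 - P e) * pr P (setc e false A) := by
  have hu : Det univ A := fun ω ω' hw h => by
    have : ω = ω' := funext fun i => hw i trivial
    rwa [← this]
  have hd : ∀ b, Det ({e}ᶜ : Set E) (setc e b A) := fun b =>
    (det_setc e b hu).mono (by intro x; simp)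
  have hs : A = ({ω | ω e = true} ∩ setc e true A) ∪ ({ω | ω e = false} ∩ setc e false A) := by
    ext ω
    simp only [mem_union, mem_inter_iff, mem_ofPred_eq, setc]
    cases h : ω e
    · have : Function.update ω e false = ω := by rw [← h]; simp
      simp [this]
    · have : Function.update ω e true = ω := by rw [← h]; simp
      simp [this]
  conv_lhs => rw [hs]
  rw [pr_union, pr_inter_of_det P (det_coord e true) (hd true) (by simp) (measurableSet_coord _ _)
    (measurableSet_setc _ _ hA), pr_inter_of_det P (det_coord e false) (hd false) (by simp)
    (measurableSet_coord _ _) (measurableSet_setc _ _ hA), pr_coord_true h0 h1, pr_coord_false h0 h1]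
  · rw [Set.disjoint_left]
    rintro ω ⟨h, -⟩ ⟨h', -⟩
    simp only [mem_ofPred_eq] at h h'
    simp [h] at h'
  · exact (measurableSet_coord _ _).inter (measurableSet_setc _ _ hA)

lemma det_empty_cases {A : Set (E → Bool)} (h : Det (∅ : Set E) A) : A = ∅ ∨ A = univ := by
  rcases A.eq_empty_or_nonempty with h' | ⟨ω, hω⟩
  · exact Or.inl h'
  · exact Or.inr (eq_univ_of_forall fun ω' => h ω ω' (by simp) hω)

lemma upper_setc (e : E) (b : Bool) {A : Set (E → Bool)} (hA : IsUpperSet A) :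
    IsUpperSet (setc e b A) := by
  intro ω ω' hw h
  refine hA ?_ h
  exact update_le_update_iff.2 ⟨le_rfl, fun j _ => hw j⟩

lemma setc_mono (e : E) {A : Set (E → Bool)} (hA : IsUpperSet A) :
    setc e false A ⊆ setc e true A := by
  intro ω h
  refine hA ?_ h
  exact update_le_update_iff.2 ⟨by decide, fun j _ => le_rfl⟩

lemma det_erase_setc {F : Finset E} {e : E} (b : Bool) {A : Set (E → Bool)}
    (hA : Det ((insert e F : Finset E) : Set E) A) : Det (F : Set E) (setc e b A) :=
  (det_setc e b hA).mono (by intro x; simp; tauto)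

/-- Monotonicity in the parameters. -/
lemma pr_mono_param {F : Finset E} {A : Set (E → Bool)} (hA : Det (F : Set E) A)
    (hu : IsUpperSet A) (P Q : E → ℝ) (hP : ∀ e, 0 ≤ P e) (hQ : ∀ e, Q e ≤ 1)
    (hPQ : ∀ e, P e ≤ Q e) : pr P A ≤ pr Q A := by
  induction F using Finset.induction_on generalizing A with
  | empty =>
    rcases det_empty_cases (by simpa using hA) with h | h <;> simp [h, pr_empty, pr_univ]
  | insert e F he ih =>
    have hm := hA.measurableSet
    rw [pr_split P e (hP e) ((hPQ e).trans (hQ e)) hm,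
      pr_split Q e ((hP e).trans (hPQ e)) (hQ e) hm]
    have i1 := ih (det_erase_setc true hA) (upper_setc e true hu)
    have i0 := ih (det_erase_setc false hA) (upper_setc e false hu)
    have h3 := pr_mono P (setc_mono e hu)
    have h4 := pr_mono Q (setc_mono e hu)
    have := hPQ e
    have := hP e
    have := hQ e
    nlinarith [mul_le_mul_of_nonneg_left i1 (hP e), mul_le_mul_of_nonneg_left i0 (show 0 ≤ 1 - P e by linarith)]

/-- Harris inequality for increasing events. -/
lemma harris {F : Finset E} {A B : Set (E → Bool)} (hA : Det (F : Set E) A)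
    (hB : Det (F : Set E) B) (uA : IsUpperSet A) (uB : IsUpperSet B) (P : E → ℝ)
    (h0 : ∀ e, 0 ≤ P e) (h1 : ∀ e, P e ≤ 1) : pr P A * pr P B ≤ pr P (A ∩ B) := by
  induction F using Finset.induction_on generalizing A B with
  | empty =>
    rcases det_empty_cases (by simpa using hA) with h | h <;> simp [h, pr_empty, pr_univ]
  | insert e F he ih =>
    have mA := hA.measurableSet
    have mB := hB.measurableSet
    rw [pr_split P e (h0 e) (h1 e) mA, pr_split P e (h0 e) (h1 e) mB,
      pr_split P e (h0 e) (h1 e) (mA.inter mB)]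
    have i1 := ih (det_erase_setc true hA) (det_erase_setc true hB) (upper_setc e true uA)
      (upper_setc e true uB)
    have i0 := ih (det_erase_setc false hA) (det_erase_setc false hB) (upper_setc e false uA)
      (upper_setc e false uB)
    have h3 := pr_mono P (setc_mono e uA)
    have h4 := pr_mono P (setc_mono e uB)
    have e1 : ∀ b, setc e b (A ∩ B) = setc e b A ∩ setc e b B := fun b => rfl
    rw [e1, e1]
    have a0 := h0 e
    have a1 := h1 e
    have hm := mul_nonneg (mul_nonneg a0 (show 0 ≤ 1 - P e by linarith))
      (mul_nonneg (sub_nonneg.2 h3) (sub_nonneg.2 h4))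
    have j1 := mul_le_mul_of_nonneg_left i1 a0
    have j0 := mul_le_mul_of_nonneg_left i0 (show 0 ≤ 1 - P e by linarith)
    nlinarith

lemma harris_compl {F : Finset E} {A B : Set (E → Bool)} (hA : Det (F : Set E) A)
    (hB : Det (F : Set E) B) (uA : IsUpperSet A) (uB : IsUpperSet B) (P : E → ℝ)
    (h0 : ∀ e, 0 ≤ P e) (h1 : ∀ e, P e ≤ 1) : pr P Aᶜ * pr P Bᶜ ≤ pr P (Aᶜ ∩ Bᶜ) := by
  have h := harris hA hB uA uB P h0 h1
  have mA := hA.measurableSet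
  have mB := hB.measurableSet
  rw [← compl_union, pr_compl P mA, pr_compl P mB, pr_compl P (mA.union mB)]
  have h2 : pr P (A ∪ B) + pr P (A ∩ B) = pr P A + pr P B := measureReal_union_add_inter mB
  nlinarith

/-- The influence of the coordinate `e` on `A`. -/
noncomputable def infl (P : E → ℝ) (e : E) (A : Set (E → Bool)) : ℝ :=
  pr P (setc e true A) - pr P (setc e false A)

lemma setc_comm {e f : E} (h : e ≠ f) (b c : Bool) (A : Set (E → Bool)) :
    setc e b (setc f c A) = setc f c (setc e b A) := by
  ext ω
  simp only [setc, mem_ofPred_eq]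
  rw [Function.update_comm h]

/-- Russo's formula. -/
lemma russo {F : Finset E} {A : Set (E → Bool)} (hA : Det (F : Set E) A) (P : ℝ → E → ℝ)
    (P' : E → ℝ) (x : ℝ) (hP : ∀ e, HasDerivAt (fun s => P s e) (P' e) x)
    (h01 : ∀ᶠ s in nhds x, ∀ e, 0 ≤ P s e ∧ P s e ≤ 1) :
    HasDerivAt (fun s => pr (P s) A) (∑ e ∈ F, P' e * infl (P x) e A) x := by
  induction F using Finset.induction_on generalizing A with
  | empty =>
    rcases det_empty_cases (by simpa using hA) with h | h <;>
      simp [h, pr_empty, pr_univ, hasDerivAt_const]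
  | insert e F he ih =>
    have mA := hA.measurableSet
    have i1 := ih (det_erase_setc true hA)
    have i0 := ih (det_erase_setc false hA)
    have hx := h01.self_of_nhds
    have hd := ((hP e).mul i1).add (((hP e).const_sub 1).mul i0)
    have heq : (fun s => pr (P s) A) =ᶠ[nhds x] ((fun s => P s e) * (fun s => pr (P s) (setc e true A))
        + (fun s => 1 - P s e) * (fun s => pr (P s) (setc e false A))) := by
      filter_upwards [h01] with s hs
      exact pr_split (P s) e (hs e).1 (hs e).2 mA
    refine (hd.congr_of_eventuallyEq heq).congr_deriv ?_
    rw [Finset.sum_insert he, Finset.mul_sum, Finset.mul_sum]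
    have hsum : ∑ f ∈ F, P' f * infl (P x) f A =
        ∑ f ∈ F, P x e * (P' f * infl (P x) f (setc e true A)) +
        ∑ f ∈ F, (1 - P x e) * (P' f * infl (P x) f (setc e false A)) := by
      rw [← Finset.sum_add_distrib]
      refine Finset.sum_congr rfl fun f hf => ?_
      have hfe : e ≠ f := fun h => he (h ▸ hf)
      unfold infl
      rw [pr_split (P x) e (hx e).1 (hx e).2 (measurableSet_setc f true mA),
        pr_split (P x) e (hx e).1 (hx e).2 (measurableSet_setc f false mA),
        setc_comm hfe, setc_comm hfe, setc_comm hfe, setc_comm hfe]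
      ring
    rw [hsum]
    unfold infl
    ring

/-- Local surgery. -/
lemma surgery (P : E → ℝ) (κ : ℝ) (hκ : 0 < κ) (W : Finset E)
    (hP : ∀ e ∈ W, κ ≤ P e ∧ P e ≤ 1 - κ) (A B : Set (E → Bool)) (mB : MeasurableSet B)
    (h : ∀ ω ∈ A, ∃ ω' ∈ B, ∀ e ∉ W, ω e = ω' e) :
    κ ^ W.card * pr P A ≤ 2 ^ W.card * pr P B := by
  induction W using Finset.induction_on generalizing B with
  | empty =>
    simp only [Finset.card_empty, pow_zero, one_mul]
    refine pr_mono P fun ω hω => ?_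
    obtain ⟨ω', h1, h2⟩ := h ω hω
    have : ω = ω' := funext fun e => h2 e (by simp)
    rwa [this]
  | insert e W he ih =>
    have hPe := hP e (by simp)
    have m1 := measurableSet_setc e true mB
    have m0 := measurableSet_setc e false mB
    have i := ih (fun e he => hP e (by simp [he])) (setc e true B ∪ setc e false B) (m1.union m0) (by
      intro ω hω
      obtain ⟨ω', h1, h2⟩ := h ω hω
      refine ⟨Function.update ω' e (ω e), ?_, fun f hf => ?_⟩
      · have hb : ∀ b, ω' e = b → Function.update ω' e (ω e) ∈ setc e b B := by
          intro b hb
          simp only [setc, mem_ofPred_eq, Function.update_idem]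
          rw [← hb]; simpa using h1
        cases hb' : ω' e
        · exact Or.inr (hb _ hb')
        · exact Or.inl (hb _ hb')
      · by_cases hfe : f = e
        · subst hfe; simp
        · rw [Function.update_of_ne hfe]; exact h2 f (by simp [hfe, hf]))
    have hu := pr_union_le P (setc e true B) (setc e false B)
    have hs := pr_split P e (by linarith) (by linarith) mB
    rw [Finset.card_insert_of_notMem he, pow_succ, pow_succ]
    have p1 := pr_nonneg P (setc e true B)
    have p0 := pr_nonneg P (setc e false B)
    have h4 : κ * pr P (setc e true B ∪ setc e false B) ≤ 2 * pr P B := by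
      have pB := pr_nonneg P B
      nlinarith [mul_le_mul_of_nonneg_right hPe.1 p1,
        mul_le_mul_of_nonneg_right (show κ ≤ 1 - P e by linarith) p0]
    calc κ ^ W.card * κ * pr P A = κ * (κ ^ W.card * pr P A) := by ring
      _ ≤ κ * (2 ^ W.card * pr P (setc e true B ∪ setc e false B)) := by gcongr
      _ = 2 ^ W.card * (κ * pr P (setc e true B ∪ setc e false B)) := by ring
      _ ≤ 2 ^ W.card * (2 * pr P B) := by gcongr
      _ = _ := by ring

end events
end

section
open ProbabilityTheory Relation

/-! ### Graphs with indexed edges and connectivity -/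

/-- A multigraph: each edge has two endpoints. -/
structure Gr (V E : Type*) where
  s : E → V
  t : E → V

namespace Gr
variable {V E : Type*} (G : Gr V E)

/-- The tail of a dart (oriented edge). -/
def tl (d : E × Bool) : V := if d.2 then G.s d.1 else G.t d.1

/-- The head of a dart (oriented edge). -/
def hd (d : E × Bool) : V := if d.2 then G.t d.1 else G.s d.1

/-- Joined by an open edge. -/
def Adj (ω : E → Bool) (x y : V) : Prop := ∃ d : E × Bool, ω d.1 = true ∧ G.tl d = x ∧ G.hd d = y

/-- Connected by an open path inside `U`. -/
def Conn (ω : E → Bool) (U : Set V) : V → V → Prop :=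
  ReflTransGen (fun a b => a ∈ U ∧ b ∈ U ∧ G.Adj ω a b)

/-- Connected to `T` by an open path inside `U`. -/
def Hit (ω : E → Bool) (U : Set V) (x : V) (T : Set V) : Prop := ∃ y ∈ T, G.Conn ω U x y

variable {G} {ω ω' : E → Bool} {U U' T : Set V} {x y z : V}

lemma tl_hd (d : E × Bool) : (G.tl d = G.s d.1 ∧ G.hd d = G.t d.1) ∨
    (G.tl d = G.t d.1 ∧ G.hd d = G.s d.1) := by
  unfold tl hd; cases d.2 <;> simp

lemma Adj.symm (h : G.Adj ω x y) : G.Adj ω y x := by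
  obtain ⟨⟨e, b⟩, h1, h2, h3⟩ := h
  refine ⟨⟨e, !b⟩, h1, ?_, ?_⟩
  · rw [← h3]; unfold tl hd; cases b <;> simp
  · rw [← h2]; unfold tl hd; cases b <;> simp

lemma adj_edge {e : E} (h : ω e = true) : G.Adj ω (G.s e) (G.t e) := ⟨(e, true), h, rfl, rfl⟩

lemma adj_iff : G.Adj ω x y ↔ ∃ e, ω e = true ∧ ((G.s e = x ∧ G.t e = y) ∨ (G.t e = x ∧ G.s e = y)) := by
  constructor
  · rintro ⟨d, h, rfl, rfl⟩
    refine ⟨d.1, h, ?_⟩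
    rcases tl_hd (G := G) d with ⟨a, b⟩ | ⟨a, b⟩ <;> simp [a, b]
  · rintro ⟨e, h, ⟨rfl, rfl⟩ | ⟨rfl, rfl⟩⟩
    · exact adj_edge h
    · exact (adj_edge h).symm

lemma Conn.refl (x : V) : G.Conn ω U x x := ReflTransGen.refl

lemma Conn.trans (h : G.Conn ω U x y) (h' : G.Conn ω U y z) : G.Conn ω U x z :=
  ReflTransGen.trans h h'

lemma Conn.symm (h : G.Conn ω U x y) : G.Conn ω U y x := by
  induction h with
  | refl => exact .refl _
  | tail _ h ih => exact Conn.trans (ReflTransGen.single ⟨h.2.1, h.1, h.2.2.symm⟩) ih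

lemma Conn.single (hx : x ∈ U) (hy : y ∈ U) (h : G.Adj ω x y) : G.Conn ω U x y :=
  ReflTransGen.single ⟨hx, hy, h⟩

lemma Conn.tail (h : G.Conn ω U x y) (hx : y ∈ U) (hy : z ∈ U) (h' : G.Adj ω y z) :
    G.Conn ω U x z := ReflTransGen.tail h ⟨hx, hy, h'⟩

lemma Conn.mono (h : G.Conn ω U x y) (hU : U ⊆ U') (hw : ∀ e, ω e = true → ω' e = true) :
    G.Conn ω' U' x y := by
  induction h with
  | refl => exact .refl _
  | tail _ h ih =>
    obtain ⟨ha, hb, d, h1, h2⟩ := h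
    exact ih.tail (hU ha) (hU hb) ⟨d, hw _ h1, h2⟩

lemma Conn.mem (h : G.Conn ω U x y) (hx : x ∈ U) : y ∈ U := by
  induction h with
  | refl => exact hx
  | tail _ h _ => exact h.2.1

lemma Conn.mem_or (h : G.Conn ω U x y) : x = y ∨ (x ∈ U ∧ y ∈ U) := by
  induction h with
  | refl => exact Or.inl rfl
  | tail _ h ih => exact Or.inr ⟨by rcases ih with rfl | h'; exacts [h.1, h'.1], h.2.1⟩

/-- Exploration of a cluster only reveals the edges touching it. -/
lemma explore (h : ∀ e, G.s e ∈ U → G.t e ∈ U →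
      (G.Conn ω U x (G.s e) ∨ G.Conn ω U x (G.t e)) → ω e = ω' e) (y : V) :
    G.Conn ω U x y ↔ G.Conn ω' U x y := by
  have key : ∀ d : E × Bool, G.tl d ∈ U → G.hd d ∈ U → G.Conn ω U x (G.tl d) → ω d.1 = ω' d.1 := by
    intro d h1 h2 h3
    rcases tl_hd (G := G) d with ⟨a, b⟩ | ⟨a, b⟩ <;> rw [a] at h1 h3 <;> rw [b] at h2
    · exact h _ h1 h2 (Or.inl h3)
    · exact h _ h2 h1 (Or.inr h3)
  constructor
  · intro hc
    induction hc with
    | refl => exact .refl _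
    | tail hab hb ih =>
      obtain ⟨ha, hb, d, h1, rfl, rfl⟩ := hb
      exact ih.tail ha hb ⟨d, by rw [← key d ha hb hab, h1], rfl, rfl⟩
  · intro hc
    induction hc with
    | refl => exact .refl _
    | tail hab hb ih =>
      obtain ⟨ha, hb, d, h1, rfl, rfl⟩ := hb
      exact ih.tail ha hb ⟨d, by rw [key d ha hb ih, h1], rfl, rfl⟩

lemma Conn.congr (h : ∀ e, G.s e ∈ U → G.t e ∈ U → ω e = ω' e) (hc : G.Conn ω U x y) :
    G.Conn ω' U x y := by
  exact (explore (fun e h1 h2 _ => h e h1 h2) y).1 hc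

lemma Hit.congr (h : ∀ e, G.s e ∈ U → G.t e ∈ U → (G.s e ∉ T ∨ G.t e ∉ T) → ω e = ω' e)
    (hc : G.Hit ω U x T) : G.Hit ω' U x T := by
  obtain ⟨y, hy, hc⟩ := hc
  induction hc using ReflTransGen.head_induction_on with
  | refl => exact ⟨y, hy, .refl _⟩
  | head hab _ ih =>
    obtain ⟨ha, hb, d, h1, rfl, rfl⟩ := hab
    by_cases haT : G.tl d ∈ T
    · exact ⟨_, haT, .refl _⟩
    · obtain ⟨z, hz, hc⟩ := ih
      refine ⟨z, hz, Conn.trans (.single ha hb ⟨d, ?_, rfl, rfl⟩) hc⟩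
      rw [← h1]; symm
      rcases tl_hd (G := G) d with ⟨a, b⟩ | ⟨a, b⟩ <;> rw [a] at ha haT <;> rw [b] at hb
      · exact h _ ha hb (Or.inl haT)
      · exact h _ hb ha (Or.inr haT)

lemma det_conn (U : Set V) (x y : V) :
    Det {e | G.s e ∈ U ∧ G.t e ∈ U} {ω | G.Conn ω U x y} :=
  fun _ _ hw h => Conn.congr (fun e h1 h2 => hw e ⟨h1, h2⟩) h

lemma det_hit (U : Set V) (x : V) (T : Set V) :
    Det {e | (G.s e ∈ U ∧ G.t e ∈ U) ∧ (G.s e ∉ T ∨ G.t e ∉ T)} {ω | G.Hit ω U x T} :=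
  fun _ _ hw h => Hit.congr (fun e h1 h2 h3 => hw e ⟨⟨h1, h2⟩, h3⟩) h

lemma det_hit' (U : Set V) (x : V) (T : Set V) :
    Det {e | (G.s e ∈ U ∧ G.t e ∈ U)} {ω | G.Hit ω U x T} :=
  (det_hit U x T).mono fun _ h => h.1

lemma upper_conn (U : Set V) (x y : V) : IsUpperSet {ω | G.Conn ω U x y} := by
  intro ω ω' hw h
  refine Conn.mono h subset_rfl fun e he => ?_
  have := hw e
  rw [he] at this
  exact this rfl

lemma upper_hit (U : Set V) (x : V) (T : Set V) : IsUpperSet {ω | G.Hit ω U x T} := by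
  rintro ω ω' hw ⟨y, hy, h⟩
  exact ⟨y, hy, upper_conn U x y hw h⟩

lemma measurable_conn [Countable E] (U : Set V) (x y : V) : MeasurableSet {ω | G.Conn ω U x y} := by
  apply IsOpen.measurableSet
  rw [isOpen_iff_eventually]
  intro ω hω
  induction hω with
  | refl => exact Filter.Eventually.of_forall fun _ => .refl _
  | tail hab hb ih =>
    obtain ⟨ha, hb, d, h1, rfl, rfl⟩ := hb
    have hc : ∀ᶠ ω' in nhds ω, ω' d.1 = true := by
      have : Continuous (fun ω : E → Bool => ω d.1) := continuous_apply _
      have h2 : IsOpen {ω : E → Bool | ω d.1 = true} :=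
        (isOpen_discrete ({true} : Set Bool)).preimage this
      exact h2.mem_nhds h1
    filter_upwards [ih, hc] with ω' h3 h4
    exact Conn.tail h3 ha hb ⟨d, h4, rfl, rfl⟩

lemma measurable_hit [Countable E] [Countable V] (U : Set V) (x : V) (T : Set V) :
    MeasurableSet {ω | G.Hit ω U x T} := by
  have : {ω | G.Hit ω U x T} = ⋃ y ∈ T, {ω | G.Conn ω U x y} := by
    ext; simp [Hit]
  rw [this]
  exact MeasurableSet.biUnion (to_countable _) fun y _ => measurable_conn U x y

/-- Last exit from `C`. -/
lemma last_exit {C : Set V} (hc : G.Conn ω U x y) (hx : x ∈ C) (hy : y ∉ C) :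
    ∃ d : E × Bool, ω d.1 = true ∧ G.tl d ∈ C ∧ G.hd d ∉ C ∧ G.tl d ∈ U ∧ G.hd d ∈ U ∧
      G.Conn ω (U \ C) (G.hd d) y := by
  have key : (∃ d : E × Bool, ω d.1 = true ∧ G.tl d ∈ C ∧ G.hd d ∉ C ∧ G.tl d ∈ U ∧ G.hd d ∈ U ∧
      G.Conn ω (U \ C) (G.hd d) y) ∨ (x ∉ C ∧ G.Conn ω (U \ C) x y) := by
    clear hx
    induction hc using ReflTransGen.head_induction_on with
    | refl => exact Or.inr ⟨hy, .refl _⟩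
    | head hab _ ih =>
      obtain ⟨ha, hb, d, h1, rfl, rfl⟩ := hab
      rcases ih with ih | ⟨ih1, ih2⟩
      · exact Or.inl ih
      · by_cases hd : G.tl d ∈ C
        · exact Or.inl ⟨d, h1, hd, ih1, ha, hb, ih2⟩
        · exact Or.inr ⟨hd, Conn.trans (.single ⟨ha, hd⟩ ⟨hb, ih1⟩ ⟨d, h1, rfl, rfl⟩) ih2⟩
  rcases key with h | ⟨h, -⟩
  · exact h
  · exact absurd hx h

/-- First exit from `C`. -/
lemma first_exit {C : Set V} (hc : G.Conn ω U x y) (hx : x ∈ C) (hy : y ∉ C) :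
    ∃ d : E × Bool, ω d.1 = true ∧ G.tl d ∈ C ∧ G.hd d ∉ C ∧ G.tl d ∈ U ∧ G.hd d ∈ U ∧
      G.Conn ω (U ∩ C) x (G.tl d) := by
  obtain ⟨d, h1, h2, h3, h4, h5, h6⟩ := last_exit (C := Cᶜ) hc.symm hy (by simpa using hx)
  refine ⟨(d.1, !d.2), h1, ?_, ?_, ?_, ?_, ?_⟩
  all_goals
    have a : G.tl (d.1, !d.2) = G.hd d := by unfold tl hd; cases d.2 <;> simp
    have b : G.hd (d.1, !d.2) = G.tl d := by unfold tl hd; cases d.2 <;> simp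
  · rw [a]; simpa using h3
  · rw [b]; simpa using h2
  · rw [a]; exact h5
  · rw [b]; exact h4
  · rw [a]
    refine h6.symm.mono ?_ (fun _ h => h)
    intro v hv; exact ⟨hv.1, by simpa using hv.2⟩

/-- Simon-type inequality (Duminil-Copin and Tassion). -/
theorem simon [Countable E] [Countable V] (P : E → ℝ) (h0 : ∀ e, 0 ≤ P e) (h1 : ∀ e, P e ≤ 1)
    (S : Finset V) {o : V} (ho : o ∈ S) (T : Set V) (hT : ∀ x ∈ S, x ∉ T) (D : Finset (E × Bool))
    (hD : ∀ d, G.tl d ∈ S → G.hd d ∉ S → d ∈ D) :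
    pr P {ω | G.Hit ω univ o T} ≤
      ∑ d ∈ D, pr P {ω | G.Conn ω S o (G.tl d)} * P d.1 * pr P {ω | G.Hit ω univ (G.hd d) T} := by
  classical
  have hD' : ∀ D' ⊆ D,
      ∑ d ∈ D', pr P {ω | G.Conn ω S o (G.tl d)} * P d.1 * pr P {ω | G.Hit ω univ (G.hd d) T} ≤
      ∑ d ∈ D, pr P {ω | G.Conn ω S o (G.tl d)} * P d.1 * pr P {ω | G.Hit ω univ (G.hd d) T} :=
    fun D' h => Finset.sum_le_sum_of_subset_of_nonneg h fun d _ _ =>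
      mul_nonneg (mul_nonneg (pr_nonneg _ _) (h0 _)) (pr_nonneg _ _)
  refine le_trans ?_ (hD' (D.filter fun d => G.tl d ∈ S ∧ G.hd d ∉ S) (Finset.filter_subset _ _))
  set D' := D.filter fun d => G.tl d ∈ S ∧ G.hd d ∉ S with hD'def
  let Cl : Finset V → Set (E → Bool) := fun C => {ω | ∀ x ∈ S, (x ∈ C ↔ G.Conn ω S o x)}
  have mCl : ∀ C, MeasurableSet (Cl C) := by
    intro C
    have : Cl C = ⋂ x ∈ S, {ω | x ∈ C ↔ G.Conn ω S o x} := by ext; simp [Cl]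
    rw [this]
    refine Finset.measurableSet_biInter _ fun x _ => ?_
    by_cases hx : x ∈ C
    · simpa [hx] using measurable_conn (G := G) (S : Set V) o x
    · have h := (measurable_conn (G := G) (S : Set V) o x).compl
      convert h using 1
      ext; simp [hx]
  have dCl : ∀ C, Det {e | (G.s e ∈ S ∧ G.t e ∈ S) ∧ (G.s e ∈ C ∨ G.t e ∈ C)} (Cl C) := by
    intro C ω ω' hw hω x hx
    rw [hω x hx]
    refine explore (fun e h1 h2 h3 => hw e ⟨⟨h1, h2⟩, ?_⟩) x
    rcases h3 with h3 | h3
    · exact Or.inl ((hω _ h1).2 h3)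
    · exact Or.inr ((hω _ h2).2 h3)
  have hsub : {ω | G.Hit ω univ o T} ⊆ ⋃ d ∈ D', ⋃ C ∈ (S.powerset.filter fun C => G.tl d ∈ C),
      (Cl C ∩ ({ω | ω d.1 = true} ∩ {ω | G.Hit ω (C : Set V)ᶜ (G.hd d) T})) := by
    rintro ω ⟨y, hy, hc⟩
    let C := S.filter fun x => G.Conn ω S o x
    have hC : ω ∈ Cl C := by intro x hx; simp [C, hx]
    have hyC : y ∉ (C : Set V) := by
      intro h; exact hT y (Finset.mem_filter.1 h).1 hy
    have hoC : o ∈ (C : Set V) := by simp [C, ho, Conn.refl]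
    obtain ⟨d, e1, e2, e3, -, -, e4⟩ := last_exit hc hoC hyC
    have e2' := Finset.mem_filter.1 (Finset.mem_coe.1 e2)
    have hS : G.hd d ∉ S := by
      intro h
      apply e3
      simp only [C, Finset.coe_filter, mem_ofPred_eq]
      exact ⟨h, e2'.2.tail (by simpa using e2'.1) (by simpa using h) ⟨d, e1, rfl, rfl⟩⟩
    simp only [mem_iUnion]
    refine ⟨d, ?_, C, ?_, hC, e1, y, hy, ?_⟩
    · simp only [hD'def, Finset.mem_filter]
      exact ⟨hD d e2'.1 hS, e2'.1, hS⟩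
    · simp only [Finset.mem_filter, Finset.mem_powerset]
      exact ⟨Finset.filter_subset _ _, Finset.mem_coe.1 e2⟩
    · refine e4.mono ?_ (fun _ h => h)
      intro v hv; exact hv.2
  refine (pr_mono P hsub).trans ((pr_biUnion_le P _ _).trans (Finset.sum_le_sum fun d hd => ?_))
  obtain ⟨-, hd1, hd2⟩ := Finset.mem_filter.1 hd
  refine (pr_biUnion_le P _ _).trans ?_
  have hterm : ∀ C ∈ (S.powerset.filter fun C => G.tl d ∈ C),
      pr P (Cl C ∩ ({ω | ω d.1 = true} ∩ {ω | G.Hit ω (C : Set V)ᶜ (G.hd d) T})) ≤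
      pr P (Cl C) * (P d.1 * pr P {ω | G.Hit ω univ (G.hd d) T}) := by
    intro C hC
    obtain ⟨hC1, hC2⟩ := Finset.mem_filter.1 hC
    rw [Finset.mem_powerset] at hC1
    have hnS : ¬ (G.s d.1 ∈ S ∧ G.t d.1 ∈ S) := by
      rcases tl_hd (G := G) d with ⟨a, b⟩ | ⟨a, b⟩ <;> rw [b] at hd2 <;> tauto
    have hnC : ¬ (G.s d.1 ∉ C ∧ G.t d.1 ∉ C) := by
      rcases tl_hd (G := G) d with ⟨a, b⟩ | ⟨a, b⟩ <;> rw [a] at hC2 <;> tauto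
    have mH := measurable_hit (G := G) (C : Set V)ᶜ (G.hd d) T
    have dH := det_hit' (G := G) (C : Set V)ᶜ (G.hd d) T
    rw [pr_inter_of_det P (dCl C) ((det_coord d.1 true).inter dH) _ (mCl C)
      ((measurableSet_coord _ _).inter mH),
      pr_inter_of_det P (det_coord d.1 true) dH _ (measurableSet_coord _ _) mH,
      pr_coord_true (h0 _) (h1 _)]
    · refine mul_le_mul_of_nonneg_left (mul_le_mul_of_nonneg_left (pr_mono P ?_) (h0 _)) (pr_nonneg _ _)
      rintro ω ⟨y, hy, h⟩
      exact ⟨y, hy, h.mono (subset_univ _) fun _ h => h⟩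
    · simp only [Set.disjoint_singleton_left, mem_ofPred_eq]
      exact hnC
    · rw [Set.disjoint_left]
      rintro e ⟨he1, he2⟩ (he3 | he3)
      · rw [mem_singleton_iff] at he3
        subst he3; exact hnS he1
      · simp only [mem_ofPred_eq, mem_compl_iff, Finset.mem_coe] at he3
        tauto
  refine (Finset.sum_le_sum hterm).trans ?_
  rw [← Finset.sum_mul, ← mul_assoc, ← pr_biUnion P _ (fun C _ => mCl C)]
  · refine mul_le_mul_of_nonneg_right (mul_le_mul_of_nonneg_right (pr_mono P ?_) (h0 _)) (pr_nonneg _ _)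
    intro ω hω
    simp only [mem_iUnion] at hω
    obtain ⟨C, hC, hω⟩ := hω
    exact (hω _ hd1).1 (Finset.mem_filter.1 hC).2
  · intro C hC C' hC' hne
    rw [Function.onFun, Set.disjoint_left]
    intro ω h h'
    apply hne
    have hC := Finset.mem_powerset.1 (Finset.mem_filter.1 hC).1
    have hC' := Finset.mem_powerset.1 (Finset.mem_filter.1 hC').1
    ext x
    constructor
    · intro hx; exact (h' x (hC hx)).2 ((h x (hC hx)).1 hx)
    · intro hx; exact (h x (hC' hx)).2 ((h' x (hC' hx)).1 hx)

end Gr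
end

section
open ProbabilityTheory Relation

namespace Gr
variable {V E : Type*} {G : Gr V E}

open Classical in
/-- Outgoing darts of `S` among the edges of `F`. -/
noncomputable def outD (G : Gr V E) (F : Finset E) (S : Finset V) : Finset (E × Bool) :=
  (F ×ˢ Finset.univ).filter fun d => G.tl d ∈ S ∧ G.hd d ∉ S

/-- Differential inequality of Duminil-Copin and Tassion. -/
lemma dct_infl [DecidableEq E] [Countable E] [Countable V] (P : E → ℝ)
    (R : Finset V) {o : V} (ho : o ∈ R) (T : Set V) (hT : ∀ x, x ∈ R ↔ x ∉ T) (F : Finset E)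
    (hF : ∀ e, (G.s e ∉ T ∨ G.t e ∉ T) → e ∈ F)
    (hφ : ∀ S ⊆ R, o ∈ S → 1 ≤ ∑ d ∈ G.outD F S, pr P {ω | G.Conn ω S o (G.tl d)}) :
    1 - pr P {ω | G.Hit ω univ o T} ≤ ∑ e ∈ F, infl P e {ω | G.Hit ω univ o T} := by
  classical
  set A := {ω | G.Hit ω univ o T} with hA
  have mA : MeasurableSet A := measurable_hit _ _ _
  have uA : IsUpperSet A := upper_hit _ _ _
  let Sc : Finset V → Set (E → Bool) := fun S => {ω | ∀ x ∈ R, (x ∈ S ↔ ¬ G.Hit ω univ x T)}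
  have mSc : ∀ S, MeasurableSet (Sc S) := by
    intro C
    have : Sc C = ⋂ x ∈ R, {ω | x ∈ C ↔ ¬ G.Hit ω univ x T} := by ext; simp [Sc]
    rw [this]
    refine Finset.measurableSet_biInter _ fun x _ => ?_
    have h := (measurable_hit (G := G) univ x T)
    by_cases hx : x ∈ C
    · convert h.compl using 1
      ext; simp [hx]
    · convert h using 1
      ext; simp [hx]
  let I := R.powerset.filter fun S => o ∈ S
  have dSc : ∀ S ∈ I, Det {e | G.s e ∉ S ∨ G.t e ∉ S} (Sc S) := by
    intro S hS ω ω' hw hω x hx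
    have hSR := Finset.mem_powerset.1 (Finset.mem_filter.1 hS).1
    rw [hω x hx]
    have : G.Hit ω univ x T ↔ G.Hit ω' univ x T := by
      have hh : ∀ y ∈ T, (G.Conn ω univ y x ↔ G.Conn ω' univ y x) := by
        intro y hy
        refine explore (fun e _ _ h3 => hw e ?_) x
        have hn : ∀ z, G.Conn ω univ y z → z ∉ S := fun z hz hzS =>
          (hω z (hSR hzS)).1 hzS ⟨y, hy, hz.symm⟩
        exact h3.imp (hn _) (hn _)
      constructor
      · rintro ⟨y, hy, h⟩; exact ⟨y, hy, ((hh y hy).1 h.symm).symm⟩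
      · rintro ⟨y, hy, h⟩; exact ⟨y, hy, ((hh y hy).2 h.symm).symm⟩
    rw [this]
  have disj : PairwiseDisjoint (I : Set (Finset V)) Sc := by
    intro C hC C' hC' hne
    rw [Function.onFun, Set.disjoint_left]
    intro ω h h'
    apply hne
    have hC := Finset.mem_powerset.1 (Finset.mem_filter.1 hC).1
    have hC' := Finset.mem_powerset.1 (Finset.mem_filter.1 hC').1
    ext x
    constructor
    · intro hx; exact (h' x (hC hx)).2 ((h x (hC hx)).1 hx)
    · intro hx; exact (h x (hC' hx)).2 ((h' x (hC' hx)).1 hx)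
  have hcov : Aᶜ = ⋃ S ∈ I, Sc S := by
    ext ω
    simp only [mem_compl_iff, mem_iUnion, exists_prop]
    constructor
    · intro hω
      refine ⟨R.filter fun x => ¬ G.Hit ω univ x T, ?_, ?_⟩
      · simp only [I, Finset.mem_filter, Finset.mem_powerset]
        exact ⟨Finset.filter_subset _ _, ho, hω⟩
      · intro x hx; simp [hx]
    · rintro ⟨S, hS, hω⟩
      exact (hω o ho).1 (Finset.mem_filter.1 hS).2
  have hpA : 1 - pr P A = ∑ S ∈ I, pr P (Sc S) := by
    rw [← pr_compl P mA, hcov, pr_biUnion P disj fun S _ => mSc S]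
  have hinfl : ∀ e, ∑ S ∈ I, pr P (Sc S ∩ setc e true A) ≤ infl P e A := by
    intro e
    rw [← pr_biUnion P (disj.mono fun S => inter_subset_left)
      fun S _ => (mSc S).inter (measurableSet_setc e true mA)]
    have h1 : pr P (setc e false A ∪ ⋃ S ∈ I, (Sc S ∩ setc e true A)) ≤ pr P (setc e true A) := by
      apply pr_mono
      apply union_subset (setc_mono e uA)
      intro ω hω
      simp only [mem_iUnion] at hω
      obtain ⟨S, _, hω⟩ := hω
      exact hω.2
    rw [pr_union] at h1
    · unfold infl; linarith
    · rw [Set.disjoint_left]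
      intro ω hω hω'
      have : ω ∈ Aᶜ := by
        rw [hcov]
        simp only [mem_iUnion] at hω' ⊢
        obtain ⟨S, hS, hω'⟩ := hω'
        exact ⟨S, hS, hω'.1⟩
      apply this
      refine uA ?_ hω
      rw [update_le_iff]
      exact ⟨Bool.false_le _, fun _ _ => le_rfl⟩
    · exact Finset.measurableSet_biUnion _ fun S _ => (mSc S).inter (measurableSet_setc e true mA)
  have hSe : ∀ S ∈ I, ∀ e, ∑ b : Bool, (if G.tl (e, b) ∈ S ∧ G.hd (e, b) ∉ S then
      pr P (Sc S) * pr P {ω | G.Conn ω S o (G.tl (e, b))} else 0) ≤ pr P (Sc S ∩ setc e true A) := by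
    intro S hS e
    have hb : ∀ b, G.tl (e, b) ∈ S ∧ G.hd (e, b) ∉ S →
        pr P (Sc S) * pr P {ω | G.Conn ω S o (G.tl (e, b))} ≤ pr P (Sc S ∩ setc e true A) := by
      rintro b ⟨h1, h2⟩
      rw [← pr_inter_of_det P (dSc S hS) (det_conn (S : Set V) o (G.tl (e, b))) _ (mSc S)
        (measurable_conn _ _ _)]
      · apply pr_mono
        rintro ω ⟨h3, h4⟩
        refine ⟨h3, ?_⟩
        have hle : ∀ f, ω f = true → Function.update ω e true f = true := by
          intro f hf
          by_cases hfe : f = e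
          · subst hfe; simp
          · rwa [Function.update_of_ne hfe]
        have hhit : G.Hit ω univ (G.hd (e, b)) T := by
          by_cases hR : G.hd (e, b) ∈ R
          · by_contra hcon
            exact h2 ((h3 _ hR).2 hcon)
          · exact ⟨_, by have := hT (G.hd (e, b)); tauto, .refl _⟩
        obtain ⟨y, hy, hc⟩ := hhit
        refine ⟨y, hy, ?_⟩
        refine Conn.trans (Conn.mono h4 (subset_univ _) hle) (Conn.trans ?_
          (hc.mono (subset_univ _) hle))
        exact .single trivial trivial ⟨(e, b), by simp, rfl, rfl⟩
      · rw [Set.disjoint_left]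
        rintro e he ⟨h3, h4⟩
        rcases he with he | he
        · exact he h3
        · exact he h4
    rw [Fintype.sum_bool]
    by_cases hx : G.tl (e, true) ∈ S ∧ G.hd (e, true) ∉ S
    · have hy : ¬ (G.tl (e, false) ∈ S ∧ G.hd (e, false) ∉ S) := by
        simp only [tl, hd] at hx ⊢; simp at hx ⊢; tauto
      rw [if_pos hx, if_neg hy, add_zero]; exact hb _ hx
    · rw [if_neg hx, zero_add]
      split_ifs with hy
      · exact hb _ hy
      · exact pr_nonneg _ _
  calc 1 - pr P A = ∑ S ∈ I, pr P (Sc S) := hpA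
    _ ≤ ∑ S ∈ I, pr P (Sc S) * ∑ d ∈ G.outD F S, pr P {ω | G.Conn ω S o (G.tl d)} := by
        refine Finset.sum_le_sum fun S hS => ?_
        obtain ⟨h1, h2⟩ := Finset.mem_filter.1 hS
        exact le_mul_of_one_le_right (pr_nonneg _ _) (hφ S (Finset.mem_powerset.1 h1) h2)
    _ = ∑ S ∈ I, ∑ e ∈ F, ∑ b : Bool, (if G.tl (e, b) ∈ S ∧ G.hd (e, b) ∉ S then
      pr P (Sc S) * pr P {ω | G.Conn ω S o (G.tl (e, b))} else 0) := by
        refine Finset.sum_congr rfl fun S _ => ?_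
        rw [outD, Finset.mul_sum, Finset.sum_filter, Finset.sum_product]
    _ ≤ ∑ S ∈ I, ∑ e ∈ F, pr P (Sc S ∩ setc e true A) :=
        Finset.sum_le_sum fun S hS => Finset.sum_le_sum fun e _ => hSe S hS e
    _ = ∑ e ∈ F, ∑ S ∈ I, pr P (Sc S ∩ setc e true A) := Finset.sum_comm
    _ ≤ _ := Finset.sum_le_sum fun e _ => hinfl e

/-- Integrated form, for homogeneous percolation. -/
lemma dct_lower [Countable E] [Countable V]
    (R : Finset V) {o : V} (ho : o ∈ R) (T : Set V) (hT : ∀ x, x ∈ R ↔ x ∉ T) (F : Finset E)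
    (hF : ∀ e, (G.s e ∉ T ∨ G.t e ∉ T) → e ∈ F) {p0 p1 : ℝ} (h0 : 0 < p0) (h01 : p0 ≤ p1)
    (h1 : p1 < 1)
    (hφ : ∀ S ⊆ R, o ∈ S → 1 ≤ ∑ d ∈ G.outD F S, pr (fun _ => p0) {ω | G.Conn ω S o (G.tl d)}) :
    1 - Real.exp (-(p1 - p0)) ≤ pr (fun _ => p1) {ω | G.Hit ω univ o T} := by
  classical
  set A := {ω | G.Hit ω univ o T} with hA
  have dA : Det (F : Set E) A := (det_hit univ o T).mono fun e he => hF e he.2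
  have hder : ∀ x ∈ Icc p0 p1, HasDerivAt (fun x => pr (fun _ => x) A)
      (∑ e ∈ F, (1:ℝ) * infl (fun _ => x) e A) x := by
    intro x hx
    refine russo dA (fun x _ => x) (fun _ => 1) x (fun _ => hasDerivAt_id x) ?_
    have : ∀ᶠ s in nhds x, s ∈ Ioo (0:ℝ) 1 := Ioo_mem_nhds (by linarith [hx.1]) (by linarith [hx.2])
    filter_upwards [this] with s hs _
    exact ⟨hs.1.le, hs.2.le⟩
  have hge : ∀ x ∈ Icc p0 p1, 1 - pr (fun _ => x) A ≤ ∑ e ∈ F, (1:ℝ) * infl (fun _ => x) e A := by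
    intro x hx
    simp only [one_mul]
    refine dct_infl (fun _ => x) R ho T hT F hF fun S hS hoS => ?_
    refine (hφ S hS hoS).trans (Finset.sum_le_sum fun d _ => ?_)
    refine pr_mono_param (F := F) ?_ (upper_conn _ _ _) _ _ (fun _ => h0.le)
      (fun _ => by linarith [hx.2]) fun _ => hx.1
    refine (det_conn _ _ _).mono fun e he => hF e (Or.inl ((hT _).1 (hS he.1)))
  let g : ℝ → ℝ := fun x => (1 - pr (fun _ => x) A) * Real.exp x
  have hg : ∀ x ∈ Icc p0 p1, HasDerivAt g
      (-(∑ e ∈ F, (1:ℝ) * infl (fun _ => x) e A) * Real.exp x + (1 - pr (fun _ => x) A) * Real.exp x) x := by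
    intro x hx
    exact ((hder x hx).const_sub 1).mul (Real.hasDerivAt_exp x)
  have hanti : AntitoneOn g (Icc p0 p1) := by
    refine antitoneOn_of_deriv_nonpos (convex_Icc _ _)
      (fun x hx => (hg x hx).continuousAt.continuousWithinAt)
      (fun x hx => (hg x (interior_subset hx)).differentiableAt.differentiableWithinAt) fun x hx => ?_
    have hx := interior_subset hx
    rw [(hg x hx).deriv]
    have := hge x hx
    have e := Real.exp_pos x
    nlinarith
  have h2 := hanti (left_mem_Icc.2 h01) (right_mem_Icc.2 h01) h01
  simp only [g] at h2
  have h3 : 1 - pr (fun _ => p0) A ≤ 1 := by linarith [pr_nonneg (fun _ => p0) A]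
  have e0 := Real.exp_pos p0
  have e1 := Real.exp_pos p1
  have h4 : (1 - pr (fun _ => p1) A) ≤ Real.exp p0 / Real.exp p1 := by
    rw [le_div_iff₀ e1]; nlinarith
  rw [← Real.exp_sub] at h4
  have : p0 - p1 = -(p1 - p0) := by ring
  rw [this] at h4
  linarith

end Gr
end

section
open ProbabilityTheory Relation

namespace Gr
variable {V E : Type*} {G : Gr V E}

/-- The edge `e` joins `a` and `b`. -/
def Ends (G : Gr V E) (e : E) (a b : V) : Prop :=
  (G.s e = a ∧ G.t e = b) ∨ (G.s e = b ∧ G.t e = a)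

lemma Ends.symm {e : E} {a b : V} (h : G.Ends e a b) : G.Ends e b a := Or.symm h

lemma Ends.adj {e : E} {a b : V} (h : G.Ends e a b) {ω : E → Bool} (ho : ω e = true) :
    G.Adj ω a b := by
  rcases h with ⟨rfl, rfl⟩ | ⟨rfl, rfl⟩
  · exact adj_edge ho
  · exact (adj_edge ho).symm

lemma Ends.conn {e : E} {a b : V} (h : G.Ends e a b) {ω : E → Bool} (ho : ω e = true) :
    G.Conn ω univ a b := .single trivial trivial (h.adj ho)

lemma Conn.transfer {ω ω' : E → Bool} {U U' : Set V} {x y : V} (h : G.Conn ω U x y) (hU : U ⊆ U')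
    (hw : ∀ e, G.s e ∈ U → G.t e ∈ U → ω e = true → ω' e = true) : G.Conn ω' U' x y := by
  induction h with
  | refl => exact .refl _
  | tail _ h ih =>
    obtain ⟨ha, hb, d, h1, rfl, rfl⟩ := h
    refine ih.tail (hU ha) (hU hb) ⟨d, ?_, rfl, rfl⟩
    rcases tl_hd (G := G) d with ⟨a, b⟩ | ⟨a, b⟩ <;> rw [a] at ha <;> rw [b] at hb
    · exact hw _ ha hb h1
    · exact hw _ hb ha h1

lemma not_hit_of_closed {ω : E → Bool} {o : V} {T : Set V} (C : Set V) (ho : o ∈ C)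
    (hcl : ∀ e, ω e = true → (G.s e ∈ C ↔ G.t e ∈ C)) (hCT : ∀ x ∈ C, x ∉ T) :
    ¬ G.Hit ω univ o T := by
  rintro ⟨y, hy, hc⟩
  refine hCT y ?_ hy
  clear hy
  induction hc with
  | refl => exact ho
  | tail _ h ih =>
    obtain ⟨-, -, d, h1, rfl, rfl⟩ := h
    have := hcl _ h1
    rcases tl_hd (G := G) d with ⟨a, b⟩ | ⟨a, b⟩ <;> rw [a] at ih <;> rw [b] <;> tauto

variable [DecidableEq E]

/-- The coordinate `f` is pivotal for the event `A`. -/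
def Piv (A : Set (E → Bool)) (f : E) : Set (E → Bool) := setc f true A \ setc f false A

open Classical in
lemma ag_half {o v w v' w' : V} {T : Set V} {e f g h : E} {ω : E → Bool} (W : Finset E)
    (he : G.Ends e v w) (hf : G.Ends f v v') (hg : G.Ends g w w') (hh : G.Ends h v' w')
    (d2 : v ≠ v') (d3 : v ≠ w') (d4 : w ≠ v')
    (hW : ∀ i, (G.s i = v ∨ G.s i = w ∨ G.s i = v' ∨ G.s i = w' ∨
      G.t i = v ∨ G.t i = w ∨ G.t i = v' ∨ G.t i = w') → i ∈ W)
    (hno : ¬ G.Hit ω univ o T) (hov : G.Conn ω univ o v)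
    (hwT : G.Hit ω univ w T) :
    ∃ ω', (∀ i ∉ W, ω i = ω' i) ∧
      (ω' ∈ Piv {ω | G.Hit ω univ o T} f ∨ ω' ∈ Piv {ω | G.Hit ω univ o T} g) := by
  set C : Set V := {x | G.Conn ω univ o x} with hC
  have hoC : o ∈ C := .refl _
  have hCT : ∀ x ∈ C, x ∉ T := fun x hx hxT => hno ⟨x, hxT, hx⟩
  have hcl : ∀ e, ω e = true → (G.s e ∈ C ↔ G.t e ∈ C) := by
    intro e he
    constructor
    · intro h; exact Conn.tail h trivial trivial (adj_edge he)
    · intro h; exact Conn.tail h trivial trivial (adj_edge he).symm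
  have hvC : v ∈ C := hov
  obtain ⟨y, hyT, hwy⟩ := hwT
  have hwC : w ∉ C := fun hw => hno ⟨y, hyT, Conn.trans hw hwy⟩
  have hwy' : G.Conn ω Cᶜ w y := by
    by_contra hcon
    have : ∀ z, G.Conn ω univ w z → z ∉ C ∧ G.Conn ω Cᶜ w z := by
      intro z hz
      induction hz with
      | refl => exact ⟨hwC, .refl _⟩
      | tail _ hb ih =>
        obtain ⟨-, -, d, h1, rfl, rfl⟩ := hb
        have h2 := hcl _ h1
        have h3 : G.hd d ∉ C := by
          rcases tl_hd (G := G) d with ⟨a, b⟩ | ⟨a, b⟩ <;> rw [a] at ih <;> rw [b] <;> tauto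
        exact ⟨h3, ih.2.tail ih.1 h3 ⟨d, h1, rfl, rfl⟩⟩
    exact hcon (this y hwy).2
  have upd : ∀ (η : E → Bool) i, η i = true → ∀ j, Function.update η j true i = true := by
    intro η i hi j
    by_cases h : i = j
    · subst h; simp
    · rwa [Function.update_of_ne h]
  have updf : ∀ (η : E → Bool) i j, Function.update η j false i = true → i ≠ j ∧ η i = true := by
    intro η i j hij
    by_cases h : i = j
    · subst h; simp at hij
    · rw [Function.update_of_ne h] at hij; exact ⟨h, hij⟩
  by_cases hw'C : w' ∈ C
  · -- case A
    refine ⟨ω, fun _ _ => rfl, Or.inr ⟨?_, ?_⟩⟩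
    · refine ⟨y, hyT, ?_⟩
      have h1 : G.Conn (Function.update ω g true) univ o w' :=
        Conn.mono hw'C subset_rfl fun i hi => upd ω i hi g
      exact h1.trans ((hg.symm.conn (by simp)).trans
        (hwy.mono subset_rfl fun i hi => upd ω i hi g))
    · rintro ⟨z, hz, hc⟩
      exact hno ⟨z, hz, hc.mono subset_rfl fun i hi => (updf ω i g hi).2⟩
  by_cases hv'C : v' ∈ C
  · -- case C
    have hsplit : G.Conn ω {v}ᶜ o v' ∨ G.Conn ω {v'}ᶜ o v := by
      have key : ∀ z, G.Conn ω univ o z → (G.Conn ω {v}ᶜ o v' ∨ G.Conn ω {v'}ᶜ o v) ∨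
          (z ≠ v ∧ z ≠ v' ∧ G.Conn ω ({v}ᶜ ∩ {v'}ᶜ) o z) := by
        intro z hz
        induction hz with
        | refl =>
          by_cases h1 : o = v
          · left; right; rw [h1]; exact .refl _
          · by_cases h2 : o = v'
            · left; left; rw [h2]; exact .refl _
            · exact Or.inr ⟨h1, h2, .refl _⟩
        | @tail b c _ hbc ih =>
          rcases ih with ih | ⟨i1, i2, i3⟩
          · exact Or.inl ih
          · obtain ⟨-, -, hadj⟩ := hbc
            by_cases h1 : c = v
            · left; right; subst h1
              exact (i3.mono inter_subset_right fun _ h => h).tail (by simpa using i2)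
                (by simpa using d2) hadj
            · by_cases h2 : c = v'
              · left; left; subst h2
                exact (i3.mono inter_subset_left fun _ h => h).tail (by simpa using i1)
                  (by simpa using d2.symm) hadj
              · exact Or.inr ⟨h1, h2, i3.tail ⟨by simpa using i1, by simpa using i2⟩
                  ⟨by simpa using h1, by simpa using h2⟩ hadj⟩
      rcases key v hvC with h | h
      · exact h
      · exact absurd rfl h.1
    rcases hsplit with hs | hs
    · -- C1
      have hov' : o ≠ v := by
        rcases hs.mem_or with h | h
        · rw [h]; exact d2.symm
        · simpa using h.1
      let ω' : E → Bool := fun i => if i = e then true else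
        if G.s i = v ∨ G.t i = v then false else ω i
      have hω' : ∀ i, ω' i = true → i = e ∨ (G.s i ≠ v ∧ G.t i ≠ v ∧ ω i = true) := by
        intro i hi
        simp only [ω'] at hi
        split_ifs at hi with h1 h2
        · exact Or.inl h1
        · push Not at h2; exact Or.inr ⟨h2.1, h2.2, hi⟩
      have hω'' : ∀ i, G.s i ≠ v → G.t i ≠ v → ω i = true → ω' i = true := by
        intro i h1 h2 h3
        simp only [ω']
        split_ifs with h4 h5
        · rfl
        · tauto
        · exact h3
      refine ⟨ω', fun i hi => ?_, Or.inl ⟨?_, ?_⟩⟩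
      · have h1 : ¬ (G.s i = v ∨ G.t i = v) := fun h => hi (hW i (by tauto))
        have h2 : i ≠ e := by
          rintro rfl; rcases he with ⟨a, b⟩ | ⟨a, b⟩ <;> tauto
        show ω i = _
        simp only [ω']
        rw [if_neg h2, if_neg h1]
      · refine ⟨y, hyT, ?_⟩
        have c1 : G.Conn (Function.update ω' f true) univ o v' :=
          hs.transfer (subset_univ _) fun i h1 h2 h3 => upd _ _ (hω'' i h1 h2 h3) _
        have c2 : G.Conn (Function.update ω' f true) univ v' v := hf.symm.conn (by simp)
        have c3 : G.Conn (Function.update ω' f true) univ v w := he.conn (upd _ _ (by simp [ω']) _)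
        have c4 : G.Conn (Function.update ω' f true) univ w y := by
          refine hwy'.transfer (subset_univ _) fun i h1 h2 h3 => upd _ _ (hω'' i ?_ ?_ h3) _
          · rintro h; rw [h] at h1; exact h1 hvC
          · rintro h; rw [h] at h2; exact h2 hvC
        exact c1.trans (c2.trans (c3.trans c4))
      · refine not_hit_of_closed (C \ {v}) ⟨hoC, by simpa using hov'⟩ (fun i hi => ?_)
          fun x hx => hCT x hx.1
        obtain ⟨-, hi⟩ := updf _ _ _ hi
        simp only [mem_diff, mem_singleton_iff]
        rcases hω' i hi with rfl | ⟨h1, h2, h3⟩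
        · rcases he with ⟨a, b⟩ | ⟨a, b⟩ <;> rw [a, b] <;> tauto
        · have := hcl i h3; tauto
    · -- C2
      have hov' : o ≠ v' := by
        rcases hs.mem_or with h | h
        · rw [h]; exact d2
        · simpa using h.1
      let ω' : E → Bool := fun i => if i = h ∨ i = g then true else
        if G.s i = v' ∨ G.t i = v' then false else ω i
      have hω' : ∀ i, ω' i = true → (i = h ∨ i = g) ∨ (G.s i ≠ v' ∧ G.t i ≠ v' ∧ ω i = true) := by
        intro i hi
        simp only [ω'] at hi
        split_ifs at hi with h1 h2
        · exact Or.inl h1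
        · push Not at h2; exact Or.inr ⟨h2.1, h2.2, hi⟩
      have hω'' : ∀ i, G.s i ≠ v' → G.t i ≠ v' → ω i = true → ω' i = true := by
        intro i h1 h2 h3
        simp only [ω']
        split_ifs with h4 h5
        · rfl
        · tauto
        · exact h3
      refine ⟨ω', fun i hi => ?_, Or.inl ⟨?_, ?_⟩⟩
      · have h1 : ¬ (G.s i = v' ∨ G.t i = v') := fun h => hi (hW i (by tauto))
        have h2 : ¬ (i = h ∨ i = g) := by
          rintro (rfl | rfl)
          · apply h1; rcases hh with ⟨a, b⟩ | ⟨a, b⟩ <;> tauto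
          · apply hi; apply hW; rcases hg with ⟨a, b⟩ | ⟨a, b⟩ <;> tauto
        show ω i = _
        simp only [ω']
        rw [if_neg h2, if_neg h1]
      · refine ⟨y, hyT, ?_⟩
        have c1 : G.Conn (Function.update ω' f true) univ o v :=
          hs.transfer (subset_univ _) fun i h1 h2 h3 => upd _ _ (hω'' i h1 h2 h3) _
        have c2 : G.Conn (Function.update ω' f true) univ v v' := hf.conn (by simp)
        have c3 : G.Conn (Function.update ω' f true) univ v' w' := hh.conn (upd _ _ (by simp [ω']) _)
        have c3' : G.Conn (Function.update ω' f true) univ w' w :=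
          hg.symm.conn (upd _ _ (by simp [ω']) _)
        have c4 : G.Conn (Function.update ω' f true) univ w y := by
          refine hwy'.transfer (subset_univ _) fun i h1 h2 h3 => upd _ _ (hω'' i ?_ ?_ h3) _
          · rintro h; rw [h] at h1; exact h1 hv'C
          · rintro h; rw [h] at h2; exact h2 hv'C
        exact c1.trans (c2.trans (c3.trans (c3'.trans c4)))
      · refine not_hit_of_closed (C \ {v'}) ⟨hoC, by simpa using hov'⟩ (fun i hi => ?_)
          fun x hx => hCT x hx.1
        obtain ⟨-, hi⟩ := updf _ _ _ hi
        simp only [mem_diff, mem_singleton_iff]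
        rcases hω' i hi with (rfl | rfl) | ⟨h1, h2, h3⟩
        · rcases hh with ⟨a, b⟩ | ⟨a, b⟩ <;> rw [a, b] <;> tauto
        · rcases hg with ⟨a, b⟩ | ⟨a, b⟩ <;> rw [a, b] <;> tauto
        · have := hcl i h3; tauto
  · -- case B
    let ω' : E → Bool := fun i => if i = h ∨ i = g then true else ω i
    have hω' : ∀ i, ω' i = true → (i = h ∨ i = g) ∨ ω i = true := by
      intro i hi
      simp only [ω'] at hi
      split_ifs at hi with h1
      · exact Or.inl h1
      · exact Or.inr hi
    have hω'' : ∀ i, ω i = true → ω' i = true := by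
      intro i h3
      simp only [ω']
      split_ifs with h4
      · rfl
      · exact h3
    refine ⟨ω', fun i hi => ?_, Or.inl ⟨?_, ?_⟩⟩
    · have h2 : ¬ (i = h ∨ i = g) := by
        rintro (rfl | rfl)
        · apply hi; apply hW; rcases hh with ⟨a, b⟩ | ⟨a, b⟩ <;> tauto
        · apply hi; apply hW; rcases hg with ⟨a, b⟩ | ⟨a, b⟩ <;> tauto
      simp [ω', h2]
    · refine ⟨y, hyT, ?_⟩
      have c1 : G.Conn (Function.update ω' f true) univ o v :=
        hov.mono (subset_univ _) fun i h3 => upd _ _ (hω'' i h3) _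
      have c2 : G.Conn (Function.update ω' f true) univ v v' := hf.conn (by simp)
      have c3 : G.Conn (Function.update ω' f true) univ v' w' := hh.conn (upd _ _ (by simp [ω']) _)
      have c3' : G.Conn (Function.update ω' f true) univ w' w :=
        hg.symm.conn (upd _ _ (by simp [ω']) _)
      have c4 : G.Conn (Function.update ω' f true) univ w y :=
        hwy.mono (subset_univ _) fun i h3 => upd _ _ (hω'' i h3) _
      exact c1.trans (c2.trans (c3.trans (c3'.trans c4)))
    · refine not_hit_of_closed C hoC (fun i hi => ?_) hCT
      obtain ⟨-, hi⟩ := updf _ _ _ hi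
      rcases hω' i hi with (rfl | rfl) | h3
      · rcases hh with ⟨a, b⟩ | ⟨a, b⟩ <;> rw [a, b] <;> tauto
      · rcases hg with ⟨a, b⟩ | ⟨a, b⟩ <;> rw [a, b] <;> tauto
      · exact hcl i h3

lemma infl_eq_piv (P : E → ℝ) (e : E) {A : Set (E → Bool)} (mA : MeasurableSet A)
    (uA : IsUpperSet A) : infl P e A = pr P (Piv A e) := by
  unfold infl Piv
  exact (measureReal_sdiff (setc_mono e uA) (measurableSet_setc e false mA)).symm

lemma infl_nonneg (P : E → ℝ) (e : E) {A : Set (E → Bool)} (uA : IsUpperSet A) :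
    0 ≤ infl P e A := sub_nonneg.2 (pr_mono P (setc_mono e uA))

/-- Comparison of influences around a square. -/
lemma ag_infl [Countable E] [Countable V] {o v w v' w' : V} {T : Set V} {e f g h : E} (W : Finset E)
    (he : G.Ends e v w) (hf : G.Ends f v v') (hg : G.Ends g w w') (hh : G.Ends h v' w')
    (d2 : v ≠ v') (d3 : v ≠ w') (d4 : w ≠ v') (d5 : w ≠ w')
    (hW : ∀ i, (G.s i = v ∨ G.s i = w ∨ G.s i = v' ∨ G.s i = w' ∨
      G.t i = v ∨ G.t i = w ∨ G.t i = v' ∨ G.t i = w') → i ∈ W)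
    (P : E → ℝ) (κ : ℝ) (hκ : 0 < κ) (hP : ∀ e ∈ W, κ ≤ P e ∧ P e ≤ 1 - κ) :
    infl P e {ω | G.Hit ω univ o T} ≤ (2 / κ) ^ W.card *
      (infl P f {ω | G.Hit ω univ o T} + infl P g {ω | G.Hit ω univ o T}) := by
  set A := {ω | G.Hit ω univ o T} with hA
  have mA : MeasurableSet A := measurable_hit _ _ _
  have uA : IsUpperSet A := upper_hit _ _ _
  have mPiv : ∀ i, MeasurableSet (Piv A i) := fun i =>
    (measurableSet_setc i true mA).diff (measurableSet_setc i false mA)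
  have heW : e ∈ W := hW e (by rcases he with ⟨a, b⟩ | ⟨a, b⟩ <;> tauto)
  have key := surgery P κ hκ W hP (Piv A e) (Piv A f ∪ Piv A g) ((mPiv f).union (mPiv g)) (by
    rintro ω ⟨h1, h2⟩
    set ω0 := Function.update ω e false with hω0
    have hpath : (G.Conn ω0 univ o v ∧ G.Hit ω0 univ w T) ∨
        (G.Conn ω0 univ o w ∧ G.Hit ω0 univ v T) := by
      have hopen : ∀ i, Function.update ω e true i = true → i = e ∨ ω0 i = true := by
        intro i hi
        by_cases hie : i = e
        · exact Or.inl hie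
        · right; rw [hω0, Function.update_of_ne hie]; rwa [Function.update_of_ne hie] at hi
      obtain ⟨y, hy, hc⟩ := h1
      have hyC : y ∉ {x | G.Conn ω0 univ o x} := fun h => h2 ⟨y, hy, h⟩
      obtain ⟨d, e1, e2, e3, -, -, e4⟩ := last_exit hc
        (C := {x | G.Conn ω0 univ o x}) (Conn.refl o) hyC
      have hde : d.1 = e := by
        rcases hopen _ e1 with h | h
        · exact h
        · exact absurd (Conn.tail e2 trivial trivial ⟨d, h, rfl, rfl⟩) e3
      have hc' : G.Conn ω0 univ (G.hd d) y := by
        refine e4.transfer (subset_univ _) fun i i1 i2 i3 => ?_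
        rcases hopen _ i3 with rfl | h
        · exfalso
          rcases tl_hd (G := G) d with ⟨a, b⟩ | ⟨a, b⟩ <;> rw [hde] at a b <;> rw [a] at e2
          · exact i1.2 e2
          · exact i2.2 e2
        · exact h
      have hends : (G.tl d = v ∧ G.hd d = w) ∨ (G.tl d = w ∧ G.hd d = v) := by
        rcases tl_hd (G := G) d with ⟨a, b⟩ | ⟨a, b⟩ <;> rw [hde] at a b <;> rw [a, b] <;>
          rcases he with ⟨a', b'⟩ | ⟨a', b'⟩ <;> tauto
      rcases hends with ⟨a, b⟩ | ⟨a, b⟩ <;> rw [a] at e2 <;> rw [b] at hc'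
      · exact Or.inl ⟨e2, y, hy, hc'⟩
      · exact Or.inr ⟨e2, y, hy, hc'⟩
    have hoff : ∀ i ∉ W, ω i = ω0 i := by
      intro i hi
      have : i ≠ e := fun h => hi (h ▸ heW)
      rw [hω0, Function.update_of_ne this]
    rcases hpath with ⟨p1, p2⟩ | ⟨p1, p2⟩
    · obtain ⟨ω', q1, q2⟩ := ag_half W he hf hg hh d2 d3 d4 hW h2 p1 p2
      exact ⟨ω', q2, fun i hi => (hoff i hi).trans (q1 i hi)⟩
    · obtain ⟨ω', q1, q2⟩ := ag_half W he.symm hg hf hh.symm d5 d4 d3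
        (fun i hi => hW i (by tauto)) h2 p1 p2
      exact ⟨ω', q2.symm, fun i hi => (hoff i hi).trans (q1 i hi)⟩)
  rw [infl_eq_piv P e mA uA, infl_eq_piv P f mA uA, infl_eq_piv P g mA uA, div_pow, div_mul_eq_mul_div,
    le_div_iff₀ (by positivity), mul_comm]
  refine key.trans ?_
  have := pr_union_le P (Piv A f) (Piv A g)
  gcongr

end Gr
end

section
open ProbabilityTheory Relation

open Classical in
/-- The slab as a graph with edge labels; labels of non-edges are loops. -/
noncomputable def slabG (k : ℕ) : Gr Vtx EdgeIdx where
  s e := e.1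
  t e := if IsEdge k e then e.1 + dvec e.2 else e.1

/-- Edge parameters of the anisotropic model. -/
noncomputable def sp (p q : ℝ) (e : EdgeIdx) : ℝ := if e.2 = 2 then q else p

/-- Far vertices (or vertices outside of the slab). -/
def slabT (k n : ℕ) : Set Vtx := {v | ¬ (InSlab k v ∧ |v.1| < n ∧ |v.2.1| < n)}

/-- Edges close to the origin. -/
noncomputable def slabF (k n : ℕ) : Finset EdgeIdx :=
  (Finset.Icc (-(n : ℤ)) n ×ˢ Finset.Icc (-(n : ℤ)) n ×ˢ Finset.Icc (-1 : ℤ) (k + 1)) ×ˢ Finset.univ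

/-- The event that the origin is joined to distance `n`. -/
def slabA (k n : ℕ) : Set Config := {ω | (slabG k).Hit ω univ 0 (slabT k n)}

/-- Finite volume approximation of `theta`. -/
noncomputable def th (k n : ℕ) (p q : ℝ) : ℝ := pr (sp p q) (slabA k n)

lemma slab_s (k : ℕ) (e : EdgeIdx) : (slabG k).s e = e.1 := rfl

lemma slab_t (k : ℕ) {e : EdgeIdx} (h : IsEdge k e) : (slabG k).t e = e.1 + dvec e.2 := if_pos h

lemma slab_t' (k : ℕ) {e : EdgeIdx} (h : ¬ IsEdge k e) : (slabG k).t e = e.1 := if_neg h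

lemma slab_t_or (k : ℕ) (e : EdgeIdx) : (slabG k).t e = e.1 + dvec e.2 ∨ (slabG k).t e = e.1 := by
  by_cases h : IsEdge k e
  · exact Or.inl (slab_t k h)
  · exact Or.inr (slab_t' k h)

lemma slab_ends (k : ℕ) {e : EdgeIdx} (h : IsEdge k e) {a b : Vtx} (ha : e.1 = a)
    (hb : e.1 + dvec e.2 = b) : (slabG k).Ends e a b :=
  Or.inl ⟨ha, (slab_t k h).trans hb⟩

lemma slabF_spec (k n : ℕ) (e : EdgeIdx)
    (h : (slabG k).s e ∉ slabT k n ∨ (slabG k).t e ∉ slabT k n) : e ∈ slabF k n := by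
  obtain ⟨⟨x, y, z⟩, i⟩ := e
  have h' : (x, y, z) ∉ slabT k n ∨ (x, y, z) + dvec i ∉ slabT k n := by
    rcases h with h | h
    · exact Or.inl h
    · rcases slab_t_or k ((x, y, z), i) with h' | h' <;> rw [h'] at h
      · exact Or.inr h
      · exact Or.inl h
  simp only [slabT, mem_ofPred_eq, not_not, InSlab, abs_lt] at h'
  simp only [slabF, Finset.mem_product, Finset.mem_Icc, Finset.mem_univ, and_true]
  rcases h' with h' | h'
  · omega
  · fin_cases i <;> simp [dvec] at h' <;> omega

lemma slabA_det (k n : ℕ) : Det (slabF k n : Set EdgeIdx) (slabA k n) :=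
  (Gr.det_hit univ 0 (slabT k n)).mono fun e he => slabF_spec k n e he.2

lemma slabA_upper (k n : ℕ) : IsUpperSet (slabA k n) := Gr.upper_hit _ _ _

lemma slabA_meas (k n : ℕ) : MeasurableSet (slabA k n) := Gr.measurable_hit _ _ _

lemma sp_bounds {p q l u : ℝ} (h : (l ≤ p ∧ p ≤ u) ∧ (l ≤ q ∧ q ≤ u)) (e : EdgeIdx) :
    l ≤ sp p q e ∧ sp p q e ≤ u := by
  unfold sp; split_ifs <;> tauto

lemma th_mono (k n : ℕ) {p q p' q' : ℝ} (hp : 0 ≤ p) (hq : 0 ≤ q) (hpp : p ≤ p') (hqq : q ≤ q')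
    (hp1 : p' ≤ 1) (hq1 : q' ≤ 1) : th k n p q ≤ th k n p' q' := by
  refine pr_mono_param (slabA_det k n) (slabA_upper k n) _ _ ?_ ?_ ?_ <;> intro e <;>
    unfold sp <;> split_ifs <;> assumption

lemma infl_eq_zero_of_det {E : Type*} [DecidableEq E] (P : E → ℝ) {e : E} {I : Set E}
    {A : Set (E → Bool)} (h : Det I A) (he : e ∉ I) : infl P e A = 0 := by
  have : setc e true A = setc e false A := by
    ext ω
    refine h.iff fun i hi => ?_
    have : i ≠ e := fun h => he (h ▸ hi)
    rw [Function.update_of_ne this, Function.update_of_ne this]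
  unfold infl
  rw [this, sub_self]

lemma infl_loop (k n : ℕ) (P : EdgeIdx → ℝ) {e : EdgeIdx} (he : ¬ IsEdge k e) :
    infl P e (slabA k n) = 0 := by
  have : setc e true (slabA k n) = setc e false (slabA k n) := by
    apply subset_antisymm
    · rintro ω ⟨y, hy, hc⟩
      refine ⟨y, hy, ?_⟩
      clear hy
      induction hc with
      | refl => exact .refl _
      | tail _ h ih =>
        obtain ⟨-, -, d, h1, rfl, rfl⟩ := h
        by_cases hd : d.1 = e
        · have : (slabG k).hd d = (slabG k).tl d := by
            rcases Gr.tl_hd (G := slabG k) d with ⟨a, b⟩ | ⟨a, b⟩ <;>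
              rw [a, b, hd, slab_t' k he, slab_s]
          rw [this]; exact ih
        · refine ih.tail trivial trivial ⟨d, ?_, rfl, rfl⟩
          rw [Function.update_of_ne hd] at h1 ⊢
          exact h1
    · exact setc_mono e (slabA_upper k n)
  unfold infl
  rw [this, sub_self]

/-- Edges touching one of four vertices. -/
def nbrE (v : Vtx) : Finset EdgeIdx :=
  Finset.univ.image (fun i : Fin 3 => (v, i)) ∪ Finset.univ.image (fun i : Fin 3 => (v - dvec i, i))

lemma nbrE_card (v : Vtx) : (nbrE v).card ≤ 6 := by
  refine (Finset.card_union_le _ _).trans ?_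
  have h1 := Finset.card_image_le (s := Finset.univ) (f := fun i : Fin 3 => ((v, i) : EdgeIdx))
  have h2 := Finset.card_image_le (s := Finset.univ) (f := fun i : Fin 3 => ((v - dvec i, i) : EdgeIdx))
  simp at h1 h2
  omega

lemma nbrE_spec (k : ℕ) {v : Vtx} {e : EdgeIdx} (h : (slabG k).s e = v ∨ (slabG k).t e = v) :
    e ∈ nbrE v := by
  have h' : e.1 = v ∨ e.1 + dvec e.2 = v := by
    rcases h with h | h
    · exact Or.inl h
    · rcases slab_t_or k e with h' | h' <;> rw [h'] at h
      · exact Or.inr h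
      · exact Or.inl h
  obtain ⟨w, i⟩ := e
  simp only [nbrE, Finset.mem_union, Finset.mem_image, Finset.mem_univ, true_and]
  rcases h' with rfl | rfl
  · exact Or.inl ⟨i, rfl⟩
  · exact Or.inr ⟨i, by simp⟩

/-- Comparison of influences in a square of the slab. -/
lemma slab_square (k n : ℕ) {p q κ : ℝ} (hκ : 0 < κ) (hκ2 : κ ≤ 1)
    (hpq : (κ ≤ p ∧ p ≤ 1 - κ) ∧ (κ ≤ q ∧ q ≤ 1 - κ))
    {v w v' w' : Vtx} {e f g h : EdgeIdx}
    (he : (slabG k).Ends e v w) (hf : (slabG k).Ends f v v') (hg : (slabG k).Ends g w w')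
    (hh : (slabG k).Ends h v' w')
    (d2 : v ≠ v') (d3 : v ≠ w') (d4 : w ≠ v') (d5 : w ≠ w') :
    infl (sp p q) e (slabA k n) ≤ (2 / κ) ^ 24 *
      (infl (sp p q) f (slabA k n) + infl (sp p q) g (slabA k n)) := by
  set W := nbrE v ∪ nbrE w ∪ nbrE v' ∪ nbrE w' with hW
  have hWc : W.card ≤ 24 := by
    have h1 := Finset.card_union_le (nbrE v ∪ nbrE w ∪ nbrE v') (nbrE w')
    have h2 := Finset.card_union_le (nbrE v ∪ nbrE w) (nbrE v')
    have h3 := Finset.card_union_le (nbrE v) (nbrE w)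
    have := nbrE_card v
    have := nbrE_card w
    have := nbrE_card v'
    have := nbrE_card w'
    rw [← hW] at h1
    omega
  refine (Gr.ag_infl (G := slabG k) (o := 0) (T := slabT k n) W he hf hg hh d2 d3 d4 d5 ?_ (sp p q) κ hκ
    fun e _ => sp_bounds hpq e).trans ?_
  · intro i hi
    have hm : ∀ u, ((slabG k).s i = u ∨ (slabG k).t i = u) → nbrE u ⊆ W → i ∈ W :=
      fun u h hs => hs (nbrE_spec k h)
    have i1 : nbrE v ⊆ W := fun _ h => by simp [hW, h]
    have i2 : nbrE w ⊆ W := fun _ h => by simp [hW, h]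
    have i3 : nbrE v' ⊆ W := fun _ h => by simp [hW, h]
    have i4 : nbrE w' ⊆ W := fun _ h => by simp [hW, h]
    rcases hi with h | h | h | h | h | h | h | h
    · exact hm _ (Or.inl h) i1
    · exact hm _ (Or.inl h) i2
    · exact hm _ (Or.inl h) i3
    · exact hm _ (Or.inl h) i4
    · exact hm _ (Or.inr h) i1
    · exact hm _ (Or.inr h) i2
    · exact hm _ (Or.inr h) i3
    · exact hm _ (Or.inr h) i4
  · refine mul_le_mul_of_nonneg_right ?_ (add_nonneg (Gr.infl_nonneg _ _ (slabA_upper k n))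
      (Gr.infl_nonneg _ _ (slabA_upper k n)))
    refine pow_le_pow_right₀ ?_ hWc
    rw [le_div_iff₀ hκ]; linarith

lemma sum_inj_le {α β : Type*} [DecidableEq β] (S : Finset α) (F : Finset β) (φ : α → β) (J : β → ℝ)
    (hJ : ∀ b, 0 ≤ J b) (h0 : ∀ b, b ∉ F → J b = 0) (hφ : InjOn φ S) :
    ∑ a ∈ S, J (φ a) ≤ ∑ b ∈ F, J b := by
  rw [← Finset.sum_image (f := J) hφ]
  calc ∑ b ∈ S.image φ, J b = ∑ b ∈ (S.image φ).filter (· ∈ F), J b := by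
        rw [Finset.sum_filter]
        refine Finset.sum_congr rfl fun b _ => ?_
        split_ifs with h
        · rfl
        · exact h0 b h
    _ ≤ ∑ b ∈ F, J b := Finset.sum_le_sum_of_subset_of_nonneg
        (fun b hb => (Finset.mem_filter.1 hb).2) fun b _ _ => hJ b

/-- Total influence of horizontal edges. -/
noncomputable def dHor (k n : ℕ) (p q : ℝ) : ℝ :=
  ∑ e ∈ slabF k n, if e.2 = 2 then 0 else infl (sp p q) e (slabA k n)

/-- Total influence of vertical edges. -/
noncomputable def dVer (k n : ℕ) (p q : ℝ) : ℝ :=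
  ∑ e ∈ slabF k n, if e.2 = 2 then infl (sp p q) e (slabA k n) else 0

lemma dVer_le (k n : ℕ) {p q κ : ℝ} (hκ : 0 < κ) (hκ2 : κ ≤ 1)
    (hpq : (κ ≤ p ∧ p ≤ 1 - κ) ∧ (κ ≤ q ∧ q ≤ 1 - κ)) :
    dVer k n p q ≤ 8 * (2 / κ) ^ 24 * dHor k n p q := by
  have hI : ∀ e, 0 ≤ infl (sp p q) e (slabA k n) := fun e => Gr.infl_nonneg _ _ (slabA_upper k n)
  set J : EdgeIdx → ℝ := fun e => if e.2 = 2 then 0 else infl (sp p q) e (slabA k n) with hJ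
  have hJ0 : ∀ e, 0 ≤ J e := fun e => by simp only [hJ]; split_ifs; exacts [le_rfl, hI e]
  have hJF : ∀ e, e ∉ slabF k n → J e = 0 := fun e he => by
    simp only [hJ]; split_ifs
    · rfl
    · exact infl_eq_zero_of_det _ (slabA_det k n) he
  have hc : 0 ≤ (2 / κ) ^ 24 := by positivity
  set S := (slabF k n).filter (fun e => e.2 = 2) with hS
  have h1 : ∀ e ∈ S, infl (sp p q) e (slabA k n) ≤ (2 / κ) ^ 24 *
      (J (e.1, 0) + J (e.1 + dvec 2, 0)) := by
    intro e he
    obtain ⟨v, i⟩ := e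
    obtain rfl : i = 2 := (Finset.mem_filter.1 he).2
    by_cases hv : IsEdge k (v, 2)
    · have e0 : IsEdge k (v, 0) := by
        obtain ⟨x, y, z⟩ := v
        simp [IsEdge, InSlab, dvec] at hv ⊢; omega
      have e1 : IsEdge k (v + dvec 2, 0) := by
        obtain ⟨x, y, z⟩ := v
        simp [IsEdge, InSlab, dvec] at hv ⊢; omega
      have e2 : IsEdge k (v + dvec 0, 2) := by
        obtain ⟨x, y, z⟩ := v
        simp [IsEdge, InSlab, dvec] at hv ⊢; omega
      have := slab_square k n hκ hκ2 hpq (slab_ends k hv rfl rfl) (slab_ends k e0 rfl rfl)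
        (slab_ends k e1 rfl rfl) (slab_ends k e2 rfl (by simp; abel))
        (by simp [dvec]) (by simp [dvec, Prod.ext_iff]) (by simp [dvec]) (by simp [dvec])
      simpa [hJ] using this
    · rw [infl_loop k n _ hv]
      exact mul_nonneg hc (add_nonneg (hJ0 _) (hJ0 _))
  have h2 : ∑ e ∈ S, J (e.1, 0) ≤ dHor k n p q := by
    refine sum_inj_le S _ (fun e : EdgeIdx => (e.1, 0)) J hJ0 hJF ?_
    intro a ha b hb hab
    have ha := (Finset.mem_filter.1 ha).2
    have hb := (Finset.mem_filter.1 hb).2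
    exact Prod.ext (Prod.ext_iff.1 hab).1 (ha.trans hb.symm)
  have h3 : ∑ e ∈ S, J (e.1 + dvec 2, 0) ≤ dHor k n p q := by
    refine sum_inj_le S _ (fun e : EdgeIdx => (e.1 + dvec 2, 0)) J hJ0 hJF ?_
    intro a ha b hb hab
    have ha := (Finset.mem_filter.1 ha).2
    have hb := (Finset.mem_filter.1 hb).2
    exact Prod.ext (add_right_cancel (Prod.ext_iff.1 hab).1) (ha.trans hb.symm)
  have h4 : dVer k n p q = ∑ e ∈ S, infl (sp p q) e (slabA k n) := by
    rw [hS, Finset.sum_filter]; rfl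
  have h5 : 0 ≤ dHor k n p q := Finset.sum_nonneg fun e _ => hJ0 e
  rw [h4]
  refine (Finset.sum_le_sum h1).trans ?_
  rw [← Finset.mul_sum, Finset.sum_add_distrib]
  nlinarith [mul_nonneg hc h5]

lemma dHor_le (k n : ℕ) (hk : 1 ≤ k) {p q κ : ℝ} (hκ : 0 < κ) (hκ2 : κ ≤ 1)
    (hpq : (κ ≤ p ∧ p ≤ 1 - κ) ∧ (κ ≤ q ∧ q ≤ 1 - κ)) :
    dHor k n p q ≤ 8 * (2 / κ) ^ 24 * dVer k n p q := by
  have hI : ∀ e, 0 ≤ infl (sp p q) e (slabA k n) := fun e => Gr.infl_nonneg _ _ (slabA_upper k n)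
  set J : EdgeIdx → ℝ := fun e => if e.2 = 2 then infl (sp p q) e (slabA k n) else 0 with hJ
  have hJ0 : ∀ e, 0 ≤ J e := fun e => by simp only [hJ]; split_ifs; exacts [hI e, le_rfl]
  have hJF : ∀ e, e ∉ slabF k n → J e = 0 := fun e he => by
    simp only [hJ]; split_ifs
    · exact infl_eq_zero_of_det _ (slabA_det k n) he
    · rfl
  have hc : 0 ≤ (2 / κ) ^ 24 := by positivity
  have hdV : 0 ≤ dVer k n p q := Finset.sum_nonneg fun e _ => hJ0 e
  have main : ∀ i : Fin 3, i ≠ 2 → ∑ e ∈ (slabF k n).filter (fun e => e.2 = i),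
      infl (sp p q) e (slabA k n) ≤ 4 * (2 / κ) ^ 24 * dVer k n p q := by
    intro i hi
    set S := (slabF k n).filter (fun e => e.2 = i) with hS
    have h1 : ∀ e ∈ S, infl (sp p q) e (slabA k n) ≤ (2 / κ) ^ 24 *
        (J (e.1, 2) + J (e.1 + dvec i, 2) + J (e.1 - dvec 2, 2) + J (e.1 - dvec 2 + dvec i, 2)) := by
      intro e he
      obtain ⟨v, j⟩ := e
      obtain rfl : j = i := (Finset.mem_filter.1 he).2
      have hz1 : (dvec 2).2.2 = 1 := rfl
      have hz0 : (dvec j).2.2 = 0 := by fin_cases j <;> simp [dvec] at hi ⊢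
      have hne : ∀ a b : Vtx, a.2.2 ≠ b.2.2 → a ≠ b := fun a b h h' => h (by rw [h'])
      by_cases hv : IsEdge k (v, j)
      · by_cases hz : v.2.2 < k
        · have e0 : IsEdge k (v, 2) := by
            obtain ⟨x, y, z⟩ := v
            fin_cases j <;> simp [IsEdge, InSlab, dvec] at hv hz ⊢ <;> omega
          have e1 : IsEdge k (v + dvec j, 2) := by
            obtain ⟨x, y, z⟩ := v
            fin_cases j <;> simp [IsEdge, InSlab, dvec] at hv hz hi ⊢ <;> omega
          have e2 : IsEdge k (v + dvec 2, j) := by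
            obtain ⟨x, y, z⟩ := v
            fin_cases j <;> simp [IsEdge, InSlab, dvec] at hv hz hi ⊢ <;> omega
          have := slab_square k n hκ hκ2 hpq (slab_ends k hv rfl rfl) (slab_ends k e0 rfl rfl)
            (slab_ends k e1 rfl rfl) (slab_ends k e2 rfl (by simp; abel))
            (hne _ _ (by simp [hz1])) (hne _ _ (by simp [hz0, hz1]))
            (hne _ _ (by simp [hz0, hz1])) (hne _ _ (by simp [hz0, hz1]))
          refine this.trans (mul_le_mul_of_nonneg_left ?_ hc)
          have a1 := hJ0 (v - dvec 2, 2)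
          have a2 := hJ0 (v - dvec 2 + dvec j, 2)
          simp only [hJ, if_true] at a1 a2 ⊢
          linarith
        · have e0 : IsEdge k (v - dvec 2, 2) := by
            obtain ⟨x, y, z⟩ := v
            fin_cases j <;> simp [IsEdge, InSlab, dvec] at hv hz ⊢ <;> omega
          have e1 : IsEdge k (v - dvec 2 + dvec j, 2) := by
            obtain ⟨x, y, z⟩ := v
            fin_cases j <;> simp [IsEdge, InSlab, dvec] at hv hz hi ⊢ <;> omega
          have e2 : IsEdge k (v - dvec 2, j) := by
            obtain ⟨x, y, z⟩ := v
            fin_cases j <;> simp [IsEdge, InSlab, dvec] at hv hz hi ⊢ <;> omega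
          have := slab_square k n hκ hκ2 hpq (slab_ends k hv rfl rfl)
            (slab_ends k e0 rfl (b := v) (by simp)).symm
            (slab_ends k e1 rfl (b := v + dvec j) (by simp; abel)).symm (slab_ends k e2 rfl rfl)
            (hne _ _ (by simp [hz1]; omega)) (hne _ _ (by simp [hz0, hz1]; omega))
            (hne _ _ (by simp [hz0, hz1]; omega)) (hne _ _ (by simp [hz0, hz1]; omega))
          refine this.trans (mul_le_mul_of_nonneg_left ?_ hc)
          have a1 := hJ0 (v, 2)
          have a2 := hJ0 (v + dvec j, 2)
          simp only [hJ, if_true] at a1 a2 ⊢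
          linarith
      · rw [infl_loop k n _ hv]
        exact mul_nonneg hc (add_nonneg (add_nonneg (add_nonneg (hJ0 _) (hJ0 _)) (hJ0 _)) (hJ0 _))
    have h2 : ∀ w : Vtx, ∑ e ∈ S, J (e.1 + w, 2) ≤ dVer k n p q := by
      intro w
      refine sum_inj_le S _ (fun e : EdgeIdx => (e.1 + w, 2)) J hJ0 hJF ?_
      intro a ha b hb hab
      have ha := (Finset.mem_filter.1 ha).2
      have hb := (Finset.mem_filter.1 hb).2
      exact Prod.ext (add_right_cancel (Prod.ext_iff.1 hab).1) (ha.trans hb.symm)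
    refine (Finset.sum_le_sum h1).trans ?_
    rw [← Finset.mul_sum, Finset.sum_add_distrib, Finset.sum_add_distrib, Finset.sum_add_distrib]
    have b1 := h2 0
    have b2 := h2 (dvec i)
    have b3 := h2 (-dvec 2)
    have b4 := h2 (-dvec 2 + dvec i)
    simp only [add_zero, ← sub_eq_add_neg, ← add_assoc] at b1 b2 b3 b4
    rw [mul_comm 4, mul_assoc]
    exact mul_le_mul_of_nonneg_left (by linarith) hc
  have h4 : dHor k n p q = ∑ e ∈ (slabF k n).filter (fun e => e.2 = 0), infl (sp p q) e (slabA k n) +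
      ∑ e ∈ (slabF k n).filter (fun e => e.2 = 1), infl (sp p q) e (slabA k n) := by
    rw [Finset.sum_filter, Finset.sum_filter, ← Finset.sum_add_distrib]
    refine Finset.sum_congr rfl fun e _ => ?_
    obtain ⟨v, i⟩ := e
    fin_cases i <;> simp
  have m0 := main 0 (by decide)
  have m1 := main 1 (by decide)
  rw [h4]; linarith

lemma th_line (k n : ℕ) {p q κ α β : ℝ} (hκ : 0 < κ)
    (h0 : (κ ≤ p ∧ p ≤ 1 - κ) ∧ (κ ≤ q ∧ q ≤ 1 - κ))
    (h1 : (κ ≤ p + α ∧ p + α ≤ 1 - κ) ∧ (κ ≤ q + β ∧ q + β ≤ 1 - κ))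
    (hd : ∀ p' q', (κ ≤ p' ∧ p' ≤ 1 - κ) ∧ (κ ≤ q' ∧ q' ≤ 1 - κ) →
      0 ≤ α * dHor k n p' q' + β * dVer k n p' q') :
    th k n p q ≤ th k n (p + α) (q + β) := by
  set f : ℝ → ℝ := fun s => th k n (p + s * α) (q + s * β) with hf
  have hin : ∀ s ∈ Icc (0 : ℝ) 1, (κ ≤ p + s * α ∧ p + s * α ≤ 1 - κ) ∧
      (κ ≤ q + s * β ∧ q + s * β ≤ 1 - κ) := by
    rintro s ⟨s0, s1⟩
    refine ⟨⟨?_, ?_⟩, ?_, ?_⟩ <;> nlinarith [h0.1.1, h0.1.2, h0.2.1, h0.2.2, h1.1.1, h1.1.2, h1.2.1, h1.2.2]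
  have hder : ∀ x ∈ Icc (0 : ℝ) 1, HasDerivAt f
      (α * dHor k n (p + x * α) (q + x * β) + β * dVer k n (p + x * α) (q + x * β)) x := by
    intro x hx
    have key := russo (slabA_det k n) (fun s => sp (p + s * α) (q + s * β))
      (fun e => if e.2 = 2 then β else α) x (by
        intro e
        unfold sp
        split_ifs
        · simpa using ((hasDerivAt_id x).mul_const β).const_add q
        · simpa using ((hasDerivAt_id x).mul_const α).const_add p) (by
        have c1 : Continuous fun s : ℝ => p + s * α := by fun_prop
        have c2 : Continuous fun s : ℝ => q + s * β := by fun_prop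
        have hx' := hin x hx
        have g1 := c1.continuousAt.eventually (Ioo_mem_nhds (show 0 < p + x * α by linarith)
          (show p + x * α < 1 by linarith))
        have g2 := c2.continuousAt.eventually (Ioo_mem_nhds (show 0 < q + x * β by linarith)
          (show q + x * β < 1 by linarith))
        filter_upwards [g1, g2] with s a1 a2 e
        exact sp_bounds ⟨⟨a1.1.le, a1.2.le⟩, ⟨a2.1.le, a2.2.le⟩⟩ e)
    refine key.congr_deriv ?_
    unfold dHor dVer
    rw [Finset.mul_sum, Finset.mul_sum, ← Finset.sum_add_distrib]
    refine Finset.sum_congr rfl fun e _ => ?_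
    split_ifs <;> ring
  have hmono : MonotoneOn f (Icc 0 1) := by
    refine monotoneOn_of_deriv_nonneg (convex_Icc 0 1)
      (fun x hx => (hder x hx).continuousAt.continuousWithinAt) ?_ ?_
    · intro x hx
      rw [interior_Icc] at hx
      exact (hder x (Ioo_subset_Icc_self hx)).differentiableAt.differentiableWithinAt
    · intro x hx
      rw [interior_Icc] at hx
      rw [(hder x (Ioo_subset_Icc_self hx)).deriv]
      exact hd _ _ (hin x (Ioo_subset_Icc_self hx))
  have := hmono (left_mem_Icc.2 zero_le_one) (right_mem_Icc.2 zero_le_one) zero_le_one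
  simpa [hf] using this

/-- Trading `p` for `q`. -/
lemma th_trade_q (k n : ℕ) (hk : 1 ≤ k) {p q κ t : ℝ} (hκ : 0 < κ) (hκ1 : κ ≤ 1) (ht : 0 ≤ t)
    (h0 : (κ ≤ p ∧ p ≤ 1 - κ) ∧ (κ ≤ q ∧ q ≤ 1 - κ))
    (h1 : κ ≤ p - t) (h2 : q + 8 * (2 / κ) ^ 24 * t ≤ 1 - κ) :
    th k n p q ≤ th k n (p - t) (q + 8 * (2 / κ) ^ 24 * t) := by
  have hc : 0 ≤ 8 * (2 / κ) ^ 24 * t := by positivity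
  have := th_line k n (α := -t) (β := 8 * (2 / κ) ^ 24 * t) hκ h0
    ⟨⟨by linarith, by linarith [h0.1.2]⟩, by linarith [h0.2.1], h2⟩ (by
      intro p' q' h
      have := dHor_le k n hk hκ hκ1 h
      nlinarith)
  simpa [sub_eq_add_neg] using this

/-- Trading `q` for `p`. -/
lemma th_trade_p (k n : ℕ) {p q κ t : ℝ} (hκ : 0 < κ) (hκ1 : κ ≤ 1) (ht : 0 ≤ t)
    (h0 : (κ ≤ p ∧ p ≤ 1 - κ) ∧ (κ ≤ q ∧ q ≤ 1 - κ))
    (h1 : κ ≤ q - t) (h2 : p + 8 * (2 / κ) ^ 24 * t ≤ 1 - κ) :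
    th k n p q ≤ th k n (p + 8 * (2 / κ) ^ 24 * t) (q - t) := by
  have hc : 0 ≤ 8 * (2 / κ) ^ 24 * t := by positivity
  have := th_line k n (β := -t) (α := 8 * (2 / κ) ^ 24 * t) hκ h0
    ⟨⟨by linarith [h0.1.1], h2⟩, by linarith [h0.2.1], by linarith [h0.2.2]⟩ (by
      intro p' q' h
      have := dVer_le k n hκ hκ1 h
      nlinarith)
  simpa [sub_eq_add_neg] using this

lemma slab_adj_iff (k : ℕ) (ω : Config) (x y : Vtx) (hxy : x ≠ y) :
    (slabG k).Adj ω x y ↔ OpenAdj k ω x y := by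
  rw [Gr.adj_iff]
  constructor
  · rintro ⟨⟨v, i⟩, h, h'⟩
    by_cases he : IsEdge k (v, i)
    · rw [slab_t k he, slab_s] at h'
      rcases h' with ⟨rfl, rfl⟩ | ⟨rfl, rfl⟩
      · exact ⟨i, Or.inl ⟨rfl, he, h⟩⟩
      · exact ⟨i, Or.inr ⟨rfl, he, h⟩⟩
    · rw [slab_t' k he, slab_s] at h'
      exfalso
      rcases h' with ⟨rfl, rfl⟩ | ⟨rfl, rfl⟩ <;> exact hxy rfl
  · rintro ⟨i, ⟨rfl, he, h⟩ | ⟨rfl, he, h⟩⟩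
    · exact ⟨_, h, Or.inl ⟨rfl, slab_t k he⟩⟩
    · exact ⟨_, h, Or.inr ⟨slab_t k he, rfl⟩⟩

lemma openAdj_inSlab {k : ℕ} {ω : Config} {x y : Vtx} (h : OpenAdj k ω x y) : InSlab k y := by
  rcases h with ⟨i, ⟨rfl, he, -⟩ | ⟨rfl, he, -⟩⟩
  · exact he.2
  · exact he.1

lemma mem_cluster_iff (k : ℕ) (ω : Config) (x y : Vtx) :
    y ∈ cluster k ω x ↔ (slabG k).Conn ω univ x y := by
  constructor
  · intro h
    induction h with
    | refl => exact .refl _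
    | @tail b c _ h ih =>
      by_cases hbc : b = c
      · rw [← hbc]; exact ih
      · exact ih.tail trivial trivial ((slab_adj_iff k ω _ _ hbc).2 h)
  · intro h
    induction h with
    | refl => exact ReflTransGen.refl
    | @tail b c _ h ih =>
      by_cases hbc : b = c
      · rw [← hbc]; exact ih
      · exact ReflTransGen.tail ih ((slab_adj_iff k ω _ _ hbc).1 h.2.2)

lemma cluster_inSlab {k : ℕ} {ω : Config} {y : Vtx} (h : y ∈ cluster k ω 0) : InSlab k y := by
  rcases ReflTransGen.cases_tail h with h | ⟨z, -, h⟩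
  · rw [h]; exact ⟨le_rfl, by simp⟩
  · exact openAdj_inSlab h

lemma slabA_antitone (k : ℕ) : Antitone (slabA k) := by
  rintro m n hmn ω ⟨y, hy, hc⟩
  refine ⟨y, ?_, hc⟩
  intro h
  apply hy
  have : (m : ℤ) ≤ n := by exact_mod_cast hmn
  exact ⟨h.1, lt_of_lt_of_le h.2.1 this, lt_of_lt_of_le h.2.2 this⟩

lemma cluster_infinite_iff (k : ℕ) (ω : Config) :
    (cluster k ω 0).Infinite ↔ ∀ n, ω ∈ slabA k n := by
  constructor
  · intro h n
    by_contra hn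
    apply h
    have : cluster k ω 0 ⊆ Icc (-(n : ℤ)) n ×ˢ Icc (-(n : ℤ)) n ×ˢ Icc (0 : ℤ) k := by
      intro y hy
      have h1 : y ∉ slabT k n := fun h => hn ⟨y, h, (mem_cluster_iff k ω 0 y).1 hy⟩
      simp only [slabT, mem_ofPred_eq, not_not, abs_lt, InSlab] at h1
      simp only [mem_prod, mem_Icc]
      omega
    exact ((finite_Icc _ _).prod ((finite_Icc _ _).prod (finite_Icc _ _))).subset this
  · intro h hfin
    obtain ⟨n, hn⟩ : ∃ n : ℕ, ∀ y ∈ cluster k ω 0, |y.1| < n ∧ |y.2.1| < n := by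
      obtain ⟨M, hM⟩ := (hfin.image fun y : Vtx => max (|y.1|) (|y.2.1|)).bddAbove
      refine ⟨M.toNat + 1, fun y hy => ?_⟩
      have := hM (mem_image_of_mem _ hy)
      have h1 := le_max_left (|y.1|) (|y.2.1|)
      have h2 := le_max_right (|y.1|) (|y.2.1|)
      have this : max (|y.1|) (|y.2.1|) ≤ M := this
      have h3 : (0 : ℤ) ≤ |y.1| := abs_nonneg _
      push_cast
      omega
    obtain ⟨y, hy, hc⟩ := h n
    have hy' := (mem_cluster_iff k ω 0 y).2 hc
    exact hy ⟨cluster_inSlab hy', hn y hy'⟩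

lemma th_antitone (k : ℕ) (p q : ℝ) : Antitone fun n => th k n p q :=
  fun _ _ h => pr_mono _ (slabA_antitone k h)

lemma theta_eq (k : ℕ) (p q : ℝ) : theta k p q = bern (sp p q) (⋂ n, slabA k n) := by
  unfold theta slabMeasure
  rw [bernoulliProduct_eq]
  congr 1
  ext ω
  simp [cluster_infinite_iff]

lemma theta_zero_iff (k : ℕ) (p q : ℝ) :
    theta k p q = 0 ↔ ∀ ε > 0, ∃ n, th k n p q < ε := by
  have ht : Filter.Tendsto (fun n => bern (sp p q) (slabA k n)) Filter.atTop
      (nhds (theta k p q)) := by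
    rw [theta_eq]
    exact tendsto_measure_iInter_atTop (fun n => (slabA_meas k n).nullMeasurableSet)
      (slabA_antitone k) ⟨0, measure_ne_top _ _⟩
  have ht' : Filter.Tendsto (fun n => th k n p q) Filter.atTop (nhds (theta k p q).toReal) := by
    refine (ENNReal.tendsto_toReal ?_).comp ht
    rw [theta_eq]; exact measure_ne_top _ _
  have hfin : theta k p q ≠ ⊤ := by rw [theta_eq]; exact measure_ne_top _ _
  constructor
  · intro h ε hε
    rw [h] at ht'
    exact (ht'.eventually (gt_mem_nhds (by simpa using hε))).exists
  · intro h
    have : (theta k p q).toReal ≤ 0 := by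
      refine le_of_forall_pos_le_add fun ε hε => ?_
      obtain ⟨n, hn⟩ := h ε hε
      rw [zero_add]
      refine le_of_tendsto ht' ?_
      filter_upwards [Filter.eventually_ge_atTop n] with m hm
      exact (th_antitone k p q hm).trans hn.le
    have h2 := ENNReal.toReal_nonneg (a := theta k p q)
    have h3 : (theta k p q).toReal = 0 := le_antisymm this h2
    exact ((ENNReal.toReal_eq_zero_iff _).1 h3).resolve_right hfin

lemma theta_zero_of_le (k : ℕ) {p q p' q' : ℝ} (h : ∀ n, th k n p q ≤ th k n p' q')
    (h0 : theta k p' q' = 0) : theta k p q = 0 := by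
  rw [theta_zero_iff] at *
  intro ε hε
  obtain ⟨n, hn⟩ := h0 ε hε
  exact ⟨n, (h n).trans_lt hn⟩
end

section
open ProbabilityTheory Relation

/-! ### Graph homomorphisms -/

namespace Gr

lemma Conn.hom {V E V' E' : Type*} {G : Gr V E} {G' : Gr V' E'} (σ : V → V') (τ : E → E')
    (hτ : ∀ e, G'.Ends (τ e) (σ (G.s e)) (σ (G.t e))) {U : Set V} {U' : Set V'}
    (hU : ∀ x ∈ U, σ x ∈ U') {ω : E' → Bool} {x y : V}
    (h : G.Conn (fun e => ω (τ e)) U x y) : G'.Conn ω U' (σ x) (σ y) := by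
  induction h with
  | refl => exact .refl _
  | tail _ h ih =>
    obtain ⟨ha, hb, d, h1, rfl, rfl⟩ := h
    refine ih.tail (hU _ ha) (hU _ hb) ?_
    rcases tl_hd (G := G) d with ⟨a, b⟩ | ⟨a, b⟩ <;> rw [a, b]
    · exact (hτ d.1).adj h1
    · exact (hτ d.1).symm.adj h1

lemma pr_hit_hom {V E V' E' : Type*} [Countable E] [Countable V] {G : Gr V E} {G' : Gr V' E'}
    (σ : V → V') (τ : E → E')
    (hinj : Function.Injective τ)
    (hτ : ∀ e, G'.Ends (τ e) (σ (G.s e)) (σ (G.t e))) {U T : Set V} {U' T' : Set V'}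
    (hU : ∀ x ∈ U, σ x ∈ U') (hT : ∀ x ∈ T, σ x ∈ T') (x : V) (Q : E' → ℝ) :
    pr (fun e => Q (τ e)) {ω | G.Hit ω U x T} ≤ pr Q {ω | G'.Hit ω U' (σ x) T'} := by
  rw [pr_reindex Q τ hinj (measurable_hit _ _ _)]
  refine pr_mono _ ?_
  rintro ω ⟨y, hy, hc⟩
  exact ⟨σ y, hT y hy, hc.hom σ τ hτ hU⟩

end Gr

/-! ### The square lattice -/

/-- Edges of the square lattice: lower-left endpoint and direction (`true` is vertical). -/
abbrev E2 : Type := (ℤ × ℤ) × Bool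

/-- Unit vectors. -/
def dv : Bool → ℤ × ℤ
  | false => (1, 0)
  | true => (0, 1)

/-- The square lattice. -/
def plane : Gr (ℤ × ℤ) E2 where
  s e := e.1
  t e := e.1 + dv e.2

@[simp] lemma plane_s (e : E2) : plane.s e = e.1 := rfl
@[simp] lemma plane_t (e : E2) : plane.t e = e.1 + dv e.2 := rfl
@[simp] lemma dv_true : dv true = (0, 1) := rfl
@[simp] lemma dv_false : dv false = (1, 0) := rfl

/-- Complement of the open box of radius `n`. -/
def T2 (n : ℕ) : Set (ℤ × ℤ) := {v | ¬ (|v.1| < n ∧ |v.2| < n)}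

/-- The open box of radius `n`. -/
noncomputable def R2 (n : ℕ) : Finset (ℤ × ℤ) :=
  (Finset.Icc (-(n : ℤ) + 1) (n - 1)) ×ˢ (Finset.Icc (-(n : ℤ) + 1) (n - 1))

/-- Edges near the box of radius `n`. -/
noncomputable def F2 (n : ℕ) : Finset E2 :=
  (Finset.Icc (-(n : ℤ)) n ×ˢ Finset.Icc (-(n : ℤ)) n) ×ˢ Finset.univ

lemma R2_iff (n : ℕ) (x : ℤ × ℤ) : x ∈ R2 n ↔ x ∉ T2 n := by
  obtain ⟨x, y⟩ := x
  simp only [R2, T2, Finset.mem_product, Finset.mem_Icc, mem_ofPred_eq, not_not, abs_lt]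
  omega

lemma F2_spec (n : ℕ) (e : E2) (h : plane.s e ∉ T2 n ∨ plane.t e ∉ T2 n) : e ∈ F2 n := by
  obtain ⟨⟨x, y⟩, b⟩ := e
  rw [← R2_iff, ← R2_iff] at h
  simp only [R2, F2, Finset.mem_product, Finset.mem_Icc, Finset.mem_univ, and_true, plane_s, plane_t] at *
  cases b <;> simp at h <;> omega

/-- Probability of an arm of length `n` in the plane. -/
noncomputable def tp (n : ℕ) (p : ℝ) : ℝ := pr (fun _ : E2 => p) {ω | plane.Hit ω univ 0 (T2 n)}

/-- Shift of an edge. -/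
def shE (v : ℤ × ℤ) (e : E2) : E2 := (e.1 + v, e.2)

lemma shE_inj (v : ℤ × ℤ) : Function.Injective (shE v) := by
  intro a b h
  simp only [shE, Prod.mk.injEq, add_left_inj] at h
  exact Prod.ext h.1 h.2

lemma shE_ends (v : ℤ × ℤ) (e : E2) :
    plane.Ends (shE v e) (plane.s e + v) (plane.t e + v) := by
  left; simp [shE]; abel

lemma tp_shift (v : ℤ × ℤ) (n : ℕ) (p : ℝ) (T : Set (ℤ × ℤ))
    (h : ∀ x ∈ T, x - v ∈ T2 n) :
    pr (fun _ : E2 => p) {ω | plane.Hit ω univ v T} ≤ tp n p := by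
  have := Gr.pr_hit_hom (G := plane) (G' := plane) (fun x => x + -v) (shE (-v)) (shE_inj _)
    (shE_ends (-v)) (U := univ) (U' := univ) (T := T) (T' := T2 n) (fun _ _ => trivial)
    (fun x hx => by simpa [sub_eq_add_neg] using h x hx) v (fun _ => p)
  simpa [tp] using this

/-! ### Duality -/

/-- The primal edge crossed by a dual edge. -/
def crossE : E2 → E2
  | ((x, y), true) => ((x, y + 1), false)
  | ((x, y), false) => ((x + 1, y), true)

lemma crossE_inj : Function.Injective crossE := by
  rintro ⟨⟨x, y⟩, b⟩ ⟨⟨x', y'⟩, b'⟩ h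
  cases b <;> cases b' <;> simp [crossE] at h ⊢ <;> tauto

/-- The dual configuration. -/
def dualC (ω : E2 → Bool) : E2 → Bool := fun e => !ω (crossE e)

lemma pr_dual {p : ℝ} (h0 : 0 ≤ p) (h1 : p ≤ 1) {A : Set (E2 → Bool)} (hA : MeasurableSet A) :
    pr (fun _ => 1 - p) A = pr (fun _ => p) {ω | dualC ω ∈ A} := by
  have := map_blocks (fun _ : E2 => p) (fun e ω => dualC ω e) (fun e => {crossE e})
    (fun e => by simpa [dualC] using measurableSet_coord (crossE e) false)
    (fun e => by simpa [dualC] using det_coord (crossE e) false)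
    (fun e e' h => by simpa using fun h' => h (crossE_inj h'))
    (fun _ => 1 - p) (fun _ => by linarith) (fun _ => by linarith)
    (fun e => by simpa [dualC] using pr_coord_false (P := fun _ : E2 => p) (e := crossE e) h0 h1)
  refine pr_map ?_ this hA
  refine measurable_pi_lambda _ fun e => ?_
  simp only [dualC]
  exact (measurable_of_countable (fun b : Bool => !b)).comp (measurable_pi_apply (crossE e))

lemma abel_sum (D U : ℕ → ℤ) (l : ℕ) :
    ∑ y ∈ Finset.range (l + 1), D y * (U (y + 1) - U y) +
      ∑ y ∈ Finset.range l, (D (y + 1) - D y) * U (y + 1) = D l * U (l + 1) - D 0 * U 0 := by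
  induction l with
  | zero => simp; ring
  | succ l ih =>
    rw [Finset.sum_range_succ (fun y => D y * (U (y + 1) - U y)) (l + 1),
      Finset.sum_range_succ (fun y => (D (y + 1) - D y) * U (y + 1)) l]
    linarith

lemma stokes (S U : ℕ → ℕ → ℤ) (m l : ℕ) (hS0 : ∀ y ≤ l, S 0 y = 1) (hSm : ∀ y ≤ l, S (m + 1) y = 0)
    (hU0 : ∀ x ≤ m, U x 0 = 1) (hUl : ∀ x ≤ m, U x (l + 1) = 0)
    (hh : ∀ x ≤ m, ∀ y ≤ l, (S (x + 1) y - S x y) * (U x (y + 1) - U x y) = 0)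
    (hv : ∀ x < m, ∀ y < l, (S (x + 1) (y + 1) - S (x + 1) y) * (U (x + 1) (y + 1) - U x (y + 1)) = 0) :
    False := by
  have h1 : ∀ x ≤ m, ∑ y ∈ Finset.range l,
      ((S (x + 1) (y + 1) - S x (y + 1)) - (S (x + 1) y - S x y)) * U x (y + 1) =
      - (S (x + 1) 0 - S x 0) := by
    intro x hx
    have := abel_sum (fun y => S (x + 1) y - S x y) (U x) l
    rw [Finset.sum_eq_zero (fun y hy => hh x hx y (by simp at hy; omega)), hU0 x hx, hUl x hx] at this
    simp only [zero_add, mul_zero, mul_one, zero_sub] at this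
    exact this
  have h2 : ∀ y < l, ∑ x ∈ Finset.range (m + 1),
      ((S (x + 1) (y + 1) - S x (y + 1)) - (S (x + 1) y - S x y)) * U x (y + 1) = 0 := by
    intro y hy
    have key : ∀ m', m' ≤ m → ∑ x ∈ Finset.range (m' + 1),
      ((S (x + 1) (y + 1) - S x (y + 1)) - (S (x + 1) y - S x y)) * U x (y + 1) =
        (S (m' + 1) (y + 1) - S (m' + 1) y) * U m' (y + 1) := by
      intro m'
      induction m' with
      | zero =>
        intro _
        have a := hS0 y hy.le
        have b := hS0 (y + 1) hy
        rw [Finset.sum_range_one, a, b]; ring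
      | succ m' ih =>
        intro hm
        rw [Finset.sum_range_succ, ih (by omega)]
        have := hv m' (by omega) y hy
        linarith
    rw [key m le_rfl, hSm y hy.le, hSm (y + 1) hy]; ring
  have h3 : ∑ x ∈ Finset.range (m + 1), - (S (x + 1) 0 - S x 0) = 0 := by
    rw [← Finset.sum_congr rfl fun x hx => h1 x (by simp at hx; omega), Finset.sum_comm]
    exact Finset.sum_eq_zero fun y hy => h2 y (by simpa using hy)
  rw [Finset.sum_neg_distrib, Finset.sum_range_sub (fun x => S x 0), hSm 0 (by omega), hS0 0 (by omega)] at h3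
  norm_num at h3

/-- Hard direction of planar duality. -/
lemma dual_or (ω : E2 → Bool) (m l : ℕ) :
    (∃ a b : ℕ, a ≤ l ∧ b ≤ l ∧ plane.Conn ω univ (0, (a : ℤ)) ((m : ℤ) + 1, (b : ℤ))) ∨
    (∃ a b : ℕ, a ≤ m ∧ b ≤ m ∧ plane.Conn (dualC ω) univ ((a : ℤ), -1) ((b : ℤ), (l : ℤ))) := by
  classical
  by_contra hcon
  push Not at hcon
  obtain ⟨hn1, hn2⟩ := hcon
  let S : ℕ → ℕ → ℤ := fun x y =>
    if ∃ a : ℕ, a ≤ l ∧ plane.Conn ω univ (0, (a : ℤ)) ((x : ℤ), (y : ℤ)) then 1 else 0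
  let U : ℕ → ℕ → ℤ := fun x y =>
    if ∃ a : ℕ, a ≤ m ∧ plane.Conn (dualC ω) univ ((a : ℤ), -1) ((x : ℤ), (y : ℤ) - 1) then 1 else 0
  have hSeq : ∀ x y x' y' : ℕ, plane.Conn ω univ ((x : ℤ), (y : ℤ)) ((x' : ℤ), (y' : ℤ)) →
      S x y = S x' y' := by
    intro x y x' y' h
    have : (∃ a : ℕ, a ≤ l ∧ plane.Conn ω univ (0, (a : ℤ)) ((x : ℤ), (y : ℤ))) ↔
        (∃ a : ℕ, a ≤ l ∧ plane.Conn ω univ (0, (a : ℤ)) ((x' : ℤ), (y' : ℤ))) :=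
      ⟨fun ⟨a, h1, h2⟩ => ⟨a, h1, h2.trans h⟩, fun ⟨a, h1, h2⟩ => ⟨a, h1, h2.trans h.symm⟩⟩
    simp only [S, this]
  have hUeq : ∀ x y x' y' : ℕ, plane.Conn (dualC ω) univ ((x : ℤ), (y : ℤ) - 1) ((x' : ℤ), (y' : ℤ) - 1) →
      U x y = U x' y' := by
    intro x y x' y' h
    have : (∃ a : ℕ, a ≤ m ∧ plane.Conn (dualC ω) univ ((a : ℤ), -1) ((x : ℤ), (y : ℤ) - 1)) ↔
        (∃ a : ℕ, a ≤ m ∧ plane.Conn (dualC ω) univ ((a : ℤ), -1) ((x' : ℤ), (y' : ℤ) - 1)) :=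
      ⟨fun ⟨a, h1, h2⟩ => ⟨a, h1, h2.trans h⟩, fun ⟨a, h1, h2⟩ => ⟨a, h1, h2.trans h.symm⟩⟩
    simp only [U, this]
  refine stokes S U m l ?_ ?_ ?_ ?_ ?_ ?_
  · intro y hy
    exact if_pos ⟨y, hy, by simpa using Gr.Conn.refl _⟩
  · intro y hy
    refine if_neg ?_
    rintro ⟨a, ha, hc⟩
    exact hn1 a y ha hy (by simpa using hc)
  · intro x hx
    exact if_pos ⟨x, hx, by simpa using Gr.Conn.refl _⟩
  · intro x hx
    refine if_neg ?_
    rintro ⟨a, ha, hc⟩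
    exact hn2 a x ha hx (by simpa using hc)
  · intro x _ y _
    by_cases ho : ω (((x : ℤ), (y : ℤ)), false) = true
    · rw [hSeq (x + 1) y x y, sub_self, zero_mul]
      have := Gr.adj_edge (G := plane) ho
      exact (Gr.Conn.single (U := univ) (mem_univ _) (mem_univ _) (by simpa using this)).symm
    · rw [hUeq x (y + 1) x y, sub_self, mul_zero]
      have h1 : dualC ω (((x : ℤ), (y : ℤ) - 1), true) = true := by
        simp [dualC, crossE, ho]
      have := Gr.adj_edge (G := plane) h1
      exact (Gr.Conn.single (U := univ) (mem_univ _) (mem_univ _) (by simpa using this)).symm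
  · intro x _ y _
    by_cases ho : ω (((x : ℤ) + 1, (y : ℤ)), true) = true
    · rw [hSeq (x + 1) (y + 1) (x + 1) y, sub_self, zero_mul]
      have := Gr.adj_edge (G := plane) ho
      exact (Gr.Conn.single (U := univ) (mem_univ _) (mem_univ _) (by simpa using this)).symm
    · rw [hUeq (x + 1) (y + 1) x (y + 1), sub_self, mul_zero]
      have h1 : dualC ω (((x : ℤ), (y : ℤ)), false) = true := by
        simp [dualC, crossE, ho]
      have := Gr.adj_edge (G := plane) h1
      exact (Gr.Conn.single (U := univ) (mem_univ _) (mem_univ _) (by simpa using this)).symm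

/-- The height function used in the easy direction of duality. -/
lemma height_fun (ω : E2 → Bool) (B : ℤ) {u v : ℤ × ℤ}
    (h : plane.Conn ω {x | -B ≤ x.2 ∧ x.2 ≤ B} u v) :
    ∃ g : ℤ → ℤ → ℤ, (∀ x y, y < -B → g x y = 0) ∧
      (∀ x y, B ≤ y → g x y = (if u.1 ≤ x then 1 else 0) - (if v.1 ≤ x then 1 else 0)) ∧
      (∀ x y, ω ((x, y + 1), false) = false → g x (y + 1) = g x y) ∧
      (∀ x y, ω ((x + 1, y), true) = false → g (x + 1) y - g x y =
        (if u.1 = x + 1 ∧ u.2 ≤ y then 1 else 0) - (if v.1 = x + 1 ∧ v.2 ≤ y then 1 else 0)) := by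
  induction h with
  | refl => exact ⟨fun _ _ => 0, by simp, by simp, by simp, by simp⟩
  | @tail v v' _ hs ih =>
    obtain ⟨hv, hv', hadj⟩ := hs
    obtain ⟨g, g1, g2, g3, g4⟩ := ih
    rw [Gr.adj_iff] at hadj
    obtain ⟨⟨⟨x0, y0⟩, b⟩, ho, hd⟩ := hadj
    cases b with
    | false =>
      rcases hd with ⟨rfl, rfl⟩ | ⟨rfl, rfl⟩
      · simp only [plane_s, plane_t, dv_false, Prod.mk_add_mk, add_zero, mem_ofPred_eq] at *
        refine ⟨fun x y => g x y + if x = x0 ∧ y0 ≤ y then 1 else 0, ?_, ?_, ?_, ?_⟩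
        · intro x y hy
          beta_reduce
          rw [g1 x y hy, if_neg (by omega), add_zero]
        · intro x y hy
          beta_reduce
          rw [g2 x y hy]
          split_ifs <;> omega
        · intro x y hc
          have hne : ¬ (x = x0 ∧ y + 1 = y0) := by
            rintro ⟨rfl, rfl⟩; rw [ho] at hc; cases hc
          simp only [g3 x y hc]
          split_ifs <;> omega
        · intro x y hc
          have := g4 x y hc
          beta_reduce
          split_ifs at this ⊢ <;> omega
      · simp only [plane_s, plane_t, dv_false, Prod.mk_add_mk, add_zero, mem_ofPred_eq] at *
        refine ⟨fun x y => g x y - if x = x0 ∧ y0 ≤ y then 1 else 0, ?_, ?_, ?_, ?_⟩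
        · intro x y hy
          beta_reduce
          rw [g1 x y hy, if_neg (by omega), sub_zero]
        · intro x y hy
          beta_reduce
          rw [g2 x y hy]
          split_ifs <;> omega
        · intro x y hc
          have hne : ¬ (x = x0 ∧ y + 1 = y0) := by
            rintro ⟨rfl, rfl⟩; rw [ho] at hc; cases hc
          simp only [g3 x y hc]
          split_ifs <;> omega
        · intro x y hc
          have := g4 x y hc
          beta_reduce
          split_ifs at this ⊢ <;> omega
    | true =>
      rcases hd with ⟨rfl, rfl⟩ | ⟨rfl, rfl⟩
      all_goals
        simp only [plane_s, plane_t, dv_true, Prod.mk_add_mk, add_zero, mem_ofPred_eq] at *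
        refine ⟨g, g1, g2, g3, ?_⟩
        intro x y hc
        rw [g4 x y hc]
        have hne : ¬ (x + 1 = x0 ∧ y = y0) := by
          rintro ⟨rfl, rfl⟩; rw [ho] at hc; cases hc
        split_ifs <;> omega

/-- Easy direction of planar duality. -/
lemma dual_excl (ω : E2 → Bool) (B N : ℤ) {u v f f' : ℤ × ℤ}
    (h : plane.Conn ω {x | -B ≤ x.2 ∧ x.2 ≤ B} u v) (hu : u.1 ≤ -N) (hv : N ≤ v.1)
    (h' : plane.Conn (dualC ω) {x | -N ≤ x.1 ∧ x.1 ≤ N - 1} f f') (hf : f.2 < -B) (hf' : B ≤ f'.2)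
    (hB : 0 ≤ B) : False := by
  obtain ⟨g, g1, g2, g3, g4⟩ := height_fun ω B h
  have hconst : g f.1 f.2 = g f'.1 f'.2 := by
    clear hf'
    induction h' with
    | refl => rfl
    | @tail a b _ hs ih =>
      rw [ih]
      obtain ⟨ha, hb, hadj⟩ := hs
      rw [Gr.adj_iff] at hadj
      obtain ⟨⟨⟨x0, y0⟩, c⟩, ho, hd⟩ := hadj
      cases c with
      | false =>
        have hc : ω ((x0 + 1, y0), true) = false := by simpa [dualC, crossE] using ho
        have key := g4 x0 y0 hc
        have : g (x0 + 1) y0 = g x0 y0 := by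
          have hx : -N ≤ x0 ∧ x0 + 1 ≤ N - 1 := by
            rcases hd with ⟨rfl, rfl⟩ | ⟨rfl, rfl⟩ <;> simp at ha hb <;> omega
          rw [if_neg (by omega), if_neg (by omega)] at key
          linarith
        rcases hd with ⟨rfl, rfl⟩ | ⟨rfl, rfl⟩ <;> simp [this]
      | true =>
        have hc : ω ((x0, y0 + 1), false) = false := by simpa [dualC, crossE] using ho
        have key := g3 x0 y0 hc
        rcases hd with ⟨rfl, rfl⟩ | ⟨rfl, rfl⟩ <;> simp [key]
  have hx : -N ≤ f'.1 ∧ f'.1 ≤ N - 1 := by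
    rcases h'.mem_or with e | e
    · exfalso; rw [e] at hf; omega
    · exact e.2
  rw [g1 _ _ hf, g2 _ _ hf', if_pos (by omega), if_neg (by omega)] at hconst
  norm_num at hconst
end

section
open ProbabilityTheory Relation

/-! ### Critical arms at one half, and positivity above one half -/

lemma arm_half (l : ℕ) : 1 ≤ 2 * ((l : ℝ) + 1) * tp (l + 1) (1 / 2) := by
  let A : ℕ → Set (E2 → Bool) := fun a =>
    {ω | plane.Hit ω univ (0, (a : ℤ)) {x | x.1 = (l : ℤ) + 1}}
  let B : ℕ → Set (E2 → Bool) := fun a =>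
    {ω | plane.Hit ω univ ((a : ℤ), -1) {x | x.2 = (l : ℤ)}}
  let B' : ℕ → Set (E2 → Bool) := fun a => {ω | dualC ω ∈ B a}
  have hcov : (univ : Set (E2 → Bool)) ⊆
      (⋃ a ∈ Finset.range (l + 1), A a) ∪ ⋃ a ∈ Finset.range (l + 1), B' a := by
    intro ω _
    rcases dual_or ω l l with ⟨a, b, ha, _, hc⟩ | ⟨a, b, ha, _, hc⟩
    · left
      simp only [mem_iUnion]
      exact ⟨a, by simp; omega, _, rfl, hc⟩
    · right
      simp only [mem_iUnion]
      exact ⟨a, by simp; omega, _, rfl, hc⟩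
  have hA : ∀ a, pr (fun _ : E2 => (1 / 2 : ℝ)) (A a) ≤ tp (l + 1) (1 / 2) := by
    intro a
    refine tp_shift _ _ _ _ ?_
    rintro ⟨x, y⟩ hx
    simp only [mem_ofPred_eq] at hx
    simp only [T2, mem_ofPred_eq, Prod.mk_sub_mk, sub_zero, abs_lt, hx]
    push_cast; omega
  have hB : ∀ a, pr (fun _ : E2 => (1 / 2 : ℝ)) (B' a) ≤ tp (l + 1) (1 / 2) := by
    intro a
    rw [← pr_dual (p := 1 / 2) (by norm_num) (by norm_num) (Gr.measurable_hit _ _ _)]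
    norm_num only
    refine tp_shift _ _ _ _ ?_
    rintro ⟨x, y⟩ hx
    simp only [mem_ofPred_eq] at hx
    simp only [T2, mem_ofPred_eq, Prod.mk_sub_mk, sub_zero, abs_lt, hx]
    push_cast; omega
  calc (1 : ℝ) = pr (fun _ : E2 => (1 / 2 : ℝ)) univ := (pr_univ _).symm
    _ ≤ _ := (pr_mono _ hcov).trans (pr_union_le _ _ _)
    _ ≤ ∑ a ∈ Finset.range (l + 1), tp (l + 1) (1 / 2) + ∑ a ∈ Finset.range (l + 1), tp (l + 1) (1 / 2) :=
        add_le_add ((pr_biUnion_le _ _ _).trans (Finset.sum_le_sum fun a _ => hA a))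
          ((pr_biUnion_le _ _ _).trans (Finset.sum_le_sum fun a _ => hB a))
    _ = _ := by simp; ring

lemma outD_spec {n : ℕ} {S : Finset (ℤ × ℤ)} (hS : S ⊆ R2 n) (d : E2 × Bool)
    (h1 : plane.tl d ∈ S) (h2 : plane.hd d ∉ S) : d ∈ plane.outD (F2 n) S := by
  have : d.1 ∈ F2 n := by
    refine F2_spec n _ ?_
    have := (R2_iff n _).1 (hS h1)
    rcases Gr.tl_hd (G := plane) d with ⟨a, b⟩ | ⟨a, b⟩
    · left; rwa [← a]
    · right; rwa [← a]
  simp [Gr.outD, this, h1, h2]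

lemma hd_bound {n : ℕ} {d : E2 × Bool} (h : plane.tl d ∈ R2 n) :
    |(plane.hd d).1| ≤ n ∧ |(plane.hd d).2| ≤ n := by
  obtain ⟨⟨⟨x, y⟩, b⟩, c⟩ := d
  simp only [Gr.tl, Gr.hd, plane_s, plane_t, R2, Finset.mem_product, Finset.mem_Icc, abs_le] at *
  cases b <;> cases c <;> simp at * <;> omega

lemma tp_step {n : ℕ} {S : Finset (ℤ × ℤ)} (hS : S ⊆ R2 n) (h0 : (0 : ℤ × ℤ) ∈ S) {p φ : ℝ}
    (hp0 : 0 ≤ p) (hp1 : p ≤ 1)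
    (hφ : ∑ d ∈ plane.outD (F2 n) S, pr (fun _ => p) {ω | plane.Conn ω S 0 (plane.tl d)} ≤ φ)
    (N : ℕ) : tp (N + n) p ≤ φ * tp N p := by
  have := Gr.simon (G := plane) (fun _ => p) (fun _ => hp0) (fun _ => hp1) S h0 (T2 (N + n))
    (fun x hx h => by
      have := (R2_iff n _).1 (hS hx)
      simp only [T2, mem_ofPred_eq, not_not] at this h
      apply h
      push_cast
      constructor <;> linarith [this.1, this.2])
    (plane.outD (F2 n) S) (fun d h1 h2 => outD_spec hS d h1 h2)
  refine this.trans ?_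
  refine le_trans ?_ (mul_le_mul_of_nonneg_right hφ (pr_nonneg _ _))
  rw [Finset.sum_mul]
  refine Finset.sum_le_sum fun d hd => ?_
  have hd' : plane.tl d ∈ S := by
    simp [Gr.outD] at hd; tauto
  have hb := hd_bound (hS hd')
  refine mul_le_mul ?_ ?_ (pr_nonneg _ _) (pr_nonneg _ _)
  · exact mul_le_of_le_one_right (pr_nonneg _ _) hp1
  · refine tp_shift _ _ _ _ ?_
    intro x hx
    simp only [T2, mem_ofPred_eq, Prod.fst_sub, Prod.snd_sub, abs_lt, abs_le] at *
    push_cast at hx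
    omega

lemma tp_iter {n : ℕ} {S : Finset (ℤ × ℤ)} (hS : S ⊆ R2 n) (h0 : (0 : ℤ × ℤ) ∈ S) {p φ : ℝ}
    (hp0 : 0 ≤ p) (hp1 : p ≤ 1) (hφ0 : 0 ≤ φ)
    (hφ : ∑ d ∈ plane.outD (F2 n) S, pr (fun _ => p) {ω | plane.Conn ω S 0 (plane.tl d)} ≤ φ)
    (j : ℕ) : tp (j * n) p ≤ φ ^ j := by
  induction j with
  | zero => simpa [tp] using pr_le_one _ _
  | succ j ih =>
    rw [Nat.succ_mul, pow_succ']
    exact (tp_step hS h0 hp0 hp1 hφ _).trans (mul_le_mul_of_nonneg_left ih hφ0)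

lemma zero_mem_R2 {n : ℕ} (hn : 1 ≤ n) : (0 : ℤ × ℤ) ∈ R2 n := by
  simp [R2]; omega

lemma phi_half {n : ℕ} {S : Finset (ℤ × ℤ)} (hS : S ⊆ R2 n) (h0 : (0 : ℤ × ℤ) ∈ S) :
    1 ≤ ∑ d ∈ plane.outD (F2 n) S,
      pr (fun _ => (1 / 2 : ℝ)) {ω | plane.Conn ω S 0 (plane.tl d)} := by
  by_contra hlt
  push Not at hlt
  set φ := ∑ d ∈ plane.outD (F2 n) S,
      pr (fun _ => (1 / 2 : ℝ)) {ω | plane.Conn ω S 0 (plane.tl d)} with hφ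
  have hφ0 : 0 ≤ φ := Finset.sum_nonneg fun _ _ => pr_nonneg _ _
  have hn : 1 ≤ n := by
    have := hS h0
    simp [R2] at this; omega
  have key : ∀ j : ℕ, 1 ≤ j → (1 : ℝ) ≤ 2 * n * (j * φ ^ j) := by
    intro j hj
    obtain ⟨l, hl⟩ : ∃ l, j * n = l + 1 := ⟨j * n - 1, by have := Nat.mul_pos hj hn; omega⟩
    have h1 := arm_half l
    have h2 := tp_iter hS h0 (by norm_num) (by norm_num) hφ0 hφ.ge j
    rw [hl] at h2
    have h3 : ((j : ℝ) * n) = l + 1 := by exact_mod_cast hl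
    rw [← h3] at h1
    have : 2 * ((j : ℝ) * n) * tp (l + 1) (1 / 2) ≤ 2 * ((j : ℝ) * n) * φ ^ j :=
      mul_le_mul_of_nonneg_left h2 (by positivity)
    linarith
  have ht : Filter.Tendsto (fun j : ℕ => 2 * (n : ℝ) * (j * φ ^ j)) Filter.atTop (nhds (2 * n * 0)) :=
    (tendsto_self_mul_const_pow_of_lt_one hφ0 hlt).const_mul _
  rw [mul_zero] at ht
  obtain ⟨j, h1, h2⟩ := ((ht.eventually_lt_const one_pos).and (Filter.eventually_ge_atTop 1)).exists
  exact absurd (key j h2) (not_le.2 h1)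

lemma tp_lower_of {p p1 : ℝ} (hp : 0 < p) (h : p ≤ p1) (h1 : p1 < 1)
    (hφ : ∀ n : ℕ, ∀ S ⊆ R2 n, (0 : ℤ × ℤ) ∈ S → 1 ≤ ∑ d ∈ plane.outD (F2 n) S,
      pr (fun _ => p) {ω | plane.Conn ω S 0 (plane.tl d)}) {n : ℕ} (hn : 1 ≤ n) :
    1 - Real.exp (-(p1 - p)) ≤ tp n p1 :=
  Gr.dct_lower (G := plane) (R2 n) (zero_mem_R2 hn) (T2 n) (R2_iff n) (F2 n) (F2_spec n) hp h h1
    (hφ n)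

/-- Percolation above one half. -/
lemma tp_above {p1 : ℝ} (h : 1 / 2 < p1) (h1 : p1 < 1) {n : ℕ} (hn : 1 ≤ n) :
    1 - Real.exp (-(p1 - 1 / 2)) ≤ tp n p1 :=
  tp_lower_of (by norm_num) h.le h1 (fun _ _ hS h0 => phi_half hS h0) hn

/-! ### Independent families -/

lemma indep_family {E ι : Type*} (P : E → ℝ) (s : Finset ι) (I : ι → Set E)
    (A : ι → Set (E → Bool)) (hdet : ∀ i, Det (I i) (A i)) (hm : ∀ i, MeasurableSet (A i))
    (hd : ∀ i ∈ s, ∀ j ∈ s, i ≠ j → Disjoint (I i) (I j)) :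
    pr P (⋂ i ∈ s, A i) = ∏ i ∈ s, pr P (A i) := by
  classical
  have hD : ∀ s : Finset ι, Det (⋃ i ∈ s, I i) (⋂ i ∈ s, A i) := by
    intro s
    refine Det.iInter fun i => ?_
    by_cases hi : i ∈ s
    · simp only [hi, iInter_true]
      exact (hdet i).mono (subset_biUnion_of_mem (u := I) (show i ∈ (s : Set ι) from hi))
    · simp only [hi, iInter_of_empty]
      simpa [hi] using det_univ _
  induction s using Finset.induction_on with
  | empty => simp [pr_univ]
  | insert a s ha ih =>
    rw [Finset.prod_insert ha, ← ih (fun i hi j hj => hd i (Finset.mem_insert_of_mem hi) j (Finset.mem_insert_of_mem hj)),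
      ← pr_inter_of_det P (hdet a) (hD s) ?_ (hm a) (Finset.measurableSet_biInter _ fun i _ => hm i)]
    · congr 1
      ext ω; simp
    · rw [disjoint_iUnion₂_right]
      intro i hi
      exact hd a (Finset.mem_insert_self _ _) i (Finset.mem_insert_of_mem hi) (by rintro rfl; exact ha hi)
end

section
open ProbabilityTheory Relation

/-- Exits of the explored region: either few exits, or one of them can be prolonged. -/
lemma exit_bound {E ι : Type*} [DecidableEq ι] (P : E → ℝ) (D : Finset ι) (I0 : Set E) (I : ι → Set E)
    (C L O : ι → Set (E → Bool)) (hC : ∀ d, Det I0 (C d)) (hL : ∀ d, Det (I d) (L d))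
    (hO : ∀ d, Det (I d) (O d)) (mC : ∀ d, MeasurableSet (C d)) (mL : ∀ d, MeasurableSet (L d))
    (mO : ∀ d, MeasurableSet (O d)) (hI0 : ∀ d, Disjoint I0 (I d))
    (hI : ∀ d ∈ D, ∀ d' ∈ D, d ≠ d' → Disjoint (I d) (I d')) {p lam : ℝ}
    (hp1 : p < 1) (hp0 : 0 ≤ p) (hl0 : 0 ≤ lam) (hl1 : lam ≤ 1)
    (hPL : ∀ d, pr P (L d) = lam) (hPO : ∀ d, pr P (O d) = p) (j : ℕ) :
    pr P {ω | ∀ d ∈ D, ω ∈ C d → ω ∉ L d} ≤ pr P {ω | ∀ d ∈ D, ω ∉ C d} + (1 - lam) ^ j +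
      ((1 - p) ^ j)⁻¹ * pr P {ω | (∃ d ∈ D, ω ∈ C d) ∧ ∀ d ∈ D, ω ∈ C d → ω ∉ O d} := by
  classical
  let A : Finset ι → Set (E → Bool) := fun S => ⋂ d ∈ D, {ω | ω ∈ C d ↔ d ∈ S}
  have hcase : ∀ (S : Finset ι) (d : ι), {ω | ω ∈ C d ↔ d ∈ S} = C d ∨ {ω | ω ∈ C d ↔ d ∈ S} = (C d)ᶜ := by
    intro S d
    by_cases hd : d ∈ S
    · left; ext; simp [hd]
    · right; ext; simp [hd]
  have dA : ∀ S, Det I0 (A S) := by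
    intro S
    refine Det.iInter fun d => ?_
    by_cases hD : d ∈ D
    · simp only [hD, iInter_true]
      rcases hcase S d with h | h <;> rw [h]
      · exact hC d
      · exact (hC d).compl
    · simpa [hD] using det_univ _
  have mA : ∀ S, MeasurableSet (A S) := by
    intro S
    refine Finset.measurableSet_biInter _ fun d _ => ?_
    rcases hcase S d with h | h <;> rw [h]
    · exact mC d
    · exact (mC d).compl
  have hdisj : ∀ X : Finset ι → Set (E → Bool),
      PairwiseDisjoint (D.powerset : Set (Finset ι)) (fun S => A S ∩ X S) := by
    intro X S hS S' hS' hne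
    rw [Function.onFun, Set.disjoint_left]
    rintro ω ⟨h1, _⟩ ⟨h2, _⟩
    apply hne
    simp only [A, mem_iInter, mem_ofPred_eq] at h1 h2
    simp only [Finset.coe_powerset, mem_preimage, mem_powerset_iff, Finset.coe_subset] at hS hS'
    ext d
    constructor
    · intro h; exact (h2 d (hS h)).1 ((h1 d (hS h)).2 h)
    · intro h; exact (h1 d (hS' h)).1 ((h2 d (hS' h)).2 h)
  have hfac : ∀ (X : ι → Set (E → Bool)) (x : ℝ), (∀ d, Det (I d) (X d)) → (∀ d, MeasurableSet (X d)) →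
      (∀ d, pr P (X d) = x) → ∀ S ∈ D.powerset,
      pr P (A S ∩ ⋂ d ∈ S, (X d)ᶜ) = pr P (A S) * (1 - x) ^ S.card := by
    intro X x dX mX hX S hS
    rw [Finset.mem_powerset] at hS
    have hdet : Det (⋃ d ∈ S, I d) (⋂ d ∈ S, (X d)ᶜ) := by
      refine Det.iInter fun i => ?_
      by_cases hi : i ∈ S
      · simp only [hi, iInter_true]
        exact (dX i).compl.mono (subset_biUnion_of_mem (u := I) (show i ∈ (S : Set ι) from hi))
      · simpa [hi] using det_univ _
    rw [pr_inter_of_det P (dA S) hdet ?_ (mA S) (Finset.measurableSet_biInter _ fun i _ => (mX i).compl),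
      indep_family P S I (fun d => (X d)ᶜ) (fun d => (dX d).compl) (fun d => (mX d).compl)
        (fun i hi j hj => hI i (hS hi) j (hS hj))]
    · congr 1
      rw [← Finset.prod_const]
      exact Finset.prod_congr rfl fun d _ => by rw [pr_compl P (mX d), hX d]
    · rw [disjoint_iUnion₂_right]
      exact fun i _ => hI0 i
  have hmX : ∀ (X : ι → Set (E → Bool)), (∀ d, MeasurableSet (X d)) → ∀ S,
      MeasurableSet (A S ∩ ⋂ d ∈ S, (X d)ᶜ) := fun X mX S =>
    (mA S).inter (Finset.measurableSet_biInter _ fun i _ => (mX i).compl)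
  -- the set of actual exits
  let K : (E → Bool) → Finset ι := fun ω => D.filter fun d => ω ∈ C d
  have hK : ∀ ω, ω ∈ A (K ω) := by
    intro ω
    simp only [A, mem_iInter, mem_ofPred_eq, K, Finset.mem_filter]
    tauto
  have hKD : ∀ ω, K ω ∈ D.powerset := fun ω => by simp [K]
  have e1 : pr P {ω | ∀ d ∈ D, ω ∈ C d → ω ∉ L d} ≤ ∑ S ∈ D.powerset, pr P (A S) * (1 - lam) ^ S.card := by
    rw [← Finset.sum_congr rfl fun S hS => hfac L lam hL mL hPL S hS,
      ← pr_biUnion P (hdisj _) (fun S _ => hmX L mL S)]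
    refine pr_mono _ fun ω h => ?_
    simp only [mem_iUnion]
    refine ⟨K ω, hKD ω, hK ω, ?_⟩
    simp only [mem_iInter, K, Finset.mem_filter]
    exact fun d hd => h d hd.1 hd.2
  have e2 : ∑ S ∈ D.powerset.erase ∅, pr P (A S) * (1 - p) ^ S.card ≤
      pr P {ω | (∃ d ∈ D, ω ∈ C d) ∧ ∀ d ∈ D, ω ∈ C d → ω ∉ O d} := by
    rw [← Finset.sum_congr rfl fun S hS => hfac O p hO mO hPO S (Finset.mem_of_mem_erase hS),
      ← pr_biUnion P ((hdisj _).subset (by simp)) (fun S _ => hmX O mO S)]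
    refine pr_mono _ fun ω h => ?_
    simp only [mem_iUnion] at h
    obtain ⟨S, hS, h1, h2⟩ := h
    simp only [A, mem_iInter, mem_ofPred_eq] at h1 h2
    rw [Finset.mem_erase, Finset.mem_powerset] at hS
    obtain ⟨d, hd⟩ := Finset.nonempty_iff_ne_empty.2 hS.1
    exact ⟨⟨d, hS.2 hd, (h1 d (hS.2 hd)).2 hd⟩, fun d hd hc => h2 d ((h1 d hd).1 hc)⟩
  have e3 : ∑ S ∈ D.powerset, pr P (A S) ≤ 1 := by
    have := pr_biUnion P (hdisj fun _ => univ) (fun S _ => (mA S).inter MeasurableSet.univ)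
    simp only [inter_univ] at this
    rw [← this]
    exact pr_le_one _ _
  have e4 : pr P (A ∅) ≤ pr P {ω | ∀ d ∈ D, ω ∉ C d} := by
    refine pr_mono _ fun ω h => ?_
    simpa [A] using h
  have hlj : 0 ≤ (1 - lam) ^ j := by have : 0 ≤ 1 - lam := by linarith
                                     positivity
  have hpp : 0 < 1 - p := by linarith
  have e5 : ∀ S ∈ D.powerset.erase ∅, pr P (A S) * (1 - lam) ^ S.card ≤
      (1 - lam) ^ j * pr P (A S) + ((1 - p) ^ j)⁻¹ * (pr P (A S) * (1 - p) ^ S.card) := by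
    intro S _
    have hA := pr_nonneg P (A S)
    rcases le_or_gt j S.card with h | h
    · have h1 : (1 - lam) ^ S.card ≤ (1 - lam) ^ j :=
        pow_le_pow_of_le_one (by linarith) (by linarith) h
      have h2 := mul_le_mul_of_nonneg_left h1 hA
      have h3 : 0 ≤ ((1 - p) ^ j)⁻¹ * (pr P (A S) * (1 - p) ^ S.card) := by positivity
      linarith
    · have h1 : (1 - p) ^ j ≤ (1 - p) ^ S.card :=
        pow_le_pow_of_le_one (by linarith) (by linarith) h.le
      have h2 : 1 ≤ ((1 - p) ^ j)⁻¹ * (1 - p) ^ S.card := by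
        rw [← div_eq_inv_mul, one_le_div (by positivity)]; exact h1
      have h3 : (1 - lam) ^ S.card ≤ 1 := pow_le_one₀ (by linarith) (by linarith)
      have h4 := mul_le_mul_of_nonneg_left (h3.trans h2) hA
      have h5 : 0 ≤ (1 - lam) ^ j * pr P (A S) := by positivity
      linarith
  have e6 : ∑ S ∈ D.powerset, pr P (A S) * (1 - lam) ^ S.card = pr P (A ∅) +
      ∑ S ∈ D.powerset.erase ∅, pr P (A S) * (1 - lam) ^ S.card := by
    rw [← Finset.add_sum_erase _ _ (Finset.empty_mem_powerset D)]
    simp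
  have e7 := Finset.sum_le_sum e5
  rw [Finset.sum_add_distrib, ← Finset.mul_sum, ← Finset.mul_sum] at e7
  have e8 : ∑ S ∈ D.powerset.erase ∅, pr P (A S) ≤ 1 :=
    (Finset.sum_le_sum_of_subset_of_nonneg (Finset.erase_subset _ _) fun _ _ _ => pr_nonneg _ _).trans e3
  have e9 := mul_le_mul_of_nonneg_left e8 hlj
  have e10 := mul_le_mul_of_nonneg_left e2 (show 0 ≤ ((1 - p) ^ j)⁻¹ by positivity)
  linarith
end

section
open ProbabilityTheory Relation

/-! ### Symmetries of the square lattice -/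

/-- Reflection of edges. -/
def refE : E2 → E2
  | ((x, y), false) => ((-x - 1, y), false)
  | ((x, y), true) => ((-x, y), true)

/-- Transposition of edges. -/
def swE : E2 → E2 := fun e => (e.1.swap, !e.2)

/-- Symmetries acting on vertices. -/
def symV (c : Bool × Bool) (v : ℤ × ℤ) : ℤ × ℤ :=
  if c.2 then (if c.1 then (v.2, -v.1) else (v.2, v.1)) else (if c.1 then (-v.1, v.2) else v)

/-- Inverse symmetries acting on vertices. -/
def symV' (c : Bool × Bool) (v : ℤ × ℤ) : ℤ × ℤ :=
  if c.2 then (if c.1 then (-v.2, v.1) else (v.2, v.1)) else (if c.1 then (-v.1, v.2) else v)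

/-- Symmetries acting on edges. -/
def symE (c : Bool × Bool) (e : E2) : E2 :=
  if c.2 then swE (if c.1 then refE e else e) else (if c.1 then refE e else e)

/-- Inverse symmetries acting on edges. -/
def symE' (c : Bool × Bool) (e : E2) : E2 :=
  if c.1 then refE (if c.2 then swE e else e) else (if c.2 then swE e else e)

lemma symE_symE' (c : Bool × Bool) (e : E2) : symE c (symE' c e) = e := by
  obtain ⟨a, b⟩ := c
  obtain ⟨⟨x, y⟩, d⟩ := e
  cases a <;> cases b <;> cases d <;> simp [symE, symE', swE, refE]

lemma symE'_symE (c : Bool × Bool) (e : E2) : symE' c (symE c e) = e := by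
  obtain ⟨a, b⟩ := c
  obtain ⟨⟨x, y⟩, d⟩ := e
  cases a <;> cases b <;> cases d <;> simp [symE, symE', swE, refE]

lemma symV'_symV (c : Bool × Bool) (v : ℤ × ℤ) : symV' c (symV c v) = v := by
  obtain ⟨a, b⟩ := c
  obtain ⟨x, y⟩ := v
  cases a <;> cases b <;> simp [symV, symV']

lemma symE_inj (c : Bool × Bool) : Function.Injective (symE c) :=
  Function.LeftInverse.injective (symE'_symE c)

lemma symE_ends (c : Bool × Bool) (e : E2) :
    plane.Ends (symE c e) (symV c (plane.s e)) (symV c (plane.t e)) := by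
  obtain ⟨a, b⟩ := c
  obtain ⟨⟨x, y⟩, d⟩ := e
  unfold Gr.Ends
  cases a <;> cases b <;> cases d <;> simp [symE, symV, swE, refE] <;> ring

lemma symE'_ends (c : Bool × Bool) (e : E2) :
    plane.Ends (symE' c e) (symV' c (plane.s e)) (symV' c (plane.t e)) := by
  obtain ⟨a, b⟩ := c
  obtain ⟨⟨x, y⟩, d⟩ := e
  unfold Gr.Ends
  cases a <;> cases b <;> cases d <;> simp [symE', symV', swE, refE] <;> ring

/-- Closed boxes. -/
def Bx (n : ℕ) : Set (ℤ × ℤ) := {x | |x.1| ≤ n ∧ |x.2| ≤ n}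

lemma Bx_mono {m n : ℕ} (h : m ≤ n) : Bx m ⊆ Bx n := by
  intro x hx
  have : (m : ℤ) ≤ n := by exact_mod_cast h
  exact ⟨hx.1.trans this, hx.2.trans this⟩

lemma symV_Bx (c : Bool × Bool) {n : ℕ} {x : ℤ × ℤ} (h : x ∈ Bx n) : symV c x ∈ Bx n := by
  obtain ⟨a, b⟩ := c
  obtain ⟨h1, h2⟩ := h
  cases a <;> cases b <;> simp [symV, Bx, h1, h2]

lemma symV'_Bx (c : Bool × Bool) {n : ℕ} {x : ℤ × ℤ} (h : x ∈ Bx n) : symV' c x ∈ Bx n := by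
  obtain ⟨a, b⟩ := c
  obtain ⟨h1, h2⟩ := h
  cases a <;> cases b <;> simp [symV', Bx, h1, h2]

/-- Edges inside a box. -/
def EB (n : ℕ) : Set E2 := {e | plane.s e ∈ Bx n ∧ plane.t e ∈ Bx n}

lemma EB_mono {m n : ℕ} (h : m ≤ n) : EB m ⊆ EB n := fun _ he => ⟨Bx_mono h he.1, Bx_mono h he.2⟩

lemma symE_EB (c : Bool × Bool) {n : ℕ} {e : E2} (h : e ∈ EB n) : symE c e ∈ EB n := by
  have h1 := symV_Bx c h.1
  have h2 := symV_Bx c h.2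
  rcases symE_ends c e with ⟨a, b⟩ | ⟨a, b⟩
  · exact ⟨a ▸ h1, b ▸ h2⟩
  · exact ⟨by rw [a]; exact h2, by rw [b]; exact h1⟩

lemma EB_sub (n : ℕ) : EB n ⊆ (F2 (n + 1) : Set E2) := by
  intro e he
  refine F2_spec _ e (Or.inl ?_)
  have := he.1
  simp only [Bx, T2, mem_ofPred_eq, not_not] at *
  push_cast
  omega

/-- Pull back of an event by a symmetry. -/
def pull (c : Bool × Bool) (A : Set (E2 → Bool)) : Set (E2 → Bool) := {ω | (fun e => ω (symE c e)) ∈ A}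

lemma measurableSet_pull (c : Bool × Bool) {A : Set (E2 → Bool)} (h : MeasurableSet A) :
    MeasurableSet (pull c A) :=
  (measurable_pi_lambda (fun ω : E2 → Bool => fun e => ω (symE c e))
    fun e => measurable_pi_apply (symE c e)) h

lemma det_pull (c : Bool × Bool) {A : Set (E2 → Bool)} {I J : Set E2} (h : Det I A)
    (hI : ∀ e ∈ I, symE c e ∈ J) : Det J (pull c A) := by
  intro ω ω' hw hA
  exact h _ _ (fun e he => hw _ (hI e he)) hA

lemma pr_pull (c : Bool × Bool) {A : Set (E2 → Bool)} (p : ℝ) (h : MeasurableSet A) :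
    pr (fun _ => p) (pull c A) = pr (fun _ => p) A :=
  (pr_reindex (fun _ : E2 => p) (symE c) (symE_inj c) h).symm

lemma upper_pull (c : Bool × Bool) {A : Set (E2 → Bool)} (h : IsUpperSet A) :
    IsUpperSet (pull c A) := fun _ _ hle hA => h (fun e => hle (symE c e)) hA

/-! ### Exits of boxes -/

/-- The box of radius `m` is joined to `x` within the box of radius `n`. -/
def CC (m n : ℕ) (x : ℤ × ℤ) : Set (E2 → Bool) := {ω | ∃ u ∈ Bx m, plane.Conn ω (Bx n) u x}

/-- Exit event. -/
def exC (m n : ℕ) (d : (Bool × Bool) × ℤ) : Set (E2 → Bool) := pull d.1 (CC m n ((n : ℤ), d.2))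

/-- Straight open line of length `J`. -/
def ln (n J : ℕ) (y : ℤ) : Set (E2 → Bool) :=
  ⋂ t ∈ Finset.range J, {ω | ω (((n : ℤ) + (t : ℕ), y), false) = true}

/-- Exit line. -/
def exL (n J : ℕ) (d : (Bool × Bool) × ℤ) : Set (E2 → Bool) := pull d.1 (ln n J d.2)

/-- Exit edge. -/
def exO (n : ℕ) (d : (Bool × Bool) × ℤ) : Set (E2 → Bool) := {ω | ω (symE d.1 (((n : ℤ), d.2), false)) = true}

/-- All exits. -/
noncomputable def exD (n : ℕ) : Finset ((Bool × Bool) × ℤ) := Finset.univ ×ˢ Finset.Icc (-(n : ℤ)) n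

/-- Edges of exit lines. -/
def exI (n J : ℕ) (d : (Bool × Bool) × ℤ) : Set E2 :=
  {e | ∃ t : ℕ, t < J ∧ e = symE d.1 (((n : ℤ) + (t : ℕ), d.2), false)}

lemma CC_meas (m n : ℕ) (x : ℤ × ℤ) : MeasurableSet (CC m n x) := by
  have : CC m n x = ⋃ u ∈ Bx m, {ω | plane.Conn ω (Bx n) u x} := by ext; simp [CC]
  rw [this]
  exact MeasurableSet.biUnion (to_countable _) fun u _ => Gr.measurable_conn _ _ _

lemma CC_det (m n : ℕ) (x : ℤ × ℤ) : Det (EB n) (CC m n x) := by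
  rintro ω ω' hw ⟨u, hu, hc⟩
  exact ⟨u, hu, hc.congr fun e h1 h2 => hw e ⟨h1, h2⟩⟩

lemma CC_upper (m n : ℕ) (x : ℤ × ℤ) : IsUpperSet (CC m n x) := by
  rintro ω ω' hle ⟨u, hu, hc⟩
  exact ⟨u, hu, Gr.upper_conn _ _ _ hle hc⟩

lemma ln_meas (n J : ℕ) (y : ℤ) : MeasurableSet (ln n J y) :=
  Finset.measurableSet_biInter _ fun _ _ => measurableSet_coord _ _

lemma ln_mem {n J : ℕ} {y : ℤ} {ω : E2 → Bool} :
    ω ∈ ln n J y ↔ ∀ t : ℕ, t < J → ω (((n : ℤ) + (t : ℕ), y), false) = true := by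
  simp [ln]

lemma ln_det (n J : ℕ) (y : ℤ) :
    Det {e | ∃ t : ℕ, t < J ∧ e = (((n : ℤ) + (t : ℕ), y), false)} (ln n J y) := by
  intro ω ω' hw h
  rw [ln_mem] at *
  intro t ht
  rw [← hw _ ⟨t, ht, rfl⟩]
  exact h t ht

lemma ln_upper (n J : ℕ) (y : ℤ) : IsUpperSet (ln n J y) := by
  intro ω ω' hle h
  rw [ln_mem] at *
  intro t ht
  exact hle _ (h t ht)

lemma ln_pr (n J : ℕ) (y : ℤ) {p : ℝ} (h0 : 0 ≤ p) (h1 : p ≤ 1) : pr (fun _ => p) (ln n J y) = p ^ J := by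
  unfold ln
  rw [indep_family _ _ (fun t : ℕ => {((((n : ℤ) + (t : ℕ), y), false) : E2)}) _ (fun t => det_coord _ _)
    (fun t => measurableSet_coord _ _)]
  · rw [Finset.prod_congr rfl fun t _ => pr_coord_true (P := fun _ : E2 => p) h0 h1]
    simp
  · intro i _ j _ hne
    simpa using fun h => hne h

lemma exI_disj (n J : ℕ) (d d' : (Bool × Bool) × ℤ) (h : d ≠ d') : Disjoint (exI n J d) (exI n J d') := by
  rw [Set.disjoint_left]
  rintro e ⟨t, _, rfl⟩ ⟨t', _, h'⟩
  obtain ⟨⟨a, b⟩, y⟩ := d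
  obtain ⟨⟨a', b'⟩, y'⟩ := d'
  cases a <;> cases b <;> cases a' <;> cases b' <;> simp [symE, swE, refE] at h h' <;> omega

lemma exI_EB (n J : ℕ) (d : (Bool × Bool) × ℤ) : Disjoint (EB n) (exI n J d) := by
  rw [Set.disjoint_left]
  rintro e ⟨h1, h2⟩ ⟨t, _, rfl⟩
  obtain ⟨⟨a, b⟩, y⟩ := d
  simp only [Bx, plane_s, plane_t, mem_ofPred_eq, abs_le] at h1 h2
  cases a <;> cases b <;> simp [symE, swE, refE] at h1 h2 <;> omega

lemma exit_exists {m n : ℕ} (hmn : m ≤ n) {ω : E2 → Bool} {u v : ℤ × ℤ} (hu : u ∈ Bx m)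
    (hv : v ∉ Bx n) (hc : plane.Conn ω univ u v) : ∃ d ∈ exD n, ω ∈ exC m n d ∧ ω ∈ exO n d := by
  obtain ⟨e, ho, h1, h2, -, -, h3⟩ := Gr.first_exit hc (Bx_mono hmn hu) hv
  have key : ∃ d ∈ exD n, e.1 = symE d.1 (((n : ℤ), d.2), false) ∧ plane.tl e = symV d.1 ((n : ℤ), d.2) := by
    obtain ⟨⟨⟨x, y⟩, b⟩, f⟩ := e
    simp only [Gr.tl, Gr.hd, plane_s, plane_t, Bx, mem_ofPred_eq, abs_le] at h1 h2 ⊢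
    cases b <;> cases f <;> simp at h1 h2
    · refine ⟨((true, false), y), ?_, ?_⟩
      · simp [exD]; omega
      · simp [symE, symV, refE]; omega
    · refine ⟨((false, false), y), ?_, ?_⟩
      · simp [exD]; omega
      · simp [symE, symV]; omega
    · refine ⟨((true, true), x), ?_, ?_⟩
      · simp [exD]; omega
      · simp [symE, symV, refE, swE]; omega
    · refine ⟨((false, true), x), ?_, ?_⟩
      · simp [exD]; omega
      · simp [symE, symV, swE]; omega
  obtain ⟨d, hd, k1, k2⟩ := key
  refine ⟨d, hd, ?_, ?_⟩
  · refine ⟨symV' d.1 u, symV'_Bx _ hu, ?_⟩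
    have hE : (fun e => (fun e => ω (symE d.1 e)) (symE' d.1 e)) = ω := by
      funext e; simp [symE_symE']
    have := Gr.Conn.hom (G := plane) (G' := plane) (symV' d.1) (symE' d.1) (symE'_ends d.1)
      (U := univ ∩ Bx n) (U' := Bx n) (fun x hx => symV'_Bx _ hx.2) (ω := fun e => ω (symE d.1 e))
      (x := u) (y := plane.tl e) (by rw [hE]; exact h3)
    rw [k2, symV'_symV] at this
    exact this
  · show ω _ = true
    rw [← k1]; exact ho
end

section
open ProbabilityTheory Relation

lemma pr_diff {E : Type*} (P : E → ℝ) {A B : Set (E → Bool)} (h : B ⊆ A) (mB : MeasurableSet B) :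
    pr P (A \ B) = pr P A - pr P B := by
  have := pr_union P (A := A \ B) (B := B) disjoint_sdiff_left mB
  rw [sdiff_union_of_subset h] at this
  linarith

lemma T2_anti {m n : ℕ} (h : m ≤ n) : T2 n ⊆ T2 m := by
  intro x hx
  simp only [T2, mem_ofPred_eq, abs_lt] at *
  omega

lemma tp_anti {m n : ℕ} (h : m ≤ n) (p : ℝ) : tp n p ≤ tp m p := by
  refine pr_mono _ ?_
  rintro ω ⟨y, hy, hc⟩
  exact ⟨y, T2_anti h hy, hc⟩

lemma tp_shift_eq (v : ℤ × ℤ) (n : ℕ) (p : ℝ) :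
    pr (fun _ : E2 => p) {ω | plane.Hit ω univ v {x | x - v ∈ T2 n}} = tp n p := by
  refine le_antisymm (tp_shift v n p _ fun x hx => hx) ?_
  have := Gr.pr_hit_hom (G := plane) (G' := plane) (fun x => x + v) (shE v) (shE_inj _)
    (shE_ends v) (U := univ) (U' := univ) (T := T2 n) (T' := {x | x - v ∈ T2 n}) (fun _ _ => trivial)
    (fun x hx => by simpa using hx) 0 (fun _ => p)
  simpa [tp] using this

lemma box_arm {p c : ℝ} (hc0 : 0 < c) (hc : ∀ n, c ≤ tp n p)
    {ε : ℝ} (hε : 0 < ε) :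
    ∃ m : ℕ, ∀ n ≥ m, pr (fun _ => p) {ω | ∀ d ∈ exD n, ω ∉ exC m n d} ≤ ε := by
  have hc1 : c ≤ 1 := (hc 0).trans (pr_le_one _ _)
  obtain ⟨r, hr⟩ := exists_pow_lt_of_lt_one (show 0 < ε / 2 by linarith) (show 1 - c < 1 by linarith)
  have hbdd : BddBelow (range fun n => tp n p) := ⟨0, by rintro _ ⟨n, rfl⟩; exact pr_nonneg _ _⟩
  have hδ : 0 < ε / (2 * (r + 1)) := by positivity
  obtain ⟨L, hL⟩ := exists_lt_of_ciInf_lt (show (⨅ n, tp n p) < (⨅ n, tp n p) + ε / (2 * (r + 1)) by linarith)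
  let v : ℕ → ℤ × ℤ := fun i => ((i : ℤ) * (2 * L + 2), 0)
  let A : ℕ → ℕ → Set (E2 → Bool) := fun M i => {ω | plane.Hit ω univ (v i) {x | x - v i ∈ T2 M}}
  let I : ℕ → Set E2 := fun i => {e | (plane.s e ∈ univ ∧ plane.t e ∈ univ) ∧
    (plane.s e ∉ {x | x - v i ∈ T2 L} ∨ plane.t e ∉ {x | x - v i ∈ T2 L})}
  have mA : ∀ M i, MeasurableSet (A M i) := fun M i => Gr.measurable_hit _ _ _
  have dA : ∀ i, Det (I i) (A L i) := fun i => Gr.det_hit _ _ _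
  have hI : ∀ i j, i ≠ j → Disjoint (I i) (I j) := by
    intro i j hne
    rw [Set.disjoint_left]
    rintro ⟨⟨x, y⟩, b⟩ ⟨-, h1⟩ ⟨-, h2⟩
    have hij : (i : ℤ) * (2 * L + 2) + (2 * L + 2) ≤ j * (2 * L + 2) ∨
        (j : ℤ) * (2 * L + 2) + (2 * L + 2) ≤ i * (2 * L + 2) := by
      rcases lt_or_gt_of_ne hne with h | h
      · left
        have : (i : ℤ) + 1 ≤ j := by exact_mod_cast h
        nlinarith
      · right
        have : (j : ℤ) + 1 ≤ i := by exact_mod_cast h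
        nlinarith
    simp only [T2, v, mem_ofPred_eq, plane_s, plane_t, not_not, abs_lt] at h1 h2
    cases b <;> simp at h1 h2 <;> omega
  refine ⟨r * (2 * L + 2), fun n hn => ?_⟩
  set m := r * (2 * L + 2) with hm
  set M := n + m + L + 1 with hM
  have hsub : {ω | ∀ d ∈ exD n, ω ∉ exC m n d} ⊆
      (⋂ i ∈ Finset.range r, (A L i)ᶜ) ∪ ⋃ i ∈ Finset.range r, A L i \ A M i := by
    intro ω hω
    by_contra hcon
    simp only [mem_union, mem_iInter, mem_iUnion, not_or, not_forall, not_exists] at hcon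
    obtain ⟨⟨i, hi, h1⟩, h2⟩ := hcon
    have h3 : ω ∈ A M i := by
      by_contra h3
      exact h2 i hi ⟨not_not.1 h1, h3⟩
    obtain ⟨x, hx, hcx⟩ := h3
    have hir : i < r := by simpa using hi
    have hv1 : (i : ℤ) * (2 * L + 2) ≤ m := by
      rw [hm]; push_cast
      have : (i : ℤ) ≤ r := by exact_mod_cast hir.le
      nlinarith
    have hv0 : 0 ≤ (i : ℤ) * (2 * L + 2) := by positivity
    obtain ⟨d, hd, hC, -⟩ := exit_exists (m := m) (n := n) hn (u := v i) (v := x) (ω := ω)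
      (by simp only [Bx, v, mem_ofPred_eq, abs_le]; omega)
      (by
        obtain ⟨x1, x2⟩ := x
        simp only [T2, v, mem_ofPred_eq, Bx, abs_le, abs_lt, Prod.mk_sub_mk, hM] at hx ⊢
        push_cast at hx
        omega) hcx
    exact hω d hd hC
  have h1 : pr (fun _ => p) (⋂ i ∈ Finset.range r, (A L i)ᶜ) ≤ ε / 2 := by
    rw [indep_family _ _ I (fun i => (A L i)ᶜ) (fun i => (dA i).compl) (fun i => (mA L i).compl)
      (fun i _ j _ => hI i j)]
    refine le_trans ?_ hr.le
    calc _ ≤ ∏ i ∈ Finset.range r, (1 - c) := by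
          refine Finset.prod_le_prod (fun _ _ => pr_nonneg _ _) fun i _ => ?_
          rw [pr_compl _ (mA L i), show pr (fun _ => p) (A L i) = tp L p from tp_shift_eq _ _ _]
          linarith [hc L]
      _ = _ := by simp
  have h2 : pr (fun _ => p) (⋃ i ∈ Finset.range r, A L i \ A M i) ≤ ε / 2 := by
    refine (pr_biUnion_le _ _ _).trans ?_
    calc _ ≤ ∑ i ∈ Finset.range r, ε / (2 * (r + 1)) := by
          refine Finset.sum_le_sum fun i _ => ?_
          rw [pr_diff _ ?_ (mA M i), show pr (fun _ => p) (A L i) = tp L p from tp_shift_eq _ _ _,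
            show pr (fun _ => p) (A M i) = tp M p from tp_shift_eq _ _ _]
          · have := ciInf_le hbdd M
            linarith
          · rintro ω ⟨y, hy, hcy⟩
            exact ⟨y, T2_anti (show L ≤ M by omega) hy, hcy⟩
      _ = r * (ε / (2 * (r + 1))) := by simp
      _ ≤ ε / 2 := by
          rw [← mul_div_assoc, div_le_div_iff₀ (by positivity) (by positivity)]
          nlinarith
  calc _ ≤ _ := (pr_mono _ hsub).trans (pr_union_le _ _ _)
    _ ≤ ε := by linarith

/-- Exits of the right side prolonged by a line of length `J`. -/
def exR (m n J : ℕ) : Set (E2 → Bool) :=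
  ⋃ y ∈ Finset.Icc (-(n : ℤ)) n, CC m n ((n : ℤ), y) ∩ ln n J y

lemma exR_meas (m n J : ℕ) : MeasurableSet (exR m n J) :=
  Finset.measurableSet_biUnion _ fun _ _ => (CC_meas _ _ _).inter (ln_meas _ _ _)

lemma exR_upper (m n J : ℕ) : IsUpperSet (exR m n J) := by
  intro ω ω' hle h
  simp only [exR, mem_iUnion] at *
  obtain ⟨y, hy, h1, h2⟩ := h
  exact ⟨y, hy, CC_upper _ _ _ hle h1, ln_upper _ _ _ hle h2⟩

lemma exR_det (m n J : ℕ) : Det (EB (n + J)) (exR m n J) := by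
  intro ω ω' hw h
  simp only [exR, mem_iUnion] at *
  obtain ⟨y, hy, h1, h2⟩ := h
  refine ⟨y, hy, (CC_det m n _).mono (EB_mono (Nat.le_add_right n J)) _ _ hw h1, ?_⟩
  refine (ln_det n J y).mono ?_ _ _ hw h2
  rintro e ⟨t, ht, rfl⟩
  rw [Finset.mem_Icc] at hy
  constructor <;> simp only [Bx, plane_s, plane_t, mem_ofPred_eq, abs_le, dv_false, Prod.mk_add_mk] <;>
    push_cast <;> omega

lemma exR_prob {p c : ℝ} (hp0 : 0 < p) (hp1 : p < 1) (hc0 : 0 < c) (hc : ∀ n, c ≤ tp n p)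
    {ε : ℝ} (hε : 0 < ε) :
    ∃ m : ℕ, ∀ J : ℕ, 1 ≤ J → ∃ n : ℕ, 1 - ε ≤ pr (fun _ => p) (exR m n J) := by
  set η := ε ^ 4 / 3 with hη
  have hη0 : 0 < η := by positivity
  obtain ⟨m, hm⟩ := box_arm hc0 hc hη0
  refine ⟨m, fun J hJ => ?_⟩
  have hlam0 : 0 < p ^ J := by positivity
  have hlam1 : p ^ J ≤ 1 := pow_le_one₀ hp0.le hp1.le
  obtain ⟨j, hj⟩ := exists_pow_lt_of_lt_one hη0 (show 1 - p ^ J < 1 by linarith)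
  have hpj : 0 < (1 - p) ^ j := by have : 0 < 1 - p := by linarith
                                   positivity
  set δ := η * (1 - p) ^ j with hδ
  have hδ0 : 0 < δ := by positivity
  let u : ℕ → ℝ := fun n => pr (fun _ => p) {ω | ∃ d ∈ exD n, ω ∈ exC m n d}
  have mC : ∀ n d, MeasurableSet (exC m n d) := fun n d => measurableSet_pull _ (CC_meas _ _ _)
  have mL : ∀ n d, MeasurableSet (exL n J d) := fun n d => measurableSet_pull _ (ln_meas _ _ _)
  have hstep : ∀ n, m ≤ n → {ω | ∃ d ∈ exD (n + 1), ω ∈ exC m (n + 1) d} ⊆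
      {ω | ∃ d ∈ exD n, ω ∈ exC m n d ∧ ω ∈ exO n d} := by
    rintro n hn ω ⟨d, hd, x, hx, hcx⟩
    have h1 := Gr.Conn.hom (G := plane) (G' := plane) (symV d.1) (symE d.1) (symE_ends d.1)
      (U' := univ) (fun _ _ => mem_univ _) hcx
    refine exit_exists hn (symV_Bx d.1 hx) ?_ h1
    obtain ⟨⟨a, b⟩, y⟩ := d
    simp only [Bx, mem_ofPred_eq, abs_le]
    cases a <;> cases b <;> simp [symV]
  obtain ⟨n, hmn, hn⟩ : ∃ n, m ≤ n ∧ u n - u (n + 1) ≤ δ := by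
    by_contra hcon
    push Not at hcon
    have : ∀ i : ℕ, u (m + i) ≤ 1 - i * δ := by
      intro i
      induction i with
      | zero => simpa using pr_le_one _ _
      | succ i ih =>
        have := hcon (m + i) (by omega)
        push_cast
        rw [← add_assoc]
        linarith
    obtain ⟨i, hi⟩ := exists_nat_gt (1 / δ)
    have h1 := this i
    have h2 : 0 ≤ u (m + i) := pr_nonneg _ _
    rw [div_lt_iff₀ hδ0] at hi
    linarith
  refine ⟨n, ?_⟩
  have hb := exit_bound (fun _ : E2 => p) (exD n) (EB n) (exI n J) (exC m n) (exL n J) (exO n)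
    (fun d => det_pull _ (CC_det _ _ _) fun e he => symE_EB _ he)
    (fun d => det_pull _ (ln_det _ _ _) (by rintro e ⟨t, ht, rfl⟩; exact ⟨t, ht, rfl⟩))
    (fun d => (det_coord _ _).mono (by
      rintro e rfl; exact ⟨0, by omega, by simp⟩))
    (mC n) (mL n) (fun d => measurableSet_coord _ _) (fun d => exI_EB n J d)
    (fun d _ d' _ h => exI_disj n J d d' h) hp1 hp0.le hlam0.le hlam1
    (fun d => by rw [exL, pr_pull _ _ (ln_meas _ _ _), ln_pr _ _ _ hp0.le hp1.le])
    (fun d => pr_coord_true (P := fun _ : E2 => p) hp0.le hp1.le) j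
  have h3 : pr (fun _ => p) {ω | (∃ d ∈ exD n, ω ∈ exC m n d) ∧ ∀ d ∈ exD n, ω ∈ exC m n d → ω ∉ exO n d} ≤ δ := by
    have mm : ∀ n, MeasurableSet {ω | ∃ d ∈ exD n, ω ∈ exC m n d} := by
      intro n
      have : {ω | ∃ d ∈ exD n, ω ∈ exC m n d} = ⋃ d ∈ exD n, exC m n d := by ext; simp
      rw [this]
      exact Finset.measurableSet_biUnion _ fun d _ => mC n d
    have hs : {ω | ∃ d ∈ exD (n + 1), ω ∈ exC m (n + 1) d} ⊆ {ω | ∃ d ∈ exD n, ω ∈ exC m n d} :=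
      (hstep n hmn).trans fun ω ⟨d, hd, h, _⟩ => ⟨d, hd, h⟩
    refine le_trans (le_of_le_of_eq (pr_mono _ ?_) (pr_diff (fun _ => p) hs (mm _))) hn
    rintro ω ⟨h1, h2⟩
    refine ⟨h1, fun h => ?_⟩
    obtain ⟨d, hd, h3, h4⟩ := hstep n hmn h
    exact h2 d hd h3 h4
  have h4 : ((1 - p) ^ j)⁻¹ * pr (fun _ => p) {ω | (∃ d ∈ exD n, ω ∈ exC m n d) ∧
      ∀ d ∈ exD n, ω ∈ exC m n d → ω ∉ exO n d} ≤ η := by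
    rw [inv_mul_le_iff₀ hpj]
    rw [hδ] at h3; linarith
  have h5 := hm n hmn
  -- Harris
  set x := pr (fun _ => p) (exR m n J)ᶜ with hx
  have hx0 : 0 ≤ x := pr_nonneg _ _
  let R : Bool × Bool → Set (E2 → Bool) := fun c => pull c (exR m n J)
  have dR : ∀ c, Det ((F2 (n + J + 1) : Finset E2) : Set E2) (R c) := fun c =>
    (det_pull c (exR_det m n J) fun e he => symE_EB c he).mono (EB_sub _)
  have uR : ∀ c, IsUpperSet (R c) := fun c => upper_pull c (exR_upper _ _ _)
  have pR : ∀ c, pr (fun _ => p) (R c)ᶜ = x := by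
    intro c
    rw [pr_compl _ (measurableSet_pull c (exR_meas _ _ _)), pr_pull c p (exR_meas _ _ _), hx,
      pr_compl _ (exR_meas _ _ _)]
  have dU : ∀ c c', Det ((F2 (n + J + 1) : Finset E2) : Set E2) (R c ∪ R c') := fun c c' =>
    by simpa using (dR c).union (dR c')
  have q0 : ∀ e : E2, (0 : ℝ) ≤ (fun _ : E2 => p) e := fun _ => hp0.le
  have q1 : ∀ e : E2, (fun _ : E2 => p) e ≤ (1 : ℝ) := fun _ => hp1.le
  have H2 : ∀ c c', x * x ≤ pr (fun _ => p) (R c ∪ R c')ᶜ := by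
    intro c c'
    have := harris_compl (dR c) (dR c') (uR c) (uR c') (fun _ => p) q0 q1
    rw [pR, pR] at this
    rwa [compl_union]
  have H4 := harris_compl (dU (false, false) (true, false)) (dU (false, true) (true, true))
    ((uR _).union (uR _)) ((uR _).union (uR _)) (fun _ => p) q0 q1
  have H5 : x ^ 4 ≤ pr (fun _ => p) {ω | ∀ d ∈ exD n, ω ∈ exC m n d → ω ∉ exL n J d} := by
    calc x ^ 4 = (x * x) * (x * x) := by ring
      _ ≤ _ := mul_le_mul (H2 _ _) (H2 _ _) (by positivity) (pr_nonneg _ _)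
      _ ≤ _ := H4
      _ ≤ _ := by
        refine pr_mono _ fun ω h d hd h1 h2 => ?_
        simp only [exD, Finset.mem_product, Finset.mem_univ, true_and] at hd
        have hm : ω ∈ R d.1 := by
          show _ ∈ exR m n J
          simp only [exR, mem_iUnion]
          exact ⟨d.2, hd, h1, h2⟩
        obtain ⟨⟨a, b⟩, y⟩ := d
        simp only [mem_inter_iff, mem_compl_iff, mem_union, not_or] at h
        cases a <;> cases b <;> tauto
  have H6 : x ^ 4 ≤ ε ^ 4 := by
    have : ε ^ 4 = η + η + η := by rw [hη]; ring
    linarith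
  have H7 : x ≤ ε := le_of_pow_le_pow_left₀ (by norm_num) hε.le H6
  rw [hx, pr_compl _ (exR_meas _ _ _)] at H7
  linarith
end

section
open ProbabilityTheory Relation

/-! ### Crossings at one half -/

/-- Crossing of a long strip. -/
def LR (B N : ℤ) : Set (E2 → Bool) :=
  {ω | ∃ u v : ℤ × ℤ, u.1 ≤ -N ∧ N ≤ v.1 ∧ plane.Conn ω {x | -B ≤ x.2 ∧ x.2 ≤ B} u v}

/-- Transposed crossing. -/
def TB (B N : ℤ) : Set (E2 → Bool) :=
  {ω | ∃ f f' : ℤ × ℤ, f.2 < -B ∧ B ≤ f'.2 ∧ plane.Conn ω {x | -N ≤ x.1 ∧ x.1 ≤ N - 1} f f'}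

lemma LR_meas (B N : ℤ) : MeasurableSet (LR B N) := by
  have : LR B N = ⋃ u ∈ {u : ℤ × ℤ | u.1 ≤ -N}, ⋃ v ∈ {v : ℤ × ℤ | N ≤ v.1},
      {ω | plane.Conn ω {x | -B ≤ x.2 ∧ x.2 ≤ B} u v} := by
    ext ω; simp only [LR, mem_iUnion, mem_ofPred_eq]
    constructor
    · rintro ⟨u, v, hu, hv, h⟩; exact ⟨u, hu, v, hv, h⟩
    · rintro ⟨u, hu, v, hv, h⟩; exact ⟨u, v, hu, hv, h⟩
  rw [this]
  exact MeasurableSet.biUnion (to_countable _) fun u _ =>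
    MeasurableSet.biUnion (to_countable _) fun v _ => Gr.measurable_conn _ _ _

lemma TB_meas (B N : ℤ) : MeasurableSet (TB B N) := by
  have : TB B N = ⋃ u ∈ {u : ℤ × ℤ | u.2 < -B}, ⋃ v ∈ {v : ℤ × ℤ | B ≤ v.2},
      {ω | plane.Conn ω {x | -N ≤ x.1 ∧ x.1 ≤ N - 1} u v} := by
    ext ω; simp only [TB, mem_iUnion, mem_ofPred_eq]
    constructor
    · rintro ⟨u, v, hu, hv, h⟩; exact ⟨u, hu, v, hv, h⟩
    · rintro ⟨u, hu, v, hv, h⟩; exact ⟨u, v, hu, hv, h⟩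
  rw [this]
  exact MeasurableSet.biUnion (to_countable _) fun u _ =>
    MeasurableSet.biUnion (to_countable _) fun v _ => Gr.measurable_conn _ _ _

lemma LR_half {B N : ℤ} (hB : 0 ≤ B) (hN : B ≤ N - 1) : pr (fun _ => (1 / 2 : ℝ)) (LR B N) ≤ 1 / 2 := by
  have h1 : pr (fun _ => (1 / 2 : ℝ)) (LR B N) ≤ pr (fun _ => (1 / 2 : ℝ)) (TB B N) := by
    rw [← pr_pull (false, true) _ (LR_meas B N)]
    refine pr_mono _ ?_
    rintro ω ⟨u, v, hu, hv, hc⟩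
    refine ⟨symV (false, true) u, symV (false, true) v, ?_, ?_,
      Gr.Conn.hom (G := plane) (G' := plane) (symV (false, true)) (symE (false, true))
        (symE_ends (false, true)) ?_ hc⟩
    · simp [symV]; omega
    · simp [symV]; omega
    · intro x hx
      simp only [mem_ofPred_eq] at hx
      simp [symV]; omega
  have h2 : pr (fun _ => (1 / 2 : ℝ)) (TB B N) = pr (fun _ => (1 / 2 : ℝ)) {ω | dualC ω ∈ TB B N} := by
    rw [← pr_dual (p := 1 / 2) (by norm_num) (by norm_num) (TB_meas B N)]
    norm_num only
  have h3 : pr (fun _ => (1 / 2 : ℝ)) {ω | dualC ω ∈ TB B N} ≤ pr (fun _ => (1 / 2 : ℝ)) (LR B N)ᶜ := by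
    refine pr_mono _ ?_
    rintro ω ⟨f, f', hf, hf', hc'⟩ ⟨u, v, hu, hv, hc⟩
    exact dual_excl ω B N hc hu hv hc' hf hf' hB
  rw [pr_compl _ (LR_meas B N)] at h3
  linarith

/-! ### Sprinkling -/

/-- Marginals of the pair of configurations. -/
def Qs (p s : ℝ) : E2 × Bool → ℝ := fun e => if e.2 then s else p

/-- Union of the pair of configurations. -/
def orC (ω : E2 × Bool → Bool) : E2 → Bool := fun e => ω (e, false) || ω (e, true)

lemma pr_or {p s : ℝ} (hp0 : 0 ≤ p) (hp1 : p ≤ 1) (hs0 : 0 ≤ s) (hs1 : s ≤ 1)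
    {A : Set (E2 → Bool)} (hA : MeasurableSet A) :
    pr (fun _ => 1 - (1 - p) * (1 - s)) A = pr (Qs p s) {ω | orC ω ∈ A} := by
  have hset : ∀ e : E2, {ω : E2 × Bool → Bool | orC ω e = true} =
      ({ω | ω (e, false) = false} ∩ {ω | ω (e, true) = false})ᶜ := by
    intro e; ext ω
    simp only [orC, Bool.or_eq_true, mem_ofPred_eq, mem_compl_iff, mem_inter_iff]
    cases ω (e, false) <;> cases ω (e, true) <;> simp
  have hm : ∀ e : E2, MeasurableSet {ω : E2 × Bool → Bool | orC ω e = true} := by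
    intro e
    rw [hset e]
    exact ((measurableSet_coord _ _).inter (measurableSet_coord _ _)).compl
  have hmap := map_blocks (Qs p s) (fun e ω => orC ω e) (fun e => {(e, false)} ∪ {(e, true)}) hm
    (fun e => by
      rw [hset e]
      exact ((det_coord _ _).inter (det_coord _ _)).compl)
    (fun e e' hne => by
      show Disjoint _ _
      rw [Set.disjoint_left]
      rintro x (rfl | rfl) (h | h)
      all_goals
        have := congrArg Prod.fst h
        exact hne this)
    (fun _ => 1 - (1 - p) * (1 - s)) (fun _ => by nlinarith)
    (fun _ => by nlinarith)
    (fun e => by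
      rw [hset e, pr_compl _ ((measurableSet_coord _ _).inter (measurableSet_coord _ _)),
        pr_inter_of_det _ (det_coord _ _) (det_coord _ _) (by simp) (measurableSet_coord _ _)
          (measurableSet_coord _ _), pr_coord_false (by simpa [Qs]) (by simpa [Qs]),
        pr_coord_false (by simpa [Qs]) (by simpa [Qs])]
      simp [Qs])
  refine pr_map ?_ hmap hA
  refine measurable_pi_lambda _ fun e => ?_
  exact measurable_to_bool (hm e)

lemma first_success {E : Type*} (P : E → ℝ) (K : ℕ) (D H : ℕ → Set (E → Bool)) {I J : Set E}
    (hD : ∀ i, Det I (D i)) (hH : ∀ i, Det J (H i)) (hIJ : Disjoint I J)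
    (mD : ∀ i, MeasurableSet (D i)) (mH : ∀ i, MeasurableSet (H i)) {a : ℝ} (ha : ∀ i, a ≤ pr P (H i)) :
    a * pr P (⋃ i ∈ Finset.range K, D i) ≤ pr P (⋃ i ∈ Finset.range K, D i ∩ H i) := by
  induction K with
  | zero => simp [pr_empty]
  | succ K ih =>
    set U := ⋃ i ∈ Finset.range K, D i with hU
    set W := ⋃ i ∈ Finset.range K, D i ∩ H i with hW
    have mU : MeasurableSet U := Finset.measurableSet_biUnion _ fun i _ => mD i
    have dU : Det I U := by
      refine Det.iUnion fun i => ?_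
      by_cases hi : i ∈ Finset.range K
      · simpa only [hi, iUnion_true] using hD i
      · simp only [hi, iUnion_of_empty]
        intro _ _ _ h; exact h
    have hWU : W ⊆ U := iUnion₂_mono fun i _ => inter_subset_left
    have dG : Det I (D K ∩ Uᶜ) := by simpa using (hD K).inter dU.compl
    have mG : MeasurableSet (D K ∩ Uᶜ) := (mD K).inter mU.compl
    have e1 : ⋃ i ∈ Finset.range (K + 1), D i = U ∪ (D K ∩ Uᶜ) := by
      rw [Finset.range_add_one, Finset.set_biUnion_insert]
      ext ω; simp only [mem_union, mem_inter_iff, mem_compl_iff, ← hU]; tauto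
    have e2 : W ∪ ((D K ∩ Uᶜ) ∩ H K) ⊆ ⋃ i ∈ Finset.range (K + 1), D i ∩ H i := by
      rw [Finset.range_add_one, Finset.set_biUnion_insert]
      rintro ω (h | ⟨⟨h1, _⟩, h2⟩)
      · exact Or.inr h
      · exact Or.inl ⟨h1, h2⟩
    rw [e1, pr_union P (by rw [Set.disjoint_left]; rintro ω h1 ⟨_, h2⟩; exact h2 h1) mG]
    refine le_trans ?_ (pr_mono P e2)
    rw [pr_union P (by rw [Set.disjoint_left]; rintro ω h1 ⟨⟨_, h2⟩, _⟩; exact h2 (hWU h1)) (mG.inter (mH K)),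
      pr_inter_of_det P dG (hH K) hIJ mG (mH K), mul_add]
    have := mul_le_mul_of_nonneg_left (ha K) (pr_nonneg P (D K ∩ Uᶜ))
    linarith

lemma box_conn {ω : E2 → Bool} {m : ℕ} (h : ∀ e ∈ F2 m, ω e = true) {u : ℤ × ℤ} (hu : u ∈ Bx m) :
    plane.Conn ω (Bx m) u 0 := by
  suffices H : ∀ k : ℕ, ∀ u : ℤ × ℤ, u ∈ Bx m → u.1.natAbs + u.2.natAbs = k →
      plane.Conn ω (Bx m) u 0 from H _ u hu rfl
  intro k
  induction k with
  | zero =>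
    rintro ⟨x, y⟩ _ hk
    simp at hk
    obtain ⟨rfl, rfl⟩ := hk
    exact .refl _
  | succ k ih =>
    rintro ⟨x, y⟩ hu hk
    have key : ∀ (u' : ℤ × ℤ) (e : E2), u' ∈ Bx m → u'.1.natAbs + u'.2.natAbs = k → e ∈ F2 m →
        plane.Ends e (x, y) u' → plane.Conn ω (Bx m) (x, y) 0 := by
      intro u' e h1 h2 h3 h4
      exact (Gr.Conn.single hu h1 (h4.adj (h e h3))).trans (ih u' h1 h2)
    simp only [Bx, mem_ofPred_eq, abs_le] at hu
    simp only at hk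
    rcases lt_trichotomy x 0 with hx | hx | hx
    · refine key (x + 1, y) ((x, y), false) ?_ ?_ ?_ ?_
      · simp only [Bx, mem_ofPred_eq, abs_le]; omega
      · simp only; omega
      · simp [F2]; omega
      · left; simp
    · rcases lt_trichotomy y 0 with hy | hy | hy
      · refine key (x, y + 1) ((x, y), true) ?_ ?_ ?_ ?_
        · simp only [Bx, mem_ofPred_eq, abs_le]; omega
        · simp only; omega
        · simp [F2]; omega
        · left; simp
      · omega
      · refine key (x, y - 1) ((x, y - 1), true) ?_ ?_ ?_ ?_
        · simp only [Bx, mem_ofPred_eq, abs_le]; omega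
        · simp only; omega
        · simp [F2]; omega
        · right; simp
    · refine key (x - 1, y) ((x - 1, y), false) ?_ ?_ ?_ ?_
      · simp only [Bx, mem_ofPred_eq, abs_le]; omega
      · simp only; omega
      · simp [F2]; omega
      · right; simp

/-- Horizontal strip. -/
def strip (B : ℤ) : Set (ℤ × ℤ) := {x | -B ≤ x.2 ∧ x.2 ≤ B}

lemma exR_path {m n J : ℕ} {ω : E2 → Bool} (h : ω ∈ exR m n J) :
    ∃ u ∈ Bx m, ∃ v : ℤ × ℤ, v.1 = n + J ∧ plane.Conn ω (strip n) u v := by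
  simp only [exR, mem_iUnion, Finset.mem_Icc] at h
  obtain ⟨y, hy, ⟨u, hu, hc⟩, hl⟩ := h
  rw [ln_mem] at hl
  refine ⟨u, hu, ((n : ℤ) + J, y), rfl, ?_⟩
  have h0 : plane.Conn ω (strip n) u ((n : ℤ), y) :=
    hc.mono (fun x hx => abs_le.1 hx.2) fun _ h => h
  have : ∀ t : ℕ, t ≤ J → plane.Conn ω (strip n) u ((n : ℤ) + t, y) := by
    intro t
    induction t with
    | zero => intro _; simpa using h0
    | succ t ih =>
      intro ht
      refine (ih (by omega)).tail hy hy ?_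
      have := Gr.adj_edge (G := plane) (hl t ht)
      simpa [add_assoc] using this
  exact this J le_rfl

lemma no_perc {p c : ℝ} (hp0 : 0 < p) (hp1 : p < 1 / 2) (hc0 : 0 < c) (hc : ∀ n, c ≤ tp n p) : False := by
  obtain ⟨s, hs⟩ : ∃ s, s = 1 - (1 / 2) / (1 - p) := ⟨_, rfl⟩
  have h1p : 0 < 1 - p := by linarith
  have hs0 : 0 < s := by
    have : (1 / 2) / (1 - p) < 1 := by rw [div_lt_one h1p]; linarith
    linarith
  have hs1 : s ≤ 1 := by
    have : 0 < (1 / 2) / (1 - p) := by positivity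
    linarith
  have hps : 1 - (1 - p) * (1 - s) = 1 / 2 := by
    rw [hs]; field_simp; ring
  obtain ⟨m, hm⟩ := exR_prob hp0 (by linarith) hc0 hc (show (0 : ℝ) < 1 / 10 by norm_num)
  set cm := s ^ (F2 m).card with hcm
  have hcm0 : 0 < cm := by positivity
  have hcm1 : cm ≤ 1 := pow_le_one₀ hs0.le hs1
  obtain ⟨K, hK⟩ := exists_pow_lt_of_lt_one (show (0 : ℝ) < 1 / 10 by norm_num) (show 1 - cm < 1 by linarith)
  set W := K * (2 * m + 1) with hW
  obtain ⟨n, hn⟩ := hm (W + 1) (by omega)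
  set J := W + 1 with hJ
  let H0 : Set (E2 → Bool) := exR m n J ∩ pull (true, false) (exR m n J)
  have mH0 : MeasurableSet H0 := (exR_meas _ _ _).inter (measurableSet_pull _ (exR_meas _ _ _))
  have pH0 : 8 / 10 ≤ pr (fun _ => p) H0 := by
    have h1 : pr (fun _ => p) H0ᶜ ≤ pr (fun _ => p) (exR m n J)ᶜ + pr (fun _ => p) (pull (true, false) (exR m n J))ᶜ := by
      rw [compl_inter]; exact pr_union_le _ _ _
    rw [pr_compl _ mH0, pr_compl _ (exR_meas _ _ _), pr_compl _ (measurableSet_pull _ (exR_meas _ _ _)),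
      pr_pull _ _ (exR_meas _ _ _)] at h1
    linarith
  let z : ℕ → ℤ × ℤ := fun i => (0, (i : ℤ) * (2 * m + 1))
  let D : ℕ → Set (E2 × Bool → Bool) := fun i => ⋂ e ∈ F2 m, {ω | ω (shE (z i) e, true) = true}
  let H : ℕ → Set (E2 × Bool → Bool) := fun i => {ω | (fun e => ω (shE (z i) e, false)) ∈ H0}
  have mD : ∀ i, MeasurableSet (D i) := fun i => Finset.measurableSet_biInter _ fun _ _ => measurableSet_coord _ _
  have memD : ∀ i ω, ω ∈ D i ↔ ∀ e ∈ F2 m, ω (shE (z i) e, true) = true := by intro i ω; simp [D]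
  have hinjt : ∀ i, Function.Injective (fun e : E2 => ((shE (z i) e, false) : E2 × Bool)) := by
    intro i a b h
    exact shE_inj _ (congrArg Prod.fst h)
  have mH : ∀ i, MeasurableSet (H i) := fun i =>
    (measurable_pi_lambda (fun ω : E2 × Bool → Bool => fun e => ω (shE (z i) e, false))
      fun e => measurable_pi_apply _) mH0
  have pH : ∀ i, 8 / 10 ≤ pr (Qs p s) (H i) := by
    intro i
    have := pr_reindex (Qs p s) (fun e : E2 => ((shE (z i) e, false) : E2 × Bool)) (hinjt i) mH0
    rw [← show pr (fun _ => p) H0 = pr (Qs p s) (H i) from this]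
    exact pH0
  have dD : ∀ i, Det {e | ∃ e' ∈ F2 m, e = ((shE (z i) e', true) : E2 × Bool)} (D i) := by
    intro i ω ω' hw h
    rw [memD] at *
    intro e he
    rw [← hw _ ⟨e, he, rfl⟩]
    exact h e he
  have pD : ∀ i, pr (Qs p s) (D i) = cm := by
    intro i
    have := indep_family (Qs p s) (F2 m) (fun e => {((shE (z i) e, true) : E2 × Bool)})
      (fun e => {ω | ω (shE (z i) e, true) = true}) (fun e => det_coord _ _) (fun e => measurableSet_coord _ _)
      (fun a _ b _ hne => by
        rw [Set.disjoint_singleton]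
        intro h; exact hne (shE_inj _ (congrArg Prod.fst h)))
    rw [show pr (Qs p s) (D i) = _ from this,
      Finset.prod_congr rfl fun e _ => pr_coord_true (P := Qs p s) (by simpa [Qs] using hs0.le) (by simpa [Qs] using hs1)]
    simp [Qs, hcm]
  have pU : 9 / 10 ≤ pr (Qs p s) (⋃ i ∈ Finset.range K, D i) := by
    have h1 := indep_family (Qs p s) (Finset.range K) _ (fun i => (D i)ᶜ) (fun i => (dD i).compl)
      (fun i => (mD i).compl) (fun i _ j _ hne => by
        rw [Set.disjoint_left]
        rintro _ ⟨⟨⟨x, y⟩, b⟩, he, rfl⟩ ⟨⟨⟨x', y'⟩, b'⟩, he', h⟩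
        have h2 := congrArg (fun e => e.1.1.2) h
        simp only [F2, Finset.mem_product, Finset.mem_Icc] at he he'
        simp only [shE, z, Prod.snd_add] at h2
        have hij : (i : ℤ) * (2 * m + 1) + (2 * m + 1) ≤ j * (2 * m + 1) ∨
            (j : ℤ) * (2 * m + 1) + (2 * m + 1) ≤ i * (2 * m + 1) := by
          rcases lt_or_gt_of_ne hne with h | h
          · left
            have : (i : ℤ) + 1 ≤ j := by exact_mod_cast h
            nlinarith
          · right
            have : (j : ℤ) + 1 ≤ i := by exact_mod_cast h
            nlinarith
        omega)
    rw [Finset.prod_congr rfl fun i _ => by rw [pr_compl _ (mD i), pD i]] at h1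
    simp only [Finset.prod_const, Finset.card_range] at h1
    have h2 : (⋃ i ∈ Finset.range K, D i)ᶜ = ⋂ i ∈ Finset.range K, (D i)ᶜ := by simp
    have h3 := pr_compl (Qs p s) (A := ⋃ i ∈ Finset.range K, D i)
      (Finset.measurableSet_biUnion _ fun i _ => mD i)
    rw [h2, h1] at h3
    linarith
  have hfs := first_success (Qs p s) K D H (I := {e | e.2 = true}) (J := {e | e.2 = false})
    (fun i => (dD i).mono (by rintro _ ⟨e, _, rfl⟩; rfl))
    (fun i ω ω' hw h => by
      have : (fun e => ω (shE (z i) e, false)) = (fun e => ω' (shE (z i) e, false)) := by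
        funext e; exact hw _ rfl
      show (fun e => ω' (shE (z i) e, false)) ∈ H0
      rw [← this]; exact h)
    (by rw [Set.disjoint_left]; intro e h1 h2
        simp only [mem_ofPred_eq] at h1 h2
        rw [h1] at h2; cases h2)
    mD mH pH
  have hsub : (⋃ i ∈ Finset.range K, D i ∩ H i) ⊆ {ω | orC ω ∈ LR ((n : ℤ) + W) ((n : ℤ) + J)} := by
    intro ω hω
    simp only [mem_iUnion, Finset.mem_range] at hω
    obtain ⟨i, hi, hDi, hHi1, hHi2⟩ := hω
    rw [memD] at hDi
    have hz1 : (i : ℤ) * (2 * m + 1) + (2 * m + 1) ≤ W := by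
      rw [hW]; push_cast
      have : (i : ℤ) + 1 ≤ K := by exact_mod_cast hi
      nlinarith
    have hz0 : 0 ≤ (i : ℤ) * (2 * m + 1) := by positivity
    obtain ⟨u, hu, v, hv, huv⟩ := exR_path hHi1
    obtain ⟨u', hu', v', hv', huv'⟩ := exR_path (show (fun e => (fun e => ω (shE (z i) e, false)) (symE (true, false) e)) ∈ exR m n J from hHi2)
    have huv2 := Gr.Conn.hom (G := plane) (G' := plane) (symV (true, false)) (symE (true, false))
      (symE_ends (true, false)) (ω := fun e => ω (shE (z i) e, false)) (U := strip n) (U' := strip n) (fun x hx => by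
        show -(n : ℤ) ≤ x.2 ∧ x.2 ≤ n
        exact hx) huv'
    have up : ∀ {x y}, plane.Conn (fun e => ω (shE (z i) e, false)) (strip n) x y →
        plane.Conn (orC ω) (strip ((n : ℤ) + W)) (x + z i) (y + z i) := by
      intro x y h
      refine (Gr.Conn.hom (G := plane) (G' := plane) (fun x => x + z i) (shE (z i)) (shE_ends (z i))
        (U' := strip ((n : ℤ) + W)) ?_ (ω := fun e => ω (e, false)) h).mono subset_rfl
        (fun e he => by simp only [orC, he, Bool.true_or])
      intro x hx
      simp only [strip, z, mem_ofPred_eq, Prod.snd_add] at hx ⊢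
      omega
    have hbox : plane.Conn (fun e => ω (shE (z i) e, true)) (Bx m) u (symV (true, false) u') :=
      (box_conn hDi hu).trans (box_conn hDi (symV_Bx _ hu')).symm
    have hbox2 : plane.Conn (orC ω) (strip ((n : ℤ) + W)) (u + z i) (symV (true, false) u' + z i) := by
      refine (Gr.Conn.hom (G := plane) (G' := plane) (fun x => x + z i) (shE (z i)) (shE_ends (z i))
        (U' := strip ((n : ℤ) + W)) ?_ (ω := fun e => ω (e, true)) hbox).mono subset_rfl
        (fun e he => by simp only [orC, he, Bool.or_true])
      intro x hx
      simp only [Bx, strip, z, mem_ofPred_eq, Prod.snd_add, abs_le] at hx ⊢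
      omega
    refine ⟨symV (true, false) v' + z i, v + z i, ?_, ?_, ((up huv2).symm.trans hbox2.symm).trans (up huv)⟩
    · simp [symV, z, hv']
    · simp [z, hv]
  have h1 := pr_mono (Qs p s) hsub
  rw [← pr_or hp0.le (by linarith) hs0.le hs1 (LR_meas _ _), hps] at h1
  have h2 := LR_half (B := (n : ℤ) + W) (N := (n : ℤ) + J) (by positivity) (by rw [hJ]; push_cast; omega)
  nlinarith

/-- Below one half, some finite set has small boundary sum. -/
lemma phi_small {p : ℝ} (hp0 : 0 < p) (hp1 : p < 1 / 2) :
    ∃ n : ℕ, ∃ S ⊆ R2 n, (0 : ℤ × ℤ) ∈ S ∧ ∑ d ∈ plane.outD (F2 n) S,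
      pr (fun _ => p) {ω | plane.Conn ω S 0 (plane.tl d)} < 1 := by
  by_contra hcon
  push Not at hcon
  have h := fun {n : ℕ} (hn : 1 ≤ n) => tp_lower_of (p := p) (p1 := (p + 1 / 2) / 2) hp0 (by linarith) (by linarith) hcon hn
  refine no_perc (p := (p + 1 / 2) / 2) (c := 1 - Real.exp (-((p + 1 / 2) / 2 - p))) (by linarith) (by linarith) ?_ ?_
  · have : Real.exp (-((p + 1 / 2) / 2 - p)) < 1 := Real.exp_lt_one_iff.2 (by linarith)
    linarith
  · intro n
    rcases Nat.eq_zero_or_pos n with rfl | hn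
    · exact (h le_rfl).trans (tp_anti (by norm_num) _)
    · exact h hn
end

section
open ProbabilityTheory Relation

/-! ### Small vertical density: no percolation -/

/-- Lift of a planar vertex to height `j`. -/
def lf (j : ℤ) (x : ℤ × ℤ) : Vtx := (x.1, x.2, j)

/-- Lift of a planar edge to height `j`. -/
def lfE (j : ℤ) (e : E2) : EdgeIdx := (lf j e.1, if e.2 then 1 else 0)

/-- Lift of a planar dart to height `j`. -/
def lfD (j : ℤ) (d : E2 × Bool) : EdgeIdx × Bool := (lfE j d.1, d.2)

lemma lf_inj (j : ℤ) : Function.Injective (lf j) := by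
  rintro ⟨x, y⟩ ⟨x', y'⟩ h
  simpa [lf] using h

lemma lfE_inj (j : ℤ) : Function.Injective (lfE j) := by
  rintro ⟨x, b⟩ ⟨x', b'⟩ h
  simp only [lfE, Prod.mk.injEq] at h
  have := lf_inj j h.1
  cases b <;> cases b' <;> simp_all

lemma lfD_inj (j : ℤ) : Function.Injective (lfD j) := by
  rintro ⟨x, b⟩ ⟨x', b'⟩ h
  simp only [lfD, Prod.mk.injEq] at h
  exact Prod.ext (lfE_inj j h.1) h.2

lemma sp_lfE (p q : ℝ) (j : ℤ) (e : E2) : sp p q (lfE j e) = p := by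
  obtain ⟨x, b⟩ := e
  cases b <;> simp [sp, lfE]

lemma lfE_edge {k : ℕ} {j : ℤ} (h : 0 ≤ j ∧ j ≤ k) (e : E2) : IsEdge k (lfE j e) := by
  obtain ⟨x, b⟩ := e
  cases b <;> simpa [IsEdge, InSlab, lfE, lf, dvec] using h

lemma lfE_s (k : ℕ) (j : ℤ) (e : E2) : (slabG k).s (lfE j e) = lf j (plane.s e) := rfl

lemma lfE_t {k : ℕ} {j : ℤ} (h : 0 ≤ j ∧ j ≤ k) (e : E2) :
    (slabG k).t (lfE j e) = lf j (plane.t e) := by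
  rw [slab_t k (lfE_edge h e)]
  obtain ⟨x, b⟩ := e
  cases b <;> simp [lfE, lf, dvec]

lemma lfD_tl {k : ℕ} {j : ℤ} (h : 0 ≤ j ∧ j ≤ k) (d : E2 × Bool) :
    (slabG k).tl (lfD j d) = lf j (plane.tl d) := by
  obtain ⟨e, b⟩ := d
  cases b
  · exact lfE_t h e
  · exact lfE_s k j e

lemma lfD_hd {k : ℕ} {j : ℤ} (h : 0 ≤ j ∧ j ≤ k) (d : E2 × Bool) :
    (slabG k).hd (lfD j d) = lf j (plane.hd d) := by
  obtain ⟨e, b⟩ := d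
  cases b
  · exact lfE_s k j e
  · exact lfE_t h e

/-- An edge with distinct endpoints is horizontal or vertical. -/
lemma edge_cases {k : ℕ} (e : EdgeIdx) (h : IsEdge k e) :
    (∃ f : E2, e = lfE e.1.2.2 f) ∨ e.2 = 2 := by
  obtain ⟨⟨x, y, z⟩, i⟩ := e
  fin_cases i
  · left; exact ⟨((x, y), false), by simp [lfE, lf]⟩
  · left; exact ⟨((x, y), true), by simp [lfE, lf]⟩
  · right; rfl

/-- Projection. -/
def pj (v : Vtx) : ℤ × ℤ := (v.1, v.2.1)

lemma pj_lf (j : ℤ) (x : ℤ × ℤ) : pj (lf j x) = x := rfl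

lemma conn_layer {k : ℕ} {j : ℤ} {S : Finset (ℤ × ℤ)} {ω : Config} {x y : Vtx}
    (h : (slabG k).Conn ω (S.image (lf j) : Finset Vtx) x y) :
    plane.Conn (fun e => ω (lfE j e)) S (pj x) (pj y) := by
  induction h with
  | refl => exact .refl _
  | tail _ h ih =>
    obtain ⟨ha, hb, hadj⟩ := h
    refine ih.trans ?_
    obtain ⟨e, he, h⟩ := Gr.adj_iff.1 hadj
    have key : plane.Conn (fun e => ω (lfE j e)) S (pj ((slabG k).s e)) (pj ((slabG k).t e)) := by
      have hs : (slabG k).s e ∈ S.image (lf j) := by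
        rcases h with ⟨h1, h2⟩ | ⟨h1, h2⟩
        · rw [h1]; exact ha
        · rw [h2]; exact hb
      have ht : (slabG k).t e ∈ S.image (lf j) := by
        rcases h with ⟨h1, h2⟩ | ⟨h1, h2⟩
        · rw [h2]; exact hb
        · rw [h1]; exact ha
      by_cases hE : IsEdge k e
      · rcases edge_cases e hE with ⟨f, hf⟩ | h2
        · obtain ⟨s, hsS, hs'⟩ := Finset.mem_image.1 hs
          have hz : e.1.2.2 = j := by
            rw [slab_s] at hs'; rw [← hs']; rfl
          rw [hz] at hf
          have hj : 0 ≤ j ∧ j ≤ k := hz ▸ hE.1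
          subst hf
          rw [lfE_s, lfE_t hj, pj_lf, pj_lf]
          rw [lfE_s] at hs
          rw [lfE_t hj] at ht
          refine .single ?_ ?_ (Gr.adj_edge he)
          · simpa [(lf_inj j).eq_iff] using hs
          · simpa [(lf_inj j).eq_iff] using ht
        · rw [slab_t k hE, slab_s, h2]
          have : pj (e.1 + dvec 2) = pj e.1 := by simp [pj, dvec]
          rw [this]
          exact .refl _
      · rw [slab_t' k hE, slab_s]
        exact .refl _
    rcases h with ⟨rfl, rfl⟩ | ⟨rfl, rfl⟩
    · exact key
    · exact key.symm

lemma pr_conn_layer (k : ℕ) (p q : ℝ) (j : ℤ) (S : Finset (ℤ × ℤ)) (x y : ℤ × ℤ) :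
    pr (sp p q) {ω | (slabG k).Conn ω (S.image (lf j) : Finset Vtx) (lf j x) (lf j y)} ≤
      pr (fun _ => p) {ω | plane.Conn ω S x y} := by
  have h := pr_reindex (sp p q) (lfE j) (lfE_inj j) (A := {ω | plane.Conn ω S x y})
    (Gr.measurable_conn _ _ _)
  simp only [sp_lfE] at h
  rw [h]
  refine pr_mono _ ?_
  intro ω hω
  exact conn_layer hω

/-- Horizontal shift in the slab. -/
def shS (u : ℤ × ℤ) (e : EdgeIdx) : EdgeIdx := (e.1 + lf 0 u, e.2)

lemma shS_inj (u : ℤ × ℤ) : Function.Injective (shS u) := by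
  intro a b h
  simp only [shS, Prod.mk.injEq, add_left_inj] at h
  exact Prod.ext h.1 h.2

lemma shS_edge (k : ℕ) (u : ℤ × ℤ) (e : EdgeIdx) : IsEdge k (shS u e) ↔ IsEdge k e := by
  simp [IsEdge, InSlab, shS, lf]

lemma shS_ends (k : ℕ) (u : ℤ × ℤ) (e : EdgeIdx) :
    (slabG k).Ends (shS u e) ((slabG k).s e + lf 0 u) ((slabG k).t e + lf 0 u) := by
  left
  refine ⟨rfl, ?_⟩
  by_cases h : IsEdge k e
  · rw [slab_t k h, slab_t k ((shS_edge k u e).2 h)]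
    simp only [shS]; abel
  · rw [slab_t' k h, slab_t' k (fun h' => h ((shS_edge k u e).1 h'))]
    rfl

/-- Arm probability from the vertex at height `j` above the origin. -/
noncomputable def tj (k n : ℕ) (p q : ℝ) (j : ℤ) : ℝ :=
  pr (sp p q) {ω | (slabG k).Hit ω univ (lf j 0) (slabT k n)}

lemma tj_shift (k N n : ℕ) (p q : ℝ) (v : Vtx) (hv1 : |v.1| ≤ n) (hv2 : |v.2.1| ≤ n) :
    pr (sp p q) {ω | (slabG k).Hit ω univ v (slabT k (N + n))} ≤ tj k N p q v.2.2 := by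
  have := Gr.pr_hit_hom (G := slabG k) (G' := slabG k) (fun x => x + lf 0 (-pj v)) (shS (-pj v))
    (shS_inj _) (shS_ends k (-pj v)) (U := univ) (U' := univ) (T := slabT k (N + n))
    (T' := slabT k N) (fun _ _ => trivial)
    (fun x hx => by
      obtain ⟨x1, x2, x3⟩ := x
      obtain ⟨v1, v2, v3⟩ := v
      simp only [slabT, InSlab, mem_ofPred_eq, lf, pj, Prod.neg_mk, Prod.mk_add_mk, abs_lt, abs_le] at *
      push_cast at hx
      omega) v (sp p q)
  have h2 : v + lf 0 (-pj v) = lf v.2.2 0 := by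
    obtain ⟨v1, v2, v3⟩ := v
    simp [lf, pj]
  rw [h2] at this
  exact this

lemma sum_union_le {α : Type*} [DecidableEq α] (A B : Finset α) (f : α → ℝ) (hf : ∀ x, 0 ≤ f x) :
    ∑ x ∈ A ∪ B, f x ≤ ∑ x ∈ A, f x + ∑ x ∈ B, f x := by
  rw [← Finset.sum_union_inter]
  linarith [Finset.sum_nonneg (s := A ∩ B) (f := f) (fun x _ => hf x)]

lemma sum_image_le' {α β : Type*} [DecidableEq α] (A : Finset β) (g : β → α)
    (hg : Function.Injective g) (f : α → ℝ) :
    ∑ x ∈ A.image g, f x = ∑ x ∈ A, f (g x) := Finset.sum_image fun _ _ _ _ h => hg h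

/-- Upward dart. -/
def upD (j : ℤ) (x : ℤ × ℤ) : EdgeIdx × Bool := ((lf j x, 2), true)
/-- Downward dart. -/
def dnD (j : ℤ) (x : ℤ × ℤ) : EdgeIdx × Bool := ((lf (j - 1) x, 2), false)

lemma upD_inj (j : ℤ) : Function.Injective (upD j) := fun x y h => by
  simp only [upD, Prod.mk.injEq, and_true] at h
  exact lf_inj _ h
lemma dnD_inj (j : ℤ) : Function.Injective (dnD j) := fun x y h => by
  simp only [dnD, Prod.mk.injEq, and_true] at h
  exact lf_inj _ h

/-- Every dart leaving a layer set is of one of three kinds. -/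
lemma layer_darts {k : ℕ} {j : ℤ} {n : ℕ} {S : Finset (ℤ × ℤ)} (hS : S ⊆ R2 n)
    (d : EdgeIdx × Bool) (h1 : (slabG k).tl d ∈ S.image (lf j)) (h2 : (slabG k).hd d ∉ S.image (lf j)) :
    d ∈ ((plane.outD (F2 n) S).image (lfD j) ∪ (S.image (upD j) ∪ S.image (dnD j))) := by
  obtain ⟨e, s⟩ := d
  by_cases hE : IsEdge k e
  swap
  · exfalso
    refine h2 ?_
    rcases Gr.tl_hd (G := slabG k) (e, s) with ⟨a, b⟩ | ⟨a, b⟩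
    · rw [b, slab_t' k hE]; rw [a, slab_s] at h1; exact h1
    · rw [b, slab_s]; rw [a, slab_t' k hE] at h1; exact h1
  · rcases edge_cases e hE with ⟨f, hf⟩ | hv
    · have hd := hE.1
      have h0 : ((e, s) : EdgeIdx × Bool) = lfD e.1.2.2 (f, s) := by rw [lfD, ← hf]
      have hz : e.1.2.2 = j := by
        rw [h0, lfD_tl hd] at h1
        obtain ⟨x, _, hx⟩ := Finset.mem_image.1 h1
        have := congrArg (fun v : Vtx => v.2.2) hx
        simp only [lf] at this
        exact this.symm
      rw [hz] at h0
      have hj : 0 ≤ j ∧ j ≤ k := hz ▸ hE.1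
      rw [h0] at h1 h2 ⊢
      rw [lfD_tl hj] at h1
      rw [lfD_hd hj] at h2
      refine Finset.mem_union_left _ (Finset.mem_image_of_mem _ (outD_spec hS _ ?_ ?_))
      · simpa [(lf_inj j).eq_iff] using h1
      · simpa [(lf_inj j).eq_iff] using h2
    · refine Finset.mem_union_right _ ?_
      obtain ⟨v, i⟩ := e
      obtain ⟨x, y, z⟩ := v
      simp only at hv
      subst hv
      cases s
      · refine Finset.mem_union_right _ ?_
        simp only [Gr.tl, slab_t k hE, Bool.false_eq_true, if_false, Finset.mem_image] at h1
        obtain ⟨w, hw, hw'⟩ := h1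
        simp only [lf, dvec, Prod.mk_add_mk, Prod.mk.injEq, add_zero] at hw'
        refine Finset.mem_image.2 ⟨w, hw, ?_⟩
        simp only [dnD, lf, Prod.mk.injEq, and_true]
        refine ⟨hw'.1, hw'.2.1, by omega⟩
      · refine Finset.mem_union_left _ ?_
        simp only [Gr.tl, slab_s, if_true, Finset.mem_image] at h1
        obtain ⟨w, hw, hw'⟩ := h1
        exact Finset.mem_image.2 ⟨w, hw, by simp [upD, hw']⟩

lemma slab_step {k n : ℕ} {p q c : ℝ} (hp : 0 ≤ p ∧ p ≤ 1) (hq : 0 ≤ q ∧ q ≤ 1)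
    {S : Finset (ℤ × ℤ)} (hS : S ⊆ R2 n) (h0 : (0 : ℤ × ℤ) ∈ S)
    (hc : ∑ d ∈ plane.outD (F2 n) S, pr (fun _ => p) {ω | plane.Conn ω S 0 (plane.tl d)} ≤ c)
    (N : ℕ) {M : ℝ} (hM0 : 0 ≤ M) (hM : ∀ j : ℤ, 0 ≤ j → j ≤ k → tj k N p q j ≤ M)
    (j : ℤ) (hj : 0 ≤ j ∧ j ≤ k) :
    tj k (N + n) p q j ≤ (c + 2 * S.card * q) * M := by
  classical
  have hb := fun e => sp_bounds (l := 0) (u := 1) (p := p) (q := q) ⟨hp, hq⟩ e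
  set S' : Finset Vtx := S.image (lf j) with hS'
  set D := ((plane.outD (F2 n) S).image (lfD j) ∪ (S.image (upD j) ∪ S.image (dnD j))) with hD
  -- every head has small continuation probability
  have bnd : ∀ d : EdgeIdx × Bool, (slabG k).tl d ∈ S' → (slabG k).hd d ∉ S' →
      pr (sp p q) {ω | (slabG k).Hit ω univ ((slabG k).hd d) (slabT k (N + n))} ≤ M := by
    intro d h1 h2
    have hin : ∀ x ∈ S, |x.1| + 1 ≤ (n : ℤ) ∧ |x.2| + 1 ≤ (n : ℤ) := by
      intro x hx
      have := (R2_iff n x).1 (hS hx)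
      simp only [T2, mem_ofPred_eq, not_not] at this
      exact ⟨by omega, by omega⟩
    obtain ⟨x, hx, hx'⟩ := Finset.mem_image.1 h1
    obtain ⟨hx1, hx2⟩ := hin x hx
    obtain ⟨x1, x2⟩ := x
    dsimp only at hx1 hx2
    have hE : IsEdge k d.1 := by
      by_contra hE
      rcases Gr.tl_hd (G := slabG k) d with ⟨a, b⟩ | ⟨a, b⟩
      · rw [b, slab_t' k hE] at h2; rw [a, slab_s] at h1; exact h2 h1
      · rw [b, slab_s] at h2; rw [a, slab_t' k hE] at h1; exact h2 h1
    have hhd : |((slabG k).hd d).1| ≤ n ∧ |((slabG k).hd d).2.1| ≤ n ∧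
        0 ≤ ((slabG k).hd d).2.2 ∧ ((slabG k).hd d).2.2 ≤ k := by
      have hA := hE.1
      have hB := hE.2
      rcases Gr.tl_hd (G := slabG k) d with ⟨a, b⟩ | ⟨a, b⟩
      · rw [b, slab_t k hE]
        rw [a, slab_s] at hx'
        rw [← hx'] at hB ⊢
        refine ⟨?_, ?_, hB⟩ <;>
        · generalize d.1.2 = i
          have := abs_le.1 (show |x1| ≤ (n : ℤ) - 1 by omega)
          have := abs_le.1 (show |x2| ≤ (n : ℤ) - 1 by omega)
          rw [abs_le]
          fin_cases i <;> simp [lf, dvec] <;> omega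
      · rw [b, slab_s]
        rw [a, slab_t k hE] at hx'
        have hx3 : d.1.1 = lf j (x1, x2) - dvec d.1.2 := by rw [hx']; abel
        rw [hx3] at hA ⊢
        refine ⟨?_, ?_, hA⟩ <;>
        · generalize d.1.2 = i
          have := abs_le.1 (show |x1| ≤ (n : ℤ) - 1 by omega)
          have := abs_le.1 (show |x2| ≤ (n : ℤ) - 1 by omega)
          rw [abs_le]
          fin_cases i <;> simp [lf, dvec] <;> omega
    exact (tj_shift k N n p q _ hhd.1 hhd.2.1).trans (hM _ hhd.2.2.1 hhd.2.2.2)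
  have hsim := Gr.simon (G := slabG k) (sp p q) (fun e => (hb e).1) (fun e => (hb e).2) S'
    (o := lf j 0) (Finset.mem_image_of_mem _ h0) (slabT k (N + n))
    (fun x hx hxT => by
      obtain ⟨y, hy, rfl⟩ := Finset.mem_image.1 hx
      have := (R2_iff n y).1 (hS hy)
      simp only [T2, mem_ofPred_eq, not_not] at this
      refine hxT ⟨hj, ?_, ?_⟩
      · have := this.1; simp only [lf]; push_cast; omega
      · have := this.2; simp only [lf]; push_cast; omega)
    (D.filter fun d => (slabG k).tl d ∈ S' ∧ (slabG k).hd d ∉ S')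
    (fun d h1 h2 => Finset.mem_filter.2 ⟨layer_darts hS d h1 h2, h1, h2⟩)
  refine hsim.trans ?_
  set f : EdgeIdx × Bool → ℝ := fun d =>
    pr (sp p q) {ω | (slabG k).Conn ω S' (lf j 0) ((slabG k).tl d)} * sp p q d.1 with hf
  have hf0 : ∀ d, 0 ≤ f d := fun d => mul_nonneg (pr_nonneg _ _) (hb d.1).1
  have s1 : ∑ d ∈ D, f d ≤ c + 2 * S.card * q := by
    refine (sum_union_le _ _ _ hf0).trans ?_
    have e1 : ∑ d ∈ (plane.outD (F2 n) S).image (lfD j), f d ≤ c := by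
      rw [sum_image_le' _ _ (lfD_inj j)]
      refine le_trans (Finset.sum_le_sum fun d _ => ?_) hc
      simp only [hf, lfD_tl hj]
      have h3 : sp p q (lfD j d).1 = p := sp_lfE p q j d.1
      rw [h3]
      refine le_trans (mul_le_of_le_one_right (pr_nonneg _ _) hp.2) ?_
      exact pr_conn_layer k p q j S 0 (plane.tl d)
    have fle : ∀ d : EdgeIdx × Bool, d.1.2 = 2 → f d ≤ q := by
      intro d hd
      simp only [hf, sp, hd, if_true]
      exact mul_le_of_le_one_left hq.1 (pr_le_one _ _)
    have e2 : ∑ d ∈ S.image (upD j), f d ≤ S.card * q := by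
      rw [sum_image_le' _ _ (upD_inj j), ← nsmul_eq_mul]
      exact Finset.sum_le_card_nsmul _ _ _ fun x _ => fle _ rfl
    have e3 : ∑ d ∈ S.image (dnD j), f d ≤ S.card * q := by
      rw [sum_image_le' _ _ (dnD_inj j), ← nsmul_eq_mul]
      exact Finset.sum_le_card_nsmul _ _ _ fun x _ => fle _ rfl
    have := sum_union_le (S.image (upD j)) (S.image (dnD j)) f hf0
    linarith
  calc _ ≤ ∑ d ∈ D.filter (fun d => (slabG k).tl d ∈ S' ∧ (slabG k).hd d ∉ S'), f d * M := by
        refine Finset.sum_le_sum fun d hd => ?_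
        obtain ⟨_, h1, h2⟩ := Finset.mem_filter.1 hd
        exact mul_le_mul_of_nonneg_left (bnd d h1 h2) (hf0 d)
    _ ≤ ∑ d ∈ D, f d * M :=
        Finset.sum_le_sum_of_subset_of_nonneg (Finset.filter_subset _ _)
          fun d _ _ => mul_nonneg (hf0 d) hM0
    _ = (∑ d ∈ D, f d) * M := by rw [Finset.sum_mul]
    _ ≤ _ := mul_le_mul_of_nonneg_right s1 hM0

lemma H1_holds (k : ℕ) {b : ℝ} (hb0 : 0 < b) (hb1 : b < 1 / 2) :
    ∃ q, 0 < q ∧ q ≤ 1 ∧ theta k b q = 0 := by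
  obtain ⟨n, S, hS, h0, hlt⟩ := phi_small hb0 hb1
  set c := ∑ d ∈ plane.outD (F2 n) S, pr (fun _ => b) {ω | plane.Conn ω S 0 (plane.tl d)} with hc
  have hc0 : 0 ≤ c := Finset.sum_nonneg fun _ _ => pr_nonneg _ _
  set m : ℝ := (S.card : ℝ) with hm
  have hm0 : 0 ≤ m := Nat.cast_nonneg _
  set q := (1 - c) / (2 * (m + 1)) with hq
  have hq0 : 0 < q := div_pos (by linarith) (by linarith)
  have hqe : q * (2 * (m + 1)) = 1 - c := div_mul_cancel₀ _ (by positivity)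
  have hq1 : q ≤ 1 := by nlinarith
  refine ⟨q, hq0, hq1, ?_⟩
  set r := c + 2 * m * q with hr
  have hr0 : 0 ≤ r := by positivity
  have hr1 : r < 1 := by nlinarith
  have iter : ∀ i : ℕ, ∀ j : ℤ, 0 ≤ j → j ≤ k → tj k (i * n) b q j ≤ r ^ i := by
    intro i
    induction i with
    | zero => intro j _ _; simpa [tj] using pr_le_one _ _
    | succ i ih =>
      intro j h1 h2
      have hb1' : b ≤ 1 := by linarith
      rw [Nat.succ_mul, pow_succ, mul_comm (r ^ i) r]
      exact slab_step ⟨hb0.le, hb1'⟩ ⟨hq0.le, hq1⟩ hS h0 le_rfl (i * n) (by positivity) ih j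
        ⟨h1, h2⟩
  rw [theta_zero_iff]
  intro ε hε
  obtain ⟨i, hi⟩ := exists_pow_lt_of_lt_one hε hr1
  exact ⟨i * n, lt_of_le_of_lt (iter i 0 le_rfl (by positivity)) hi⟩
end

section
open ProbabilityTheory Relation

/-! ### Large vertical density: percolation -/

/-- Master index: a planar edge, a kind (`0` horizontal, `1`, `2` auxiliary), and a height. -/
abbrev MI : Type := E2 × Fin 3 × ℤ

/-- The slab edge to which a master variable belongs. -/
def own (m : MI) : EdgeIdx :=
  if m.2.1 = 0 then lfE m.2.2 m.1
  else if m.2.1 = 1 then (lf m.2.2 m.1.1, 2) else (lf m.2.2 (m.1.1 + dv m.1.2), 2)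

/-- Parameters of the master variables. -/
noncomputable def QM (a r : ℝ) (m : MI) : ℝ := if m.2.1 = 0 then a else r

open Classical in
/-- Slab configuration built from the master variables. -/
noncomputable def Xs (e : EdgeIdx) (ω : MI → Bool) : Bool := decide (∃ m, own m = e ∧ ω m = true)

open Classical in
/-- Planar configuration built from the master variables. -/
noncomputable def Xp (k : ℕ) (e : E2) (ω : MI → Bool) : Bool :=
  decide ((∃ j ∈ Finset.Icc (0 : ℤ) k, ω (e, 0, j) = true) ∧
    ∀ m ∈ ({1, 2} : Finset (Fin 3)) ×ˢ Finset.Ico (0 : ℤ) k, ω (e, m) = true)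

lemma Xs_det (e : EdgeIdx) : Det {m | own m = e} {ω | Xs e ω = true} := by
  have : {ω | Xs e ω = true} = ⋃ m : {m // own m = e}, {ω : MI → Bool | ω m = true} := by
    ext ω; simp [Xs]
  rw [this]
  refine Det.iUnion fun m => (det_coord _ _).mono ?_
  simpa using m.2

lemma Xs_meas (e : EdgeIdx) : MeasurableSet {ω | Xs e ω = true} := by
  have : {ω | Xs e ω = true} = ⋃ m : {m // own m = e}, {ω : MI → Bool | ω m = true} := by
    ext ω; simp [Xs]
  rw [this]
  exact MeasurableSet.iUnion fun m => measurableSet_coord _ _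

lemma pr_all {E : Type*} (P : E → ℝ) (s : Finset E) (b : Bool) :
    pr P {ω | ∀ m ∈ s, ω m = b} = ∏ m ∈ s, pr P {ω | ω m = b} := by
  rw [← indep_family P s (fun m => {m}) (fun m => {ω | ω m = b}) (fun m => det_coord m b)
    (fun m => measurableSet_coord m b) (fun i _ j _ h => by simpa using h)]
  congr 1
  ext ω; simp

lemma meas_all {E : Type*} (s : Finset E) (b : Bool) :
    MeasurableSet {ω : E → Bool | ∀ m ∈ s, ω m = b} := by
  have : {ω : E → Bool | ∀ m ∈ s, ω m = b} = ⋂ m ∈ s, {ω | ω m = b} := by ext; simp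
  rw [this]
  exact Finset.measurableSet_biInter _ fun m _ => measurableSet_coord _ _

lemma det_all {E : Type*} (s : Finset E) (b : Bool) :
    Det (s : Set E) {ω : E → Bool | ∀ m ∈ s, ω m = b} := by
  have : {ω : E → Bool | ∀ m ∈ s, ω m = b} = ⋂ m : s, {ω | ω m = b} := by ext; simp
  rw [this]
  exact Det.iInter fun m => (det_coord _ _).mono (by simp)

lemma ex_eq {E : Type*} (s : Finset E) :
    {ω : E → Bool | ∃ m ∈ s, ω m = true} = {ω | ∀ m ∈ s, ω m = false}ᶜ := by
  ext ω; simp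

lemma pr_ex {E : Type*} (P : E → ℝ) (s : Finset E) (c : ℝ) (h0 : 0 ≤ c) (h1 : c ≤ 1)
    (hP : ∀ m ∈ s, P m = c) : pr P {ω | ∃ m ∈ s, ω m = true} = 1 - (1 - c) ^ s.card := by
  rw [ex_eq, pr_compl _ (meas_all _ _), pr_all]
  congr 1
  refine Finset.prod_eq_pow_card fun m hm => ?_
  rw [pr_coord_false (by rw [hP m hm]; exact h0) (by rw [hP m hm]; exact h1), hP m hm]

lemma pr_all_true {E : Type*} (P : E → ℝ) (s : Finset E) (c : ℝ) (h0 : 0 ≤ c) (h1 : c ≤ 1)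
    (hP : ∀ m ∈ s, P m = c) : pr P {ω | ∀ m ∈ s, ω m = true} = c ^ s.card := by
  rw [pr_all]
  refine Finset.prod_eq_pow_card fun m hm => ?_
  rw [pr_coord_true (by rw [hP m hm]; exact h0) (by rw [hP m hm]; exact h1), hP m hm]

lemma Xs_pr {a r : ℝ} (ha : 0 ≤ a ∧ a ≤ 1) (hr : 0 ≤ r ∧ r ≤ 1) (e : EdgeIdx) :
    pr (QM a r) {ω | Xs e ω = true} = sp a (1 - (1 - r) ^ 4) e := by
  obtain ⟨⟨x, y, z⟩, i⟩ := e
  have key : ∀ s : Finset MI, (∀ m, m ∈ s ↔ own m = ((x, y, z), i)) →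
      {ω | Xs ((x, y, z), i) ω = true} = {ω | ∃ m ∈ s, ω m = true} := by
    intro s hs
    ext ω
    simp [Xs, hs]
  fin_cases i
  · have := key {(((x, y), false), 0, z)} (by
      rintro ⟨⟨⟨x', y'⟩, b⟩, t, j⟩
      fin_cases t <;> cases b <;> simp [own, lfE, lf, and_assoc])
    refine (congrArg _ this).trans ?_
    rw [pr_ex _ _ a ha.1 ha.2 (by simp [QM])]
    simp [sp]
  · have := key {(((x, y), true), 0, z)} (by
      rintro ⟨⟨⟨x', y'⟩, b⟩, t, j⟩
      fin_cases t <;> cases b <;> simp [own, lfE, lf, and_assoc])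
    refine (congrArg _ this).trans ?_
    rw [pr_ex _ _ a ha.1 ha.2 (by simp [QM])]
    simp [sp]
  · have := key {(((x, y), false), 1, z), (((x, y), true), 1, z), (((x - 1, y), false), 2, z),
        (((x, y - 1), true), 2, z)} (by
      rintro ⟨⟨⟨x', y'⟩, b⟩, t, j⟩
      fin_cases t <;> cases b <;> simp [own, lfE, lf, and_assoc] <;> omega)
    refine (congrArg _ this).trans ?_
    rw [pr_ex _ _ r hr.1 hr.2 (by simp [QM])]
    rw [Finset.card_insert_of_notMem (by simp), Finset.card_insert_of_notMem (by simp),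
      Finset.card_insert_of_notMem (by simp), Finset.card_singleton]
    simp [sp]

/-- Horizontal variables over a planar edge. -/
noncomputable def hs (k : ℕ) (e : E2) : Finset MI := (Finset.Icc (0 : ℤ) k).image fun j => (e, 0, j)
/-- Auxiliary variables of a planar edge. -/
noncomputable def xs (k : ℕ) (e : E2) : Finset MI :=
  (({1, 2} : Finset (Fin 3)) ×ˢ Finset.Ico (0 : ℤ) k).image fun m => (e, m)

lemma Xp_eq (k : ℕ) (e : E2) : {ω | Xp k e ω = true} =
    {ω | ∃ m ∈ hs k e, ω m = true} ∩ {ω | ∀ m ∈ xs k e, ω m = true} := by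
  ext ω
  simp only [Xp, decide_eq_true_eq, mem_ofPred_eq, mem_inter_iff, hs, xs, Finset.exists_mem_image,
    Finset.forall_mem_image]

lemma ex_det {E : Type*} (s : Finset E) : Det (s : Set E) {ω : E → Bool | ∃ m ∈ s, ω m = true} := by
  rw [ex_eq]; exact (det_all _ _).compl

lemma ex_meas {E : Type*} (s : Finset E) : MeasurableSet {ω : E → Bool | ∃ m ∈ s, ω m = true} := by
  rw [ex_eq]; exact (meas_all _ _).compl

lemma Xp_det (k : ℕ) (e : E2) : Det {m | m.1 = e} {ω | Xp k e ω = true} := by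
  rw [Xp_eq]
  refine ((ex_det _).inter (det_all _ _)).mono ?_
  intro m hm
  simp only [hs, xs, Finset.coe_image, mem_union, mem_image] at hm
  rcases hm with ⟨_, _, rfl⟩ | ⟨_, _, rfl⟩ <;> rfl

lemma Xp_meas (k : ℕ) (e : E2) : MeasurableSet {ω | Xp k e ω = true} := by
  rw [Xp_eq]
  exact (ex_meas _).inter (meas_all _ _)

lemma Xp_pr (k : ℕ) {a r : ℝ} (ha : 0 ≤ a ∧ a ≤ 1) (hr : 0 ≤ r ∧ r ≤ 1) (e : E2) :
    pr (QM a r) {ω | Xp k e ω = true} = (1 - (1 - a) ^ (k + 1)) * r ^ (2 * k) := by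
  rw [Xp_eq, pr_inter_of_det _ (ex_det _) (det_all _ _) ?_ (ex_meas _) (meas_all _ _),
    pr_ex _ _ a ha.1 ha.2 ?_, pr_all_true _ _ r hr.1 hr.2 ?_]
  · congr 2
    · congr 1
      rw [hs, Finset.card_image_of_injective _ (fun _ _ h => by simpa using h)]
      simp
    · rw [xs, Finset.card_image_of_injective _ (fun _ _ h => by simpa using h)]
      simp
  · intro m hm
    simp only [xs, Finset.mem_image, Finset.mem_product, Finset.mem_insert,
      Finset.mem_singleton] at hm
    obtain ⟨⟨t, j⟩, ⟨ht, _⟩, rfl⟩ := hm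
    rcases ht with h | h <;> simp only at h <;> subst h <;> simp [QM]
  · intro m hm
    simp only [hs, Finset.mem_image] at hm
    obtain ⟨j, _, rfl⟩ := hm
    simp [QM]
  · rw [Set.disjoint_left]
    intro m hm hm'
    simp only [hs, xs, Finset.coe_image, mem_image] at hm hm'
    obtain ⟨j, _, rfl⟩ := hm
    obtain ⟨⟨t, j'⟩, ht, h⟩ := hm'
    simp only [Prod.mk.injEq, true_and] at h
    have := (Finset.mem_product.1 (Finset.mem_coe.1 ht)).1
    rw [h.1] at this
    simp at this

lemma measurable_of_coord {M E : Type*} (X : E → (M → Bool) → Bool)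
    (h : ∀ e, MeasurableSet {ω | X e ω = true}) : Measurable fun ω e => X e ω := by
  refine measurable_pi_lambda _ fun e => ?_
  refine measurable_to_bool ?_
  exact h e

/-- Columns with all vertical edges open are connected. -/
lemma column {k : ℕ} {ω : Config} {y : ℤ × ℤ}
    (h : ∀ j : ℤ, 0 ≤ j → j < k → ω (lf j y, 2) = true) (j : ℕ) (hj : j ≤ k) :
    (slabG k).Conn ω univ (lf 0 y) (lf j y) := by
  induction j with
  | zero => exact .refl _
  | succ j ih =>
    refine (ih (by omega)).trans ?_
    have hE : IsEdge k (lf j y, 2) := by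
      simp only [IsEdge, InSlab, lf, dvec, Prod.mk_add_mk]
      omega
    exact (slab_ends k hE rfl (by simp [lf, dvec])).conn (h j (by omega) (by omega))

lemma plane_to_slab {k : ℕ} {ω : MI → Bool} {y : ℤ × ℤ}
    (h : plane.Conn (fun e => Xp k e ω) univ 0 y) :
    (slabG k).Conn (fun e => Xs e ω) univ (lf 0 0) (lf 0 y) := by
  induction h with
  | refl => exact .refl _
  | tail _ h ih =>
    refine ih.trans ?_
    obtain ⟨_, _, hadj⟩ := h
    obtain ⟨e, he, h⟩ := Gr.adj_iff.1 hadj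
    have key : (slabG k).Conn (fun e => Xs e ω) univ (lf 0 (plane.s e)) (lf 0 (plane.t e)) := by
      simp only [Xp, decide_eq_true_eq] at he
      obtain ⟨⟨j, hj, hjo⟩, haux⟩ := he
      rw [Finset.mem_Icc] at hj
      have c1 := column (k := k) (ω := fun e => Xs e ω) (y := plane.s e) (fun i h0 h1 => by
        simp only [Xs, decide_eq_true_eq]
        exact ⟨(e, 1, i), by simp [own], haux (1, i) (by simp [h0, h1])⟩) j.toNat (by omega)
      have c2 := column (k := k) (ω := fun e => Xs e ω) (y := plane.t e) (fun i h0 h1 => by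
        simp only [Xs, decide_eq_true_eq]
        exact ⟨(e, 2, i), by simp [own], haux (2, i) (by simp [h0, h1])⟩) j.toNat (by omega)
      have hjj : ((j.toNat : ℕ) : ℤ) = j := Int.toNat_of_nonneg hj.1
      rw [hjj] at c1 c2
      refine c1.trans (Gr.Conn.trans ?_ c2.symm)
      have := Gr.adj_edge (G := slabG k) (ω := fun e => Xs e ω) (e := lfE j e) (by
        simp only [Xs, decide_eq_true_eq]
        exact ⟨(e, 0, j), by simp [own], hjo⟩)
      rw [lfE_s, lfE_t hj] at this
      exact .single trivial trivial this
    rcases h with ⟨rfl, rfl⟩ | ⟨rfl, rfl⟩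
    · exact key
    · exact key.symm

lemma th_ge_tp (k n : ℕ) {a r : ℝ} (ha : 0 ≤ a ∧ a ≤ 1) (hr : 0 ≤ r ∧ r ≤ 1) :
    tp n ((1 - (1 - a) ^ (k + 1)) * r ^ (2 * k)) ≤ th k n a (1 - (1 - r) ^ 4) := by
  have m1 := map_blocks (QM a r) (Xp k) (fun e => {m | m.1 = e}) (Xp_meas k) (Xp_det k)
    (fun e e' h => by
      show Disjoint _ _
      rw [Set.disjoint_left]
      intro m h1 h2
      exact h ((show m.1 = e from h1).symm.trans h2))
    (fun _ => (1 - (1 - a) ^ (k + 1)) * r ^ (2 * k))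
    (fun e => by rw [← Xp_pr k ha hr e]; exact pr_nonneg _ _)
    (fun e => by rw [← Xp_pr k ha hr e]; exact pr_le_one _ _) (Xp_pr k ha hr)
  have m2 := map_blocks (QM a r) Xs (fun e => {m | own m = e}) Xs_meas Xs_det
    (fun e e' h => by
      show Disjoint _ _
      rw [Set.disjoint_left]
      intro m h1 h2
      exact h ((show own m = e from h1).symm.trans h2))
    (sp a (1 - (1 - r) ^ 4))
    (fun e => by rw [← Xs_pr ha hr e]; exact pr_nonneg _ _)
    (fun e => by rw [← Xs_pr ha hr e]; exact pr_le_one _ _) (Xs_pr ha hr)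
  rw [tp, th, pr_map (measurable_of_coord _ (Xp_meas k)) m1 (Gr.measurable_hit _ _ _),
    pr_map (measurable_of_coord _ Xs_meas) m2 (slabA_meas k n)]
  refine pr_mono _ ?_
  rintro ω ⟨y, hy, hc⟩
  refine ⟨lf 0 y, ?_, plane_to_slab hc⟩
  intro h
  exact hy ⟨h.2.1, h.2.2⟩

lemma H2_holds (k : ℕ) {a : ℝ} (ha : pCrit k < a) (ha0 : 0 ≤ a) (ha1 : a < 1) :
    ∃ q, 0 ≤ q ∧ q < 1 ∧ theta k a q ≠ 0 := by
  have hpow : (1 - a) ^ (k + 1) < 1 / 2 := by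
    have h1 : 1 - a < (1 / 2 : ℝ) ^ ((1 : ℝ) / (k + 1)) := by
      have := ha; unfold pCrit at this; linarith
    have h2 : ((1 / 2 : ℝ) ^ ((1 : ℝ) / (k + 1))) ^ (k + 1) = 1 / 2 := by
      rw [← Real.rpow_natCast, ← Real.rpow_mul (by norm_num)]
      have : (1 : ℝ) / (k + 1) * ((k + 1 : ℕ) : ℝ) = 1 := by
        push_cast; field_simp
      rw [this, Real.rpow_one]
    calc (1 - a) ^ (k + 1) < ((1 / 2 : ℝ) ^ ((1 : ℝ) / (k + 1))) ^ (k + 1) :=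
          pow_lt_pow_left₀ h1 (by linarith) (by omega)
      _ = 1 / 2 := h2
  have hpos : 0 < (1 - a) ^ (k + 1) := pow_pos (by linarith) _
  set A := 1 - (1 - a) ^ (k + 1) with hA
  have hA1 : A < 1 := by linarith
  set δ := (A - 1 / 2) / (2 * k + 1) with hδ
  have hk : (0 : ℝ) ≤ k := Nat.cast_nonneg _
  have hδ0 : 0 < δ := div_pos (by linarith) (by positivity)
  have hδe : δ * (2 * k + 1) = A - 1 / 2 := div_mul_cancel₀ _ (by positivity)
  have hδ1 : δ ≤ 1 / 2 := by nlinarith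
  have hb : 1 - 2 * k * δ ≤ (1 - δ) ^ (2 * k) := by
    have := one_add_mul_le_pow (a := -δ) (by linarith) (2 * k)
    push_cast at this
    have e : 1 + -δ = 1 - δ := by ring
    rw [e] at this
    linarith
  have hle1 : (1 - δ) ^ (2 * k) ≤ 1 := pow_le_one₀ (by linarith) (by linarith)
  have hge0 : 0 ≤ (1 - δ) ^ (2 * k) := pow_nonneg (by linarith) _
  set p1 := A * (1 - δ) ^ (2 * k) with hp1
  have h1 : 1 / 2 < p1 := by nlinarith [mul_nonneg hk hδ0.le]
  have h2 : p1 < 1 := by nlinarith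
  have hq1 : 0 < (1 - (1 - δ)) ^ 4 := by
    have : 1 - (1 - δ) = δ := by ring
    rw [this]; positivity
  have hq2 : (1 - (1 - δ)) ^ 4 ≤ 1 := pow_le_one₀ (by linarith) (by linarith)
  refine ⟨1 - (1 - (1 - δ)) ^ 4, by linarith, by linarith, ?_⟩
  intro h0
  rw [theta_zero_iff] at h0
  have hexp : Real.exp (-(p1 - 1 / 2)) < 1 := Real.exp_lt_one_iff.2 (by linarith)
  obtain ⟨n, hn⟩ := h0 (1 - Real.exp (-(p1 - 1 / 2))) (by linarith)
  have hn1 := lt_of_le_of_lt (th_antitone k a (1 - (1 - (1 - δ)) ^ 4) (Nat.le_succ n)) hn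
  have h3 := th_ge_tp k (n + 1) (a := a) (r := 1 - δ) ⟨ha0, ha1.le⟩ ⟨by linarith, by linarith⟩
  have h4 := tp_above h1 h2 (n := n + 1) (by omega)
  have := h4.trans h3
  exact absurd hn1 (not_lt.2 this)
end

section
open ProbabilityTheory Relation

lemma qc_le_of (k : ℕ) {p q : ℝ} (hp : 0 ≤ p) (hp1 : p ≤ 1) (hq : 0 ≤ q)
    (h : theta k p q ≠ 0) : qc k p ≤ q := by
  refine Real.sSup_le ?_ hq
  rintro r ⟨⟨r0, r1⟩, hr⟩
  by_contra hlt
  push Not at hlt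
  exact h (theta_zero_of_le k (fun n => th_mono k n hp hq le_rfl hlt.le hp1 r1) hr)

lemma le_qc_of (k : ℕ) {p q : ℝ} (hq : 0 ≤ q) (hq1 : q ≤ 1)
    (h : theta k p q = 0) : q ≤ qc k p :=
  le_csSup ⟨1, fun _ hr => hr.1.2⟩ ⟨⟨hq, hq1⟩, h⟩

lemma theta_zero_of_lt_qc (k : ℕ) {p q : ℝ} (hp : 0 ≤ p) (hp1 : p ≤ 1) (hq : 0 ≤ q)
    (h : q < qc k p) : theta k p q = 0 := by
  by_contra h'
  exact absurd (qc_le_of k hp hp1 hq h') (not_le.2 h)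

lemma pCrit_nonneg (k : ℕ) : 0 ≤ pCrit k := by
  unfold pCrit
  have : (1 / 2 : ℝ) ^ ((1 : ℝ) / (k + 1)) ≤ 1 :=
    Real.rpow_le_one (by norm_num) (by norm_num) (by positivity)
  linarith

lemma final_of (k : ℕ) (a b : ℝ)
    (ha : pCrit k < a) (hab : a ≤ b) (hb : b < 1 / 2)
    (H1 : ∃ q, 0 < q ∧ q ≤ 1 ∧ theta k b q = 0)
    (H2 : ∃ q, 0 ≤ q ∧ q < 1 ∧ theta k a q ≠ 0) :
    ∃ φ ∈ Set.Ioo (0 : ℝ) (Real.pi / 2), ∃ ψ ∈ Set.Ioo (0 : ℝ) (Real.pi / 2),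
      ∃ ε : ℝ, 0 < ε ∧
        ∀ p ∈ Set.Icc a b, ∀ p' ∈ Set.Icc a b, p < p' → |p' - p| ≤ ε →
          |p' - p| * Real.tan φ ≤ |qc k p' - qc k p| ∧
          |qc k p' - qc k p| ≤ |p' - p| * Real.tan ψ := by
  have ha0 : 0 < a := (pCrit_nonneg k).trans_lt ha
  have hk : 1 ≤ k := by
    by_contra hk
    obtain rfl : k = 0 := by omega
    norm_num [pCrit] at ha
    linarith
  obtain ⟨q1, q10, q11, hq1⟩ := H1
  obtain ⟨q2, q20, q21, hq2⟩ := H2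
  have hq1qc : ∀ p ∈ Icc a b, q1 ≤ qc k p := fun p hp =>
    le_qc_of k q10.le q11 (theta_zero_of_le k
      (fun n => th_mono k n (ha0.le.trans hp.1) q10.le hp.2 le_rfl (by linarith) q11) hq1)
  have hq2qc : ∀ p ∈ Icc a b, qc k p ≤ q2 := fun p hp =>
    qc_le_of k (ha0.le.trans hp.1) (by linarith [hp.2]) q20 fun h => hq2 (theta_zero_of_le k
      (fun n => th_mono k n ha0.le q20 hp.1 le_rfl (by linarith [hp.2]) q21.le) h)
  obtain ⟨κ, hκ, k1, k2, k3, k4⟩ : ∃ κ : ℝ, 0 < κ ∧ κ ≤ a ∧ κ ≤ 1 - b ∧ κ ≤ q1 / 2 ∧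
      κ ≤ (1 - q2) / 2 := by
    refine ⟨min (min a (1 - b)) (min (q1 / 2) ((1 - q2) / 2)), ?_, ?_, ?_, ?_, ?_⟩
    · refine lt_min (lt_min ha0 (by linarith)) (lt_min (by linarith) (by linarith))
    · exact (min_le_left _ _).trans (min_le_left _ _)
    · exact (min_le_left _ _).trans (min_le_right _ _)
    · exact (min_le_right _ _).trans (min_le_left _ _)
    · exact (min_le_right _ _).trans (min_le_right _ _)
  have hκ1 : κ ≤ 1 := by linarith
  set C : ℝ := 8 * (2 / κ) ^ 24 with hC
  have hC1 : 1 ≤ C := by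
    have h2 : 1 ≤ 2 / κ := by rw [le_div_iff₀ hκ]; linarith
    have := one_le_pow₀ h2 (n := 24)
    linarith
  have hC0 : 0 < C := by linarith
  refine ⟨Real.arctan (1 / C), ⟨?_, Real.arctan_lt_pi_div_two _⟩, Real.arctan C,
    ⟨?_, Real.arctan_lt_pi_div_two _⟩, κ, hκ, ?_⟩
  · rw [Real.arctan_pos]; positivity
  · rw [Real.arctan_pos]; positivity
  rw [Real.tan_arctan, Real.tan_arctan]
  intro p hp p' hp' hlt hε
  rw [abs_of_pos (by linarith : 0 < p' - p)] at hε ⊢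
  have up : qc k p ≤ qc k p' + C * (p' - p) := by
    by_contra hcon
    push Not at hcon
    obtain ⟨q, h1, h2⟩ := exists_between (show qc k p' < qc k p - C * (p' - p) by linarith)
    have h3 := hq1qc p' hp'
    have h4 := hq2qc p hp
    have hCt : 0 ≤ C * (p' - p) := mul_nonneg hC0.le (by linarith)
    have h0 := theta_zero_of_lt_qc k (p := p) (q := q + C * (p' - p)) (by linarith [hp.1])
      (by linarith [hp.2]) (by linarith) (by linarith)
    have h5 : theta k p' q = 0 := by
      refine theta_zero_of_le k (fun n => ?_) h0
      have := th_trade_q k n hk (p := p') (q := q) (t := p' - p) hκ hκ1 (by linarith)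
        ⟨⟨by linarith [hp'.1], by linarith [hp'.2]⟩, by linarith, by linarith⟩
        (by linarith [hp.1]) (by rw [← hC]; linarith)
      rw [← hC] at this
      simpa using this
    have := le_qc_of k (p := p') (q := q) (by linarith) (by linarith) h5
    linarith
  have lo : qc k p' + (p' - p) / C ≤ qc k p := by
    set s := (p' - p) / C with hs
    have hs0 : 0 < s := div_pos (by linarith) hC0
    have hCs : C * s = p' - p := by rw [hs]; field_simp
    have hsκ : s ≤ κ := by
      rw [hs, div_le_iff₀ hC0]; nlinarith
    by_contra hcon
    push Not at hcon
    obtain ⟨r, h1, h2⟩ := exists_between (show max (qc k p - s) (q1 / 2) < qc k p' from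
      max_lt (by linarith) (by linarith [hq1qc p' hp']))
    have h3 := (le_max_left _ _).trans_lt h1
    have h3' := (le_max_right _ _).trans_lt h1
    have h4 := hq2qc p' hp'
    have h0 := theta_zero_of_lt_qc k (p := p') (q := r) (by linarith [hp'.1])
      (by linarith [hp'.2]) (by linarith) h2
    have h5 : theta k p (r + s) = 0 := by
      refine theta_zero_of_le k (fun n => ?_) h0
      have := th_trade_p k n (p := p) (q := r + s) (t := s) hκ hκ1 hs0.le
        ⟨⟨by linarith [hp.1], by linarith [hp.2]⟩, by linarith, by linarith⟩
        (by linarith) (by rw [← hC, hCs]; linarith [hp'.2])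
      rw [← hC, hCs] at this
      simpa using this
    have := le_qc_of k (p := p) (q := r + s) (by linarith) (by linarith) h5
    linarith
  have hs0 : 0 < (p' - p) / C := div_pos (by linarith) hC0
  rw [abs_sub_comm, abs_of_pos (by linarith)]
  constructor
  · rw [mul_one_div]; linarith
  · linarith
end

/-- Local bi-Lipschitz bounds for `q_c` on compacts `[a,b] ⊂ (p_k, 1/2)`:
there are `φ, ψ ∈ (0, π/2)` and `ε > 0` such that
`|p'-p| tan φ ≤ |q_c(p') - q_c(p)| ≤ |p'-p| tan ψ` whenever
`p < p'` in `[a,b]` with `|p'-p| ≤ ε`. -/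
theorem qc_local_bilipschitz (k : ℕ) (a b : ℝ)
    (ha : pCrit k < a) (hab : a ≤ b) (hb : b < 1 / 2) :
    ∃ φ ∈ Set.Ioo (0 : ℝ) (Real.pi / 2), ∃ ψ ∈ Set.Ioo (0 : ℝ) (Real.pi / 2),
      ∃ ε : ℝ, 0 < ε ∧
        ∀ p ∈ Set.Icc a b, ∀ p' ∈ Set.Icc a b, p < p' → |p' - p| ≤ ε →
          |p' - p| * Real.tan φ ≤ |qc k p' - qc k p| ∧
          |qc k p' - qc k p| ≤ |p' - p| * Real.tan ψ := by
  have ha0 : 0 < a := (pCrit_nonneg k).trans_lt ha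
  exact final_of k a b ha hab hb (H1_holds k (by linarith) hb) (H2_holds k ha ha0.le (by linarith))

end AnisoSlab
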